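/- Let n be an integer with 2 ≤ n ≤ 40 and u an integer with -18 ≤ u ≤ -2. Then the Galois group of 𝓛_n^{(u)}(x) over ℚ is isomorphic to the symmetric group S_n, except when (n,u) ∈ {(8,-5),(8,-6),(9,-5),(9,-6),(16,-9),(16,-10),(24,-13),(24,-14),(25,-13),(25,-14),(32,-17),(32,-18)}, in which cases the Galois group is isomorphic to the alternating group A_n. -/

import Mathlib

open Polynomial Finset

/-- The polynomial `𝓛_n^{(u)}(x) = ∑_{j=0}^n C(n,j) (∏_{i=j+1}^n (1+2(u+i))) xʲ`,
viewed as a polynomial over `ℚ` (it has integer coefficients). -/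
noncomputable def lcal (n : ℕ) (u : ℤ) : Polynomial ℚ :=
  ∑ j ∈ Finset.range (n + 1),
    Polynomial.C ((n.choose j : ℚ) * ∏ i ∈ Finset.Icc (j + 1) n, (1 + 2 * ((u : ℚ) + (i : ℚ))))
      * Polynomial.X ^ j

/-- The exceptional set of pairs `(n, u)`. -/
def exceptionalSet : Set (ℤ × ℤ) :=
  {(8, -5), (8, -6), (9, -5), (9, -6), (16, -9), (16, -10), (24, -13), (24, -14),
    (25, -13), (25, -14), (32, -17), (32, -18)}

/-- `[l, r]` is the face of the Newton polygon of `f` in direction `t`. -/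
structure Seg {K Γ : Type*} [Field K] [LinearOrderedCommGroupWithZero Γ] (v : Valuation K Γ) (t : Γ)
    (f : K[X]) (l r : ℕ) (M : Γ) : Prop where
  hM : M ≠ 0
  le : ∀ j, v (f.coeff j) * t ^ j ≤ M
  left : v (f.coeff l) * t ^ l = M
  right : v (f.coeff r) * t ^ r = M
  ltl : ∀ j < l, v (f.coeff j) * t ^ j < M
  ltr : ∀ j, r < j → v (f.coeff j) * t ^ j < M

section
variable {K Γ : Type*} [Field K] [LinearOrderedCommGroupWithZero Γ] {v : Valuation K Γ} {t : Γ}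

theorem Seg.l_le_r {f : K[X]} {l r : ℕ} {M : Γ} (h : Seg v t f l r M) : l ≤ r := by
  by_contra hc
  exact absurd h.right (h.ltl r (by omega)).ne

theorem Seg.r_le {f : K[X]} {l r : ℕ} {M : Γ} (h : Seg v t f l r M) : r ≤ f.natDegree := by
  apply le_natDegree_of_ne_zero
  intro h0
  have := h.right
  rw [h0, map_zero, zero_mul] at this
  exact h.hM this.symm

theorem Seg.unique {f : K[X]} {l r l' r' : ℕ} {M M' : Γ} (h : Seg v t f l r M)
    (h' : Seg v t f l' r' M') : l = l' ∧ r = r' := by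
  have hM : M = M' := le_antisymm (h.left ▸ h'.le l) (h'.left ▸ h.le l')
  subst hM
  refine ⟨?_, ?_⟩
  · rcases lt_trichotomy l l' with hl | hl | hl
    · exact absurd h.left (h'.ltl l hl).ne
    · exact hl
    · exact absurd h'.left (h.ltl l' hl).ne
  · rcases lt_trichotomy r r' with hl | hl | hl
    · exact absurd h'.right (h.ltr r' hl).ne
    · exact hl
    · exact absurd h.right (h'.ltr r hl).ne

theorem Seg.exists (ht : t ≠ 0) {f : K[X]} (hf : f ≠ 0) : ∃ l r M, Seg v t f l r M := by
  classical
  have hs : f.support.Nonempty := by simpa [Finset.nonempty_iff_ne_empty] using hf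
  obtain ⟨i, hi, hmax⟩ := f.support.exists_max_image (fun j => v (f.coeff j) * t ^ j) hs
  set M := v (f.coeff i) * t ^ i with hMdef
  have hM : M ≠ 0 := mul_ne_zero ((Valuation.ne_zero_iff v).mpr (mem_support_iff.mp hi))
    (pow_ne_zero _ ht)
  have hle : ∀ j, v (f.coeff j) * t ^ j ≤ M := by
    intro j
    by_cases hj : j ∈ f.support
    · exact hmax j hj
    · rw [notMem_support_iff.mp hj]; simp
  let S := f.support.filter (fun j => v (f.coeff j) * t ^ j = M)
  have hS : S.Nonempty := ⟨i, by simp only [S, Finset.mem_filter]; exact ⟨hi, rfl⟩⟩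
  have hmem : ∀ j, v (f.coeff j) * t ^ j = M → j ∈ S := by
    intro j hj
    simp only [S, Finset.mem_filter, mem_support_iff]
    refine ⟨?_, hj⟩
    intro h0
    rw [h0, map_zero, zero_mul] at hj
    exact hM hj.symm
  refine ⟨S.min' hS, S.max' hS, M, hM, hle, ?_, ?_, ?_, ?_⟩
  · exact (Finset.mem_filter.mp (S.min'_mem hS)).2
  · exact (Finset.mem_filter.mp (S.max'_mem hS)).2
  · intro j hj
    refine lt_of_le_of_ne (hle j) fun h => ?_
    exact absurd (S.min'_le j (hmem j h)) (by omega)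
  · intro j hj
    refine lt_of_le_of_ne (hle j) fun h => ?_
    exact absurd (S.le_max' j (hmem j h)) (by omega)

/-- a sum over the antidiagonal with one dominating term -/
theorem seg_aux (ht : t ≠ 0) {f g : K[X]} {N : Γ} {k i₀ j₀ : ℕ} (hk : i₀ + j₀ = k)
    (heq : v (f.coeff i₀) * t ^ i₀ * (v (g.coeff j₀) * t ^ j₀) = N)
    (hlt : ∀ i j, i + j = k → (i, j) ≠ (i₀, j₀) →
      v (f.coeff i) * t ^ i * (v (g.coeff j) * t ^ j) < N) :
    v ((f * g).coeff k) * t ^ k = N := by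
  have htk : 0 < t ^ k := zero_lt_iff.mpr (pow_ne_zero _ ht)
  have key : ∀ i j, i + j = k → v (f.coeff i) * t ^ i * (v (g.coeff j) * t ^ j) =
      v (f.coeff i * g.coeff j) * t ^ k := by
    intro i j hij
    rw [← hij, pow_add, map_mul]
    exact mul_mul_mul_comm _ _ _ _
  rw [coeff_mul, ← Finset.add_sum_erase _ _ (show (i₀, j₀) ∈ Finset.HasAntidiagonal.antidiagonal k from
    Finset.HasAntidiagonal.mem_antidiagonal.mpr hk)]
  have hb : v (f.coeff i₀ * g.coeff j₀) * t ^ k = N := by rw [← key _ _ hk, heq]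
  by_cases h0 : v (f.coeff i₀ * g.coeff j₀) = 0
  · -- then `N = 0`; all remaining terms vanish vacuously
    have hN : N = 0 := by rw [← hb, h0, zero_mul]
    have : (Finset.HasAntidiagonal.antidiagonal k).erase (i₀, j₀) = ∅ := by
      apply Finset.eq_empty_of_forall_notMem
      rintro ⟨i, j⟩ hij
      have := hlt i j (Finset.HasAntidiagonal.mem_antidiagonal.mp (Finset.mem_of_mem_erase hij))
        (Finset.ne_of_mem_erase hij)
      rw [hN] at this
      exact not_lt_zero this
    rw [this, Finset.sum_empty, add_zero, hb]
  · rw [Valuation.map_add_eq_of_lt_left, hb]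
    refine Valuation.map_sum_lt v h0 ?_
    rintro ⟨i, j⟩ hij
    have hk' := Finset.HasAntidiagonal.mem_antidiagonal.mp (Finset.mem_of_mem_erase hij)
    have := hlt i j hk' (Finset.ne_of_mem_erase hij)
    rw [key i j hk', ← hb] at this
    exact lt_of_mul_lt_mul_right this htk.le

theorem seg_aux' {f g : K[X]} {N : Γ} {k : ℕ} (hN : N ≠ 0)
    (hlt : ∀ i j, i + j = k → v (f.coeff i) * t ^ i * (v (g.coeff j) * t ^ j) < N) :
    v ((f * g).coeff k) * t ^ k < N := by
  rcases eq_or_ne (t ^ k) 0 with ht | ht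
  · rw [ht, mul_zero]; exact zero_lt_iff.mpr hN
  rw [coeff_mul]
  have : v (∑ x ∈ Finset.HasAntidiagonal.antidiagonal k, f.coeff x.1 * g.coeff x.2) < N / t ^ k := by
    refine Valuation.map_sum_lt v (div_ne_zero hN ht) ?_
    rintro ⟨i, j⟩ hij
    have hk' := Finset.HasAntidiagonal.mem_antidiagonal.mp hij
    have := hlt i j hk'
    rw [lt_div_iff₀ (zero_lt_iff.mpr ht), map_mul, ← hk', pow_add]
    simpa [mul_mul_mul_comm] using this
  rwa [lt_div_iff₀ (zero_lt_iff.mpr ht)] at this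

theorem Seg.mul (ht : t ≠ 0) {f g : K[X]} {l r l' r' : ℕ} {M M' : Γ} (h : Seg v t f l r M)
    (h' : Seg v t g l' r' M') : Seg v t (f * g) (l + l') (r + r') (M * M') := by
  have hle : ∀ i j, v (f.coeff i) * t ^ i * (v (g.coeff j) * t ^ j) ≤ M * M' := fun i j =>
    mul_le_mul' (h.le i) (h'.le j)
  have hlt1 : ∀ i j, v (f.coeff i) * t ^ i < M →
      v (f.coeff i) * t ^ i * (v (g.coeff j) * t ^ j) < M * M' := fun i j hi =>
    mul_lt_mul_of_lt_of_le_of_nonneg_of_pos hi (h'.le j) zero_le (zero_lt_iff.mpr h'.hM)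
  have hlt2 : ∀ i j, v (g.coeff j) * t ^ j < M' →
      v (f.coeff i) * t ^ i * (v (g.coeff j) * t ^ j) < M * M' := fun i j hi =>
    mul_lt_mul_of_le_of_lt_of_nonneg_of_pos (h.le i) hi zero_le (zero_lt_iff.mpr h.hM)
  have hN : M * M' ≠ 0 := mul_ne_zero h.hM h'.hM
  refine ⟨hN, ?_, ?_, ?_, ?_, ?_⟩
  · intro k
    rw [coeff_mul]
    have htk : t ^ k ≠ 0 := pow_ne_zero _ ht
    have : v (∑ x ∈ Finset.HasAntidiagonal.antidiagonal k, f.coeff x.1 * g.coeff x.2) ≤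
        (M * M') / t ^ k := by
      refine Valuation.map_sum_le v ?_
      rintro ⟨i, j⟩ hij
      have hk' := Finset.HasAntidiagonal.mem_antidiagonal.mp hij
      have := hle i j
      rw [le_div_iff₀ (zero_lt_iff.mpr htk), map_mul, ← hk', pow_add]
      simpa [mul_mul_mul_comm] using this
    rwa [le_div_iff₀ (zero_lt_iff.mpr htk)] at this
  · refine seg_aux ht rfl (by rw [h.left, h'.left]) ?_
    intro i j hij hne
    rcases lt_or_ge i l with hi | hi
    · exact hlt1 i j (h.ltl i hi)
    · refine hlt2 i j (h'.ltl j ?_)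
      by_contra hc
      exact hne (by rw [Prod.mk.injEq]; omega)
  · refine seg_aux ht rfl (by rw [h.right, h'.right]) ?_
    intro i j hij hne
    rcases lt_or_ge r i with hi | hi
    · exact hlt1 i j (h.ltr i hi)
    · refine hlt2 i j (h'.ltr j ?_)
      by_contra hc
      exact hne (by rw [Prod.mk.injEq]; omega)
  · intro k hk
    refine seg_aux' hN fun i j hij => ?_
    rcases lt_or_ge i l with hi | hi
    · exact hlt1 i j (h.ltl i hi)
    · exact hlt2 i j (h'.ltl j (by omega))
  · intro k hk
    refine seg_aux' hN fun i j hij => ?_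
    rcases lt_or_ge r i with hi | hi
    · exact hlt1 i j (h.ltr i hi)
    · exact hlt2 i j (h'.ltr j (by omega))

/-- If a product of linear factors has a nontrivial face, then some root has that slope. -/
theorem Seg.exists_root (ht : t ≠ 0) (s : Multiset K) {l r : ℕ} {M : Γ}
    (h : Seg v t ((s.map fun a => X - C a).prod) l r M) (hlr : l < r) : ∃ a ∈ s, v a = t := by
  by_contra! hne
  have key : ∀ s : Multiset K, (∀ a ∈ s, v a ≠ t) →
      ∃ k M, Seg v t ((s.map fun a => X - C a).prod) k k M := by
    intro s
    induction s using Multiset.induction_on with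
    | empty =>
      intro _
      refine ⟨0, 1, one_ne_zero, ?_, by simp, by simp, by simp, ?_⟩
      · intro j
        rcases eq_or_ne j 0 with rfl | hj
        · simp
        · simp [coeff_one, hj]
      · intro j hj
        simp [coeff_one, hj.ne']
    | cons a s ih =>
      intro hs
      obtain ⟨k, M, hk⟩ := ih fun b hb => hs b (Multiset.mem_cons_of_mem hb)
      have ha : v a ≠ t := hs a (Multiset.mem_cons_self a s)
      have h0 : (X - C a : K[X]).coeff 0 = -a := by simp
      have h1 : (X - C a : K[X]).coeff 1 = 1 := by simp [coeff_X, coeff_C]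
      have h2 : ∀ j, (X - C a : K[X]).coeff (j + 2) = 0 := by
        intro j; simp [coeff_X, coeff_C]
      have hlin : ∃ k M, Seg v t (X - C a) k k M := by
        rcases lt_or_gt_of_ne ha with hlt | hlt
        · refine ⟨1, t, ht, ?_, by simp [h1], by simp [h1], ?_, ?_⟩
          · rintro (_ | _ | j)
            · simpa [h0] using hlt.le
            · simp [h1]
            · rw [h2]; simp
          · intro j hj
            obtain rfl : j = 0 := by omega
            simpa [h0] using hlt
          · rintro (_ | _ | j) hj
            · omega
            · omega
            · rw [h2]; simpa using zero_lt_iff.mpr ht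
        · refine ⟨0, v a, (ne_of_gt (lt_of_le_of_lt zero_le hlt)), ?_, by simp [h0], by simp [h0], by simp, ?_⟩
          · rintro (_ | _ | j)
            · simp [h0]
            · simpa [h1] using hlt.le
            · rw [h2]; simp
          · rintro (_ | _ | j) hj
            · omega
            · simpa [h1] using hlt
            · rw [h2]; simpa using (lt_of_le_of_lt zero_le hlt)
      obtain ⟨k', M', hk'⟩ := hlin
      refine ⟨k' + k, M' * M, ?_⟩
      rw [Multiset.map_cons, Multiset.prod_cons]
      exact hk'.mul ht hk
  obtain ⟨k, M', hk⟩ := key s hne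
  have := h.unique hk
  omega
end

section
section
open IsDedekindDomain HeightOneSpectrum WithZero

/-- A valuation above `p` on a Galois number field, with ramification index dividing the degree. -/
theorem exists_val (L : Type*) [Field L] [NumberField L] [IsGalois ℚ L] (p : ℕ) [hp : Fact p.Prime] :
    ∃ (v : Valuation L ℤᵐ⁰) (e : ℕ), e ≠ 0 ∧ e ∣ Nat.card Gal(L/ℚ) ∧
      v (p : L) = exp (-(e : ℤ)) ∧ (∀ m : ℤ, v (m : L) ≤ 1) ∧
      ∀ m : ℤ, ¬ (p : ℤ) ∣ m → v (m : L) = 1 := by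
  have hpp : Prime (p : ℤ) := Nat.prime_iff_prime_int.mp hp.out
  let P : Ideal ℤ := Ideal.span {(p : ℤ)}
  have hP0 : P ≠ ⊥ := by simpa [P] using hpp.ne_zero
  have hPp : P.IsPrime := (Ideal.span_singleton_prime hpp.ne_zero).mpr hpp
  obtain ⟨⟨Q, hQ, hQP⟩⟩ := (inferInstance : Nonempty (Ideal.primesOver P (NumberField.RingOfIntegers L)))
  have hQ0 : Q ≠ ⊥ := Ideal.ne_bot_of_liesOver_of_ne_bot hP0 Q
  let w : HeightOneSpectrum (NumberField.RingOfIntegers L) := ⟨Q, hQ, hQ0⟩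
  let v0 : HeightOneSpectrum ℤ := ⟨P, hPp, hP0⟩
  have hlo : w.asIdeal.LiesOver v0.asIdeal := hQP
  have hIntg : ∀ m : ℤ, w.valuation L (m : L) = v0.intValuation m ^ (P.ramificationIdx' Q) := by
    intro m
    have := intValuation_liesOver v0 w m
    rw [this, ← valuation_of_algebraMap (K := L)]
    simp
  refine ⟨w.valuation L, P.ramificationIdx' Q, ?_, ?_, ?_, ?_, ?_⟩
  · exact Ideal.IsDedekindDomain.ramificationIdx'_ne_zero_of_liesOver Q hP0
  · have h := Ideal.ncard_primesOver_mul_ramificationIdxIn_mul_inertiaDegIn P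
      (NumberField.RingOfIntegers L) Gal(L/ℚ)
    rw [Ideal.ramificationIdxIn_eq_ramificationIdx P Q Gal(L/ℚ)] at h
    have h2 : Q.ramificationIdx ℤ = P.ramificationIdx' Q := by
      exact Eq.symm (Ideal.ramificationIdx'_eq_ramificationIdx P Q hP0)
    rw [← h2, ← h]
    exact (Dvd.intro _ rfl).mul_left _
  · have := hIntg (p : ℤ)
    rw [Int.cast_natCast] at this
    rw [this]
    have h1 : v0.intValuation (p : ℤ) = exp (-1 : ℤ) := by
      exact v0.intValuation_singleton hpp.ne_zero rfl
    rw [h1, ← exp_nsmul]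
    simp
  · intro m
    rw [hIntg]
    exact pow_le_one₀ zero_le (v0.intValuation_le_one m)
  · intro m hm
    rw [hIntg]
    have : v0.intValuation m = 1 := by
      rw [intValuation_eq_one_iff]
      simpa [v0, P, Ideal.mem_span_singleton] using hm
    rw [this, one_pow]
end
end

section
/-- The polynomial with the given list of coefficients. -/
noncomputable def ofL : List ℤ → ℤ[X]
  | [] => 0
  | x :: xs => C x + X * ofL xs

def addL : List ℤ → List ℤ → List ℤ
  | [], ys => ys
  | x :: xs, [] => x :: xs
  | x :: xs, y :: ys => (x + y) :: addL xs ys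

theorem ofL_addL : ∀ xs ys, ofL (addL xs ys) = ofL xs + ofL ys
  | [], ys => by simp [addL, ofL]
  | x :: xs, [] => by simp [addL, ofL]
  | x :: xs, y :: ys => by simp [addL, ofL, ofL_addL xs ys]; ring

def smulL (a : ℤ) : List ℤ → List ℤ
  | [] => []
  | x :: xs => (a * x) :: smulL a xs

theorem ofL_smulL (a : ℤ) : ∀ xs, ofL (smulL a xs) = C a * ofL xs
  | [] => by simp [smulL, ofL]
  | x :: xs => by simp [smulL, ofL, ofL_smulL a xs]; ring

/-- Taylor shift on coefficient lists. -/
def shiftL (a : ℤ) : List ℤ → List ℤ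
  | [] => []
  | x :: xs => addL [x] (addL (0 :: shiftL a xs) (smulL a (shiftL a xs)))

theorem ofL_shiftL (a : ℤ) : ∀ xs, ofL (shiftL a xs) = (ofL xs).comp (X + C a)
  | [] => by simp [shiftL, ofL]
  | x :: xs => by
    have h := ofL_shiftL a xs
    simp only [shiftL, ofL_addL, ofL_smulL, ofL, h]
    simp
    ring

theorem ofL_coeff : ∀ (xs : List ℤ) (j : ℕ), (ofL xs).coeff j = xs.getD j 0
  | [], j => by simp [ofL]
  | x :: xs, 0 => by simp [ofL]
  | x :: xs, j + 1 => by rw [ofL, coeff_add, coeff_X_mul, ofL_coeff xs j, coeff_C_succ]; simp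

/-- coefficients of lcal -/
def lcf (n : ℕ) (c : ℤ) (j : ℕ) : ℤ := (n.choose j : ℤ) * ∏ i ∈ Finset.Icc (j + 1) n, (c + 2 * (i : ℤ))

noncomputable def lcalZ (n : ℕ) (c : ℤ) : ℤ[X] := ∑ j ∈ Finset.range (n + 1), C (lcf n c j) * X ^ j

theorem lcalZ_map (n : ℕ) (u : ℤ) : (lcalZ n (2 * u + 1)).map (Int.castRingHom ℚ) = lcal n u := by
  simp only [lcalZ, lcal, lcf, Polynomial.map_sum, Polynomial.map_mul, Polynomial.map_pow, map_X, map_C]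
  refine Finset.sum_congr rfl fun j _ => ?_
  congr 2
  simp only [eq_intCast, Int.cast_mul, Int.cast_prod, Int.cast_add, Int.cast_natCast, Int.cast_ofNat, Int.cast_one]
  congr 1
  refine Finset.prod_congr rfl fun i _ => ?_
  ring

theorem lcf_step (n : ℕ) (c : ℤ) (j : ℕ) (hj : j < n) :
    lcf n c (j + 1) * ((j : ℤ) + 1) * (c + 2 * ((j : ℤ) + 1)) / ((n : ℤ) - j) = lcf n c j := by
  have h1 : (n : ℤ) - j ≠ 0 := by omega
  apply Int.ediv_eq_of_eq_mul_left h1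
  have h := Nat.choose_succ_right_eq n j
  have h' : (n.choose (j + 1) : ℤ) * ((j : ℤ) + 1) = n.choose j * ((n : ℤ) - j) := by
    zify [hj.le] at h
    exact h
  have h2 : ∏ i ∈ Finset.Icc (j + 1) n, (c + 2 * (i : ℤ)) =
      (c + 2 * ((j : ℤ) + 1)) * ∏ i ∈ Finset.Icc (j + 1 + 1) n, (c + 2 * (i : ℤ)) := by
    rw [← Finset.insert_Icc_add_one_left_eq_Icc (show j + 1 ≤ n by omega), Finset.prod_insert (by simp)]
    push_cast
    rfl
  simp only [lcf, h2]
  linear_combination (c + 2 * ((j : ℤ) + 1)) * (∏ i ∈ Finset.Icc (j + 1 + 1) n, (c + 2 * (i : ℤ))) * h'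

def coefGo (n : ℕ) (c : ℤ) : ℕ → ℤ → List ℤ → List ℤ
  | 0, val, acc => val :: acc
  | j + 1, val, acc =>
    coefGo n c j (val * (((j : ℕ) : ℤ) + 1) * (c + 2 * (((j : ℕ) : ℤ) + 1)) / ((n : ℤ) - ((j : ℕ) : ℤ))) (val :: acc)

def coefL (n : ℕ) (c : ℤ) : List ℤ := coefGo n c n 1 []

theorem ofL_coefGo (n : ℕ) (c : ℤ) : ∀ (j : ℕ) (_ : j ≤ n) (acc : List ℤ),
    ofL (coefGo n c j (lcf n c j) acc) =
      ∑ i ∈ Finset.range (j + 1), C (lcf n c i) * X ^ i + X ^ (j + 1) * ofL acc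
  | 0, _, acc => by simp [coefGo, ofL]
  | j + 1, hj, acc => by
    rw [coefGo, lcf_step n c j (by omega), ofL_coefGo n c j (by omega), Finset.sum_range_succ _ (j + 1), ofL]
    ring

theorem ofL_coefL (n : ℕ) (c : ℤ) : ofL (coefL n c) = lcalZ n c := by
  have : lcf n c n = 1 := by simp [lcf]
  rw [coefL, ← this, ofL_coefGo n c n le_rfl, lcalZ]
  simp [ofL]

theorem lcalZ_coeff (n : ℕ) (c : ℤ) (j : ℕ) : (lcalZ n c).coeff j = if j ≤ n then lcf n c j else 0 := by
  simp [lcalZ, coeff_X_pow]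

theorem lcalZ_monic (n : ℕ) (c : ℤ) : (lcalZ n c).Monic := by
  apply monic_of_natDegree_le_of_coeff_eq_one n
  · rw [natDegree_le_iff_coeff_eq_zero]
    intro N hN
    rw [lcalZ_coeff, if_neg (by omega)]
  · rw [lcalZ_coeff, if_pos le_rfl]; simp [lcf]

theorem lcalZ_natDegree (n : ℕ) (c : ℤ) : (lcalZ n c).natDegree = n := by
  apply natDegree_eq_of_le_of_coeff_ne_zero
  · rw [natDegree_le_iff_coeff_eq_zero]
    intro N hN
    rw [lcalZ_coeff, if_neg (by omega)]
  · rw [lcalZ_coeff, if_pos le_rfl]; simp [lcf]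

/-! ### Newton polygon certificates -/

/-- divisibility part of the check -/
def chkGo (p a b M l r : ℕ) : ℕ → List ℤ → Bool
  | _, [] => true
  | j, x :: xs =>
    (x.natAbs % p ^ ((M + b - (cond (Nat.ble l j && Nat.ble j r) 1 0) - a * j) / b)).beq 0 &&
      chkGo p a b M l r (j + 1) xs

def segChk (cs : List ℤ) (p l r a b vl vr : ℕ) : Bool :=
  Nat.ble 1 a && Nat.ble 1 b && (Nat.gcd a b).beq 1 && (b * vl + a * l).beq (b * vr + a * r) && Nat.ble (l + 1) r &&
  !((cs.getD l 0).natAbs % p ^ (vl + 1)).beq 0 && !((cs.getD r 0).natAbs % p ^ (vr + 1)).beq 0 &&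
  chkGo p a b (b * vl + a * l) l r 0 cs

theorem chkGo_spec (p a b M l r : ℕ) : ∀ (xs : List ℤ) (j : ℕ), chkGo p a b M l r j xs = true → ∀ i,
    ((p ^ ((M + b - (cond (Nat.ble l (j + i) && Nat.ble (j + i) r) 1 0) - a * (j + i)) / b) : ℕ) : ℤ) ∣ xs.getD i 0
  | [], j, _, i => by simp
  | x :: xs, j, h, 0 => by
    simp only [chkGo, Bool.and_eq_true, Nat.beq_eq] at h
    simpa using Int.natCast_dvd.mpr (Nat.dvd_of_mod_eq_zero h.1)
  | x :: xs, j, h, i + 1 => by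
    simp only [chkGo, Bool.and_eq_true] at h
    have := chkGo_spec p a b M l r xs (j + 1) h.2 i
    rw [show j + (i + 1) = j + 1 + i by ring]
    simpa using this

section
open WithZero

theorem segChk_seg {K : Type*} [Field K] (v : Valuation K ℤᵐ⁰) (p e : ℕ) (he : e ≠ 0)
    (hvp : v (p : K) = exp (-(e : ℤ))) (hv1 : ∀ m : ℤ, v (m : K) ≤ 1)
    (hv2 : ∀ m : ℤ, ¬ (p : ℤ) ∣ m → v (m : K) = 1) (cs : List ℤ) (l r a b vl vr : ℕ)
    (h : segChk cs p l r a b vl vr = true) :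
    ∃ hb : b ≠ 0, a.Coprime b ∧ l < r ∧ Seg (v.map (powMonoidWithZeroHom hb) (pow_left_mono b)) (v (p : K) ^ a)
      ((ofL cs).map (Int.castRingHom K)) l r (v (p : K) ^ (b * vl + a * l)) := by
  simp only [segChk, Bool.and_eq_true, Nat.beq_eq, Nat.ble_eq, Bool.not_eq_true', ] at h
  obtain ⟨⟨⟨⟨⟨⟨⟨ha, hb⟩, hab⟩, hM⟩, hlr⟩, hl⟩, hr⟩, hc⟩ := h
  have hl : ¬ ((p ^ (vl + 1) : ℕ) : ℤ) ∣ cs.getD l 0 := fun hh => by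
    have := Nat.mod_eq_zero_of_dvd (Int.natCast_dvd.mp hh)
    rw [this] at hl; simp at hl
  have hr : ¬ ((p ^ (vr + 1) : ℕ) : ℤ) ∣ cs.getD r 0 := fun hh => by
    have := Nat.mod_eq_zero_of_dvd (Int.natCast_dvd.mp hh)
    rw [this] at hr; simp at hr
  have hdv := fun i => chkGo_spec _ _ _ _ _ _ _ _ hc i
  simp only [zero_add] at hdv
  set π := v (p : K) with hπ
  have hπ0 : π ≠ 0 := by rw [hvp]; exact exp_ne_zero
  have hπ1 : π < 1 := by
    rw [hvp, ← exp_zero, exp_lt_exp]; omega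
  have hb0 : b ≠ 0 := by omega
  have hpw : ∀ i j : ℕ, (π ^ i) ^ b * (π ^ a) ^ j = π ^ (b * i + a * j) := fun i j => by
    rw [pow_add, ← pow_mul, ← pow_mul, mul_comm i b]
  have hle : ∀ (m : ℤ) (k : ℕ), ((p ^ k : ℕ) : ℤ) ∣ m → v (m : K) ≤ π ^ k := by
    rintro m k ⟨m', rfl⟩
    push_cast
    rw [map_mul, map_pow]
    exact mul_le_of_le_one_right' (hv1 m')
  have heq : ∀ (m : ℤ) (k : ℕ), ((p ^ k : ℕ) : ℤ) ∣ m → ¬ ((p ^ (k + 1) : ℕ) : ℤ) ∣ m → v (m : K) = π ^ k := by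
    rintro m k ⟨m', rfl⟩ hn
    have : ¬ (p : ℤ) ∣ m' := fun ⟨q, hq⟩ => hn ⟨q, by rw [hq]; push_cast; ring⟩
    push_cast
    rw [map_mul, map_pow, hv2 _ this, mul_one]
  have hmono : ∀ i j : ℕ, i ≤ j → π ^ j ≤ π ^ i := fun i j hij => pow_le_pow_right_of_le_one' hπ1.le hij
  have hsmono : ∀ i j : ℕ, i < j → π ^ j < π ^ i := fun i j hij =>
    pow_lt_pow_right_of_lt_one₀ (zero_lt_iff.mpr hπ0) hπ1 hij
  have hco : ∀ j, ((ofL cs).map (Int.castRingHom K)).coeff j = ((cs.getD j 0 : ℤ) : K) := by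
    intro j; rw [coeff_map, ofL_coeff]; simp
  have hval : ∀ x : K, (v.map (powMonoidWithZeroHom hb0) (pow_left_mono b)) x = v x ^ b := fun x => rfl
  have hbd : ∀ x m : ℕ, x ≤ b * ((x + b - 1) / b) := by
    intro x _
    have := Nat.lt_mul_div_succ (x + b - 1) (show 0 < b by omega)
    rw [mul_add] at this; omega
  have hin : ∀ j, l ≤ j → j ≤ r → v ((cs.getD j 0 : ℤ) : K) ^ b * (π ^ a) ^ j ≤ π ^ (b * vl + a * l) := by
    intro j h1 h2
    have h3 := hle _ _ (hdv j)
    simp only [Nat.ble_eq_true_of_le h1, Nat.ble_eq_true_of_le h2, Bool.and_self, cond_true] at h3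
    calc _ ≤ (π ^ ((b * vl + a * l + b - 1 - a * j) / b)) ^ b * (π ^ a) ^ j := by gcongr
      _ = π ^ (b * ((b * vl + a * l + b - 1 - a * j) / b) + a * j) := hpw _ _
      _ ≤ _ := by
        apply hmono
        rcases le_or_gt (a * j) (b * vl + a * l) with hh | hh
        · have := hbd (b * vl + a * l - a * j) 0
          rw [show b * vl + a * l + b - 1 - a * j = b * vl + a * l - a * j + b - 1 by omega]
          omega
        · omega
  have hout : ∀ j, (j < l ∨ r < j) → v ((cs.getD j 0 : ℤ) : K) ^ b * (π ^ a) ^ j < π ^ (b * vl + a * l) := by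
    intro j h1
    have h3 := hle _ _ (hdv j)
    have h4 : (Nat.ble l j && Nat.ble j r) = false := by
      rw [Bool.eq_false_iff]; simp only [ne_eq, Bool.and_eq_true, Nat.ble_eq]; omega
    simp only [h4, cond_false] at h3
    calc _ ≤ (π ^ ((b * vl + a * l + b - 0 - a * j) / b)) ^ b * (π ^ a) ^ j := by gcongr
      _ = π ^ (b * ((b * vl + a * l + b - 0 - a * j) / b) + a * j) := hpw _ _
      _ < _ := by
        apply hsmono
        rcases le_or_gt (a * j) (b * vl + a * l) with hh | hh
        · have := hbd (b * vl + a * l - a * j + 1) 0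
          rw [show b * vl + a * l + b - 0 - a * j = b * vl + a * l - a * j + 1 + b - 1 by omega]
          omega
        · omega
  have hdvl : ((p ^ vl : ℕ) : ℤ) ∣ cs.getD l 0 := by
    have := hdv l
    have h4 : (Nat.ble l l && Nat.ble l r) = true := by simp only [Bool.and_eq_true, Nat.ble_eq]; omega
    rw [h4] at this
    simp only [cond_true] at this
    rwa [show (b * vl + a * l + b - 1 - a * l) / b = vl from by
      rw [show b * vl + a * l + b - 1 - a * l = (b - 1) + b * vl by omega, Nat.add_mul_div_left _ _ (by omega), Nat.div_eq_of_lt (by omega), zero_add]] at this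
  have hdvr : ((p ^ vr : ℕ) : ℤ) ∣ cs.getD r 0 := by
    have := hdv r
    have h4 : (Nat.ble l r && Nat.ble r r) = true := by simp only [Bool.and_eq_true, Nat.ble_eq]; omega
    rw [h4, hM] at this
    simp only [cond_true] at this
    rwa [show (b * vr + a * r + b - 1 - a * r) / b = vr from by
      rw [show b * vr + a * r + b - 1 - a * r = (b - 1) + b * vr by omega, Nat.add_mul_div_left _ _ (by omega), Nat.div_eq_of_lt (by omega), zero_add]] at this
  refine ⟨hb0, hab, hlr, pow_ne_zero _ hπ0, ?_, ?_, ?_, ?_, ?_⟩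
  · intro j
    rw [hco, hval]
    by_cases hj : l ≤ j ∧ j ≤ r
    · exact hin j hj.1 hj.2
    · exact (hout j (by omega)).le
  · rw [hco, hval, heq _ _ hdvl hl]; exact hpw _ _
  · rw [hco, hval, heq _ _ hdvr hr, hM]; exact hpw _ _
  · intro j hj; rw [hco, hval]; exact hout j (Or.inl hj)
  · intro j hj; rw [hco, hval]; exact hout j (Or.inr hj)

end
end

section
structure Cert where
  sh : ℤ
  p : ℕ
  l : ℕ
  r : ℕ
  a : ℕ
  b : ℕ
  vl : ℕ
  vr : ℕ

def isP (p : ℕ) : Bool :=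
  [2, 3, 5, 7, 11, 13, 17, 19, 23, 29, 31, 37, 41, 43, 47, 53, 59, 61, 67, 71, 73, 79, 83, 89, 97].any fun q => q.beq p

theorem isP_prime {p : ℕ} (h : isP p = true) : p.Prime := by
  simp only [isP, List.any_cons, List.any_nil, Bool.or_eq_true, Nat.beq_eq, Bool.false_eq_true, or_false] at h
  rcases h with h|h|h|h|h|h|h|h|h|h|h|h|h|h|h|h|h|h|h|h|h|h|h|h|h <;> subst h <;> norm_num

/-- the shifted list; avoid computing if the shift is zero -/
def shL (a : ℤ) (cs : List ℤ) : List ℤ :=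
  match a with
  | Int.ofNat 0 => cs
  | a => shiftL a cs

theorem ofL_shL (a : ℤ) (cs : List ℤ) : ofL (shL a cs) = (ofL cs).comp (X + C a) := by
  unfold shL
  split
  · simp
  · exact ofL_shiftL _ _

def Cert.ok (c : Cert) (cs : List ℤ) : Bool :=
  isP c.p && segChk (shL c.sh cs) c.p c.l c.r c.a c.b c.vl c.vr

/-- `k` is not the degree of a factor -/
def Cert.infeas (c : Cert) (n k : ℕ) : Bool :=
  Nat.blt (n - (c.r - c.l)) (k - c.b * min (k / c.b) ((c.r - c.l) / c.b))

section
open WithZero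

theorem Cert.seg {K : Type*} [Field K] (c : Cert) (F : ℤ[X]) (cs : List ℤ) (hcs : ofL cs = F) (h : c.ok cs = true)
   (v : Valuation K ℤᵐ⁰) (e : ℕ) (he : e ≠ 0)
    (hvp : v (c.p : K) = exp (-(e : ℤ))) (hv1 : ∀ m : ℤ, v (m : K) ≤ 1)
    (hv2 : ∀ m : ℤ, ¬ (c.p : ℤ) ∣ m → v (m : K) = 1) :
    ∃ hb : c.b ≠ 0, c.a.Coprime c.b ∧ c.l < c.r ∧
      Seg (v.map (powMonoidWithZeroHom hb) (pow_left_mono c.b)) (v (c.p : K) ^ c.a)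
      ((F.map (Int.castRingHom K)).comp (X + C (c.sh : K))) c.l c.r (v (c.p : K) ^ (c.b * c.vl + c.a * c.l)) := by
  simp only [Cert.ok, Bool.and_eq_true] at h
  have := segChk_seg v c.p e he hvp hv1 hv2 _ _ _ _ _ _ _ h.2
  rw [ofL_shL, hcs, Polynomial.map_comp] at this
  simpa using this

theorem Cert.dvd_card (c : Cert) (F : ℤ[X]) (hF : F.Monic) (cs : List ℤ) (hcs : ofL cs = F) (h : c.ok cs = true)
    (L : Type*) [Field L] [NumberField L] [IsGalois ℚ L] (hs : (F.map (Int.castRingHom L)).Splits) :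
    c.b ∣ Nat.card Gal(L/ℚ) := by
  have hp : c.p.Prime := by
    simp only [Cert.ok, Bool.and_eq_true] at h
    exact isP_prime h.1
  have : Fact c.p.Prime := ⟨hp⟩
  obtain ⟨v, e, he, hed, hvp, hv1, hv2⟩ := exists_val L c.p
  obtain ⟨hb, hab, hlr, hseg⟩ := c.seg F cs hcs h v e he hvp hv1 hv2
  have hπ0 : v (c.p : L) ≠ 0 := by rw [hvp]; exact exp_ne_zero
  have hprod := hs.eq_prod_roots_of_monic (hF.map _)
  have : (F.map (Int.castRingHom L)).comp (X + C (c.sh : L)) =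
      ((((F.map (Int.castRingHom L)).roots.map (fun a => a - (c.sh : L)))).map fun a => X - C a).prod := by
    conv_lhs => rw [hprod]
    rw [Polynomial.multiset_prod_comp, Multiset.map_map, Multiset.map_map]
    congr 1
    apply Multiset.map_congr rfl
    intro x _
    simp
    ring
  rw [this] at hseg
  obtain ⟨x, -, hx⟩ := hseg.exists_root (pow_ne_zero _ hπ0) _ hlr
  change v x ^ c.b = _ at hx
  have hx0 : v x ≠ 0 := by
    intro h0
    rw [h0, zero_pow hb] at hx
    exact pow_ne_zero _ hπ0 hx.symm
  have hl := congrArg log hx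
  rw [log_pow, log_pow, hvp, log_exp] at hl
  simp only [nsmul_eq_mul] at hl
  refine dvd_trans ?_ hed
  apply hab.symm.dvd_of_dvd_mul_left
  have : ((c.b : ℕ) : ℤ) ∣ ((c.a * e : ℕ) : ℤ) := ⟨-log (v x), by push_cast; linear_combination hl⟩
  exact_mod_cast this

theorem Cert.dumas (c : Cert) (F : ℤ[X]) (hF : F.Monic) (cs : List ℤ) (hcs : ofL cs = F) (h : c.ok cs = true)
    (f g : ℚ[X]) (hfg : f * g = F.map (Int.castRingHom ℚ)) : c.infeas F.natDegree f.natDegree = false := by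
  have hp : c.p.Prime := by
    simp only [Cert.ok, Bool.and_eq_true] at h
    exact isP_prime h.1
  have : Fact c.p.Prime := ⟨hp⟩
  have hgal : @IsGalois ℚ _ ℚ _ DivisionRing.toRatAlgebra := by
    have h : (DivisionRing.toRatAlgebra : Algebra ℚ ℚ) = Algebra.id ℚ := Subsingleton.elim _ _
    rw [h]
    exact IsGalois.self ℚ
  obtain ⟨v, e, he, hed, hvp, hv1, hv2⟩ := exists_val ℚ c.p
  obtain rfl : e = 1 := by
    have hh : (DivisionRing.toRatAlgebra : Algebra ℚ ℚ) = Algebra.id ℚ := Subsingleton.elim _ _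
    rw [hh] at hed
    have : Nat.card Gal(ℚ/ℚ) = 1 := by
      have : Subsingleton Gal(ℚ/ℚ) := ⟨fun f g => AlgEquiv.ext fun x =>
        RingHom.congr_fun (Subsingleton.elim (f : ℚ →+* ℚ) (g : ℚ →+* ℚ)) x⟩
      exact Nat.card_unique
    rw [this] at hed
    exact Nat.dvd_one.mp hed
  obtain ⟨hb, hab, hlr, hseg⟩ := c.seg F cs hcs h v 1 he hvp hv1 hv2
  have hπ0 : v (c.p : ℚ) ≠ 0 := by rw [hvp]; exact exp_ne_zero
  have hF0 : F.map (Int.castRingHom ℚ) ≠ 0 := (hF.map _).ne_zero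
  have hf0 : f ≠ 0 := by rintro rfl; simp at hfg; exact hF0 hfg.symm
  have hg0 : g ≠ 0 := by rintro rfl; simp at hfg; exact hF0 hfg.symm
  have hq : (X + C (c.sh : ℚ)).natDegree = 1 := natDegree_X_add_C _
  have hdf : (f.comp (X + C (c.sh : ℚ))).natDegree = f.natDegree := by rw [natDegree_comp, hq, mul_one]
  have hdg : (g.comp (X + C (c.sh : ℚ))).natDegree = g.natDegree := by rw [natDegree_comp, hq, mul_one]
  have hcf0 : f.comp (X + C (c.sh : ℚ)) ≠ 0 := by
    rw [Ne, comp_eq_zero_iff]; rintro (h | ⟨-, h⟩)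
    · exact hf0 h
    · rw [h] at hq; simp at hq
  have hcg0 : g.comp (X + C (c.sh : ℚ)) ≠ 0 := by
    rw [Ne, comp_eq_zero_iff]; rintro (h | ⟨-, h⟩)
    · exact hg0 h
    · rw [h] at hq; simp at hq
  rw [← hfg, mul_comp] at hseg
  have ht := pow_ne_zero c.a hπ0
  obtain ⟨l1, r1, M1, s1⟩ := Seg.exists (v := v.map (powMonoidWithZeroHom hb) (pow_left_mono c.b)) ht hcf0
  obtain ⟨l2, r2, M2, s2⟩ := Seg.exists (v := v.map (powMonoidWithZeroHom hb) (pow_left_mono c.b)) ht hcg0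
  obtain ⟨e1, e2⟩ := hseg.unique (s1.mul ht s2)
  have d1 := s1.r_le
  have d2 := s2.r_le
  have o1 := s1.l_le_r
  have o2 := s2.l_le_r
  rw [hdf] at d1
  rw [hdg] at d2
  have hn : f.natDegree + g.natDegree = F.natDegree := by
    rw [← natDegree_mul hf0 hg0, hfg, hF.natDegree_map]
  have hdvd : c.b ∣ r1 - l1 := by
    have hh := s1.left.trans s1.right.symm
    change v _ ^ c.b * _ = v _ ^ c.b * _ at hh
    have n1 : v ((f.comp (X + C (c.sh : ℚ))).coeff l1) ≠ 0 := by
      intro h0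
      have := s1.left
      change v _ ^ c.b * _ = _ at this
      rw [h0, zero_pow hb, zero_mul] at this
      exact s1.hM this.symm
    have n2 : v ((f.comp (X + C (c.sh : ℚ))).coeff r1) ≠ 0 := by
      intro h0
      have := s1.right
      change v _ ^ c.b * _ = _ at this
      rw [h0, zero_pow hb, zero_mul] at this
      exact s1.hM this.symm
    have hl := congrArg log hh
    rw [log_mul (pow_ne_zero _ n1) (pow_ne_zero _ ht), log_mul (pow_ne_zero _ n2) (pow_ne_zero _ ht)] at hl
    simp only [log_pow, hvp, log_exp, nsmul_eq_mul] at hl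
    apply hab.symm.dvd_of_dvd_mul_left
    have : ((c.b : ℕ) : ℤ) ∣ ((c.a * (r1 - l1) : ℕ) : ℤ) :=
      ⟨log (v ((f.comp (X + C (c.sh : ℚ))).coeff r1)) - log (v ((f.comp (X + C (c.sh : ℚ))).coeff l1)), by
        push_cast [o1]; linear_combination hl⟩
    exact_mod_cast this
  obtain ⟨m, hm⟩ := hdvd
  rw [Cert.infeas, Bool.eq_false_iff]
  simp only [ne_eq, Nat.blt_eq, not_lt]
  have hbp : 0 < c.b := Nat.pos_of_ne_zero hb
  have m1 : m ≤ f.natDegree / c.b := by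
    rw [Nat.le_div_iff_mul_le hbp, mul_comm]; omega
  have m2 : m ≤ (c.r - c.l) / c.b := by
    rw [Nat.le_div_iff_mul_le hbp, mul_comm]; omega
  have := Nat.mul_le_mul_left c.b (le_min m1 m2)
  omega

end
end

/-- reduction of coefficients mod q -/
def redL (q : ℕ) : List ℤ → List ℕ
  | [] => []
  | x :: xs => (x % (q : ℤ)).toNat :: redL q xs

/-- remainder of division by `x + a`, mod q -/
def rem1 (q a : ℕ) : List ℕ → ℕ
  | [] => 0
  | x :: xs => (rem1 q a xs * (q - a) + x) % q

def rem2 (q a b : ℕ) : List ℕ → ℕ × ℕ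
  | [] => (0, 0)
  | x :: xs => let s := rem2 q a b xs; ((s.2 * (q - b) + x) % q, (s.1 + s.2 * (q - a)) % q)

/-- Check that there is no monic divisor of degree `k` modulo `q` (`k = 1, 2`). -/
def modChk (cs : List ℤ) (q k : ℕ) : Bool :=
  let rs := redL q cs
  match k with
  | 1 => (List.range q).all fun a => !(rem1 q a rs).beq 0
  | 2 => (List.range q).all fun a => (List.range q).all fun b =>
      let s := rem2 q a b rs; !(s.1.beq 0 && s.2.beq 0)
  | _ => false

theorem rem1_spec (q a : ℕ) (ha : a < q) : ∀ cs : List ℤ, ∃ Q : (ZMod q)[X],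
    (ofL cs).map (Int.castRingHom (ZMod q)) = (X + C (a : ZMod q)) * Q + C ((rem1 q a (redL q cs) : ℕ) : ZMod q)
  | [] => ⟨0, by simp [ofL, redL, rem1]⟩
  | x :: xs => by
    obtain ⟨Q, hQ⟩ := rem1_spec q a ha xs
    have hx : (((x % (q : ℤ)).toNat : ℕ) : ZMod q) = (x : ZMod q) := by
      rw [← Int.cast_natCast, Int.toNat_of_nonneg (Int.emod_nonneg _ (by omega)), ZMod.intCast_mod]
    have hqa : ((q - a : ℕ) : ZMod q) = - (a : ZMod q) := by
      rw [Nat.cast_sub ha.le]; simp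
    refine ⟨X * Q + C ((rem1 q a (redL q xs) : ℕ) : ZMod q), ?_⟩
    simp only [ofL, redL, rem1, Polynomial.map_add, Polynomial.map_mul, map_X, map_C, hQ, ZMod.natCast_mod, Nat.cast_add,
      Nat.cast_mul, hqa, hx, Int.coe_castRingHom, C_add, C_mul, C_neg]
    ring

theorem rem2_spec (q a b : ℕ) (ha : a < q) (hb : b < q) : ∀ cs : List ℤ, ∃ Q : (ZMod q)[X],
    (ofL cs).map (Int.castRingHom (ZMod q)) = (X ^ 2 + C (a : ZMod q) * X + C (b : ZMod q)) * Q +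
      C (((rem2 q a b (redL q cs)).1 : ℕ) : ZMod q) + C (((rem2 q a b (redL q cs)).2 : ℕ) : ZMod q) * X
  | [] => ⟨0, by simp [ofL, redL, rem2]⟩
  | x :: xs => by
    obtain ⟨Q, hQ⟩ := rem2_spec q a b ha hb xs
    have hx : (((x % (q : ℤ)).toNat : ℕ) : ZMod q) = (x : ZMod q) := by
      rw [← Int.cast_natCast, Int.toNat_of_nonneg (Int.emod_nonneg _ (by omega)), ZMod.intCast_mod]
    have hqa : ((q - a : ℕ) : ZMod q) = - (a : ZMod q) := by
      rw [Nat.cast_sub ha.le]; simp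
    have hqb : ((q - b : ℕ) : ZMod q) = - (b : ZMod q) := by
      rw [Nat.cast_sub hb.le]; simp
    refine ⟨X * Q + C (((rem2 q a b (redL q xs)).2 : ℕ) : ZMod q), ?_⟩
    simp only [ofL, redL, rem2, Polynomial.map_add, Polynomial.map_mul, map_X, map_C, hQ, ZMod.natCast_mod, Nat.cast_add,
      Nat.cast_mul, hqa, hqb, hx, Int.coe_castRingHom, C_add, C_mul, C_neg]
    ring

theorem rem_lt1 (q a : ℕ) (hq : 0 < q) : ∀ xs, rem1 q a xs < q
  | [] => hq
  | _ :: _ => Nat.mod_lt _ hq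

theorem rem_lt2 (q a b : ℕ) (hq : 0 < q) : ∀ xs, (rem2 q a b xs).1 < q ∧ (rem2 q a b xs).2 < q
  | [] => ⟨hq, hq⟩
  | _ :: _ => ⟨Nat.mod_lt _ hq, Nat.mod_lt _ hq⟩

theorem modChk_spec (cs : List ℤ) (q k : ℕ) (hq : 1 < q) (h : modChk cs q k = true) (G H : ℤ[X])
    (hG : G.Monic) (hGH : ofL cs = G * H) : G.natDegree ≠ k := by
  intro hk
  have : NeZero q := ⟨by omega⟩
  have : Fact (1 < q) := ⟨hq⟩
  have hGm := hG.map (Int.castRingHom (ZMod q))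
  have hdG : (G.map (Int.castRingHom (ZMod q))).natDegree = k := by rw [hG.natDegree_map, hk]
  have hdvd : G.map (Int.castRingHom (ZMod q)) ∣ (ofL cs).map (Int.castRingHom (ZMod q)) := by
    rw [hGH, Polynomial.map_mul]; exact dvd_mul_right _ _
  set g := G.map (Int.castRingHom (ZMod q)) with hg
  have key : ∀ r : (ZMod q)[X], (∃ Q, (ofL cs).map (Int.castRingHom (ZMod q)) = g * Q + r) → r.degree < k → r = 0 := by
    rintro r ⟨Q, hQ⟩ hr
    have : g ∣ r := by
      rw [hQ] at hdvd
      exact (dvd_add_right (dvd_mul_right _ _)).mp hdvd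
    by_contra hr0
    exact hGm.not_dvd_of_degree_lt hr0 (by rwa [degree_eq_natDegree hGm.ne_zero, hdG]) this
  have hz : ∀ m : ℕ, m < q → (m : ZMod q) = 0 → m = 0 := fun m hm h0 =>
    Nat.eq_zero_of_dvd_of_lt ((ZMod.natCast_eq_zero_iff m q).mp h0) hm
  unfold modChk at h
  split at h
  · simp only [List.all_eq_true, List.mem_range, Bool.not_eq_true'] at h
    have hge : g = X + C (((g.coeff 0).val : ℕ) : ZMod q) := by
      rw [ZMod.natCast_zmod_val]
      conv_lhs => rw [hGm.as_sum, hdG]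
      simp
    obtain ⟨Q, hQ⟩ := rem1_spec q (g.coeff 0).val (ZMod.val_lt _) cs
    rw [← hge] at hQ
    have h0 := key _ ⟨Q, hQ⟩ (lt_of_le_of_lt degree_C_le (by norm_num))
    have h1 := hz _ (rem_lt1 q _ (by omega) _) (C_eq_zero.mp h0)
    have := h _ (ZMod.val_lt (g.coeff 0))
    rw [h1] at this
    simp at this
  · simp only [List.all_eq_true, List.mem_range, Bool.not_eq_true'] at h
    have hge : g = X ^ 2 + C (((g.coeff 1).val : ℕ) : ZMod q) * X + C (((g.coeff 0).val : ℕ) : ZMod q) := by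
      rw [ZMod.natCast_zmod_val, ZMod.natCast_zmod_val]
      conv_lhs => rw [hGm.as_sum, hdG]
      simp [Finset.sum_range_succ]
      ring
    obtain ⟨Q, hQ⟩ := rem2_spec q (g.coeff 1).val (g.coeff 0).val (ZMod.val_lt _) (ZMod.val_lt _) cs
    rw [← hge, add_assoc, add_comm (C _) (C _ * X)] at hQ
    have h0 := key _ ⟨Q, hQ⟩ (lt_of_le_of_lt degree_linear_le (by norm_num))
    have h1 := hz _ (rem_lt2 q _ _ (by omega) _).1 (by simpa using congrArg (fun p => p.coeff 0) h0)
    have h2 := hz _ (rem_lt2 q _ _ (by omega) _).2 (by simpa using congrArg (fun p => p.coeff 1) h0)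
    have := h _ (ZMod.val_lt (g.coeff 1)) _ (ZMod.val_lt (g.coeff 0))
    rw [h1, h2] at this
    simp at this
  · simp at h

/-- full irreducibility check; `mc = (q, k)` -/
def irrChk2 (n : ℕ) (cs : List ℤ) (certs : List Cert) (mcs : List (ℕ × ℕ)) : Bool :=
  certs.all (fun c => c.ok cs) && mcs.all (fun m => Nat.blt 1 m.1 && modChk cs m.1 m.2) &&
    (List.range (n / 2)).all fun k => certs.any (fun c => c.infeas n (k + 1)) || mcs.any fun m => m.2.beq (k + 1)

theorem irrChk2_irreducible (F : ℤ[X]) (hF : F.Monic) (hn : 1 ≤ F.natDegree) (cs : List ℤ) (hcs : ofL cs = F)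
    (certs : List Cert) (mcs : List (ℕ × ℕ))
    (h : irrChk2 F.natDegree cs certs mcs = true) : Irreducible (F.map (Int.castRingHom ℚ)) := by
  simp only [irrChk2, Bool.and_eq_true, List.all_eq_true, List.mem_range, List.any_eq_true, Bool.or_eq_true] at h
  obtain ⟨⟨h1, h3⟩, h2⟩ := h
  rw [← IsPrimitive.Int.irreducible_iff_irreducible_map_cast hF.isPrimitive, hF.irreducible_iff_natDegree']
  refine ⟨fun h1 => by rw [h1] at hn; simp at hn, fun f g hf hg hfg hmem => ?_⟩
  rw [Finset.mem_Ioc] at hmem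
  rcases h2 (g.natDegree - 1) (by omega) with ⟨c, hc, hc'⟩ | ⟨m, hm, hm'⟩
  · rw [Nat.sub_add_cancel (by omega)] at hc'
    have := c.dumas F hF cs hcs (h1 c hc) (g.map (Int.castRingHom ℚ)) (f.map (Int.castRingHom ℚ))
      (by rw [mul_comm, ← hfg, Polynomial.map_mul])
    rw [hg.natDegree_map, hc'] at this
    exact absurd this (by simp)
  · obtain ⟨a1, a2⟩ := h3 m hm
    rw [Nat.sub_add_cancel (by omega), Nat.beq_eq] at hm'
    exact modChk_spec cs m.1 m.2 (by simpa using a1) a2 g f hg (by rw [hcs, ← hfg, mul_comm]) hm'.symm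

/-- certificates for one pair `(n, u)` -/
structure Entry where
  pp : ℕ
  certs : List Cert
  mcs : List (ℕ × ℕ)

def row2 : List Entry :=
  [⟨1, [⟨0, 31, 0, 2, 1, 2, 1, 0⟩], []⟩,
    ⟨1, [⟨0, 29, 0, 2, 1, 2, 1, 0⟩], []⟩,
    ⟨1, [⟨0, 3, 0, 2, 3, 2, 3, 0⟩], []⟩,
    ⟨1, [⟨1, 2, 0, 2, 1, 2, 1, 0⟩], []⟩,
    ⟨1, [⟨0, 23, 0, 2, 1, 2, 1, 0⟩], []⟩,
    ⟨1, [⟨0, 3, 0, 2, 1, 2, 1, 0⟩], []⟩,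
    ⟨1, [⟨0, 19, 0, 2, 1, 2, 1, 0⟩], []⟩,
    ⟨1, [⟨0, 17, 0, 2, 1, 2, 1, 0⟩], []⟩,
    ⟨1, [⟨0, 3, 0, 2, 1, 2, 1, 0⟩], []⟩,
    ⟨1, [⟨0, 13, 0, 2, 1, 2, 1, 0⟩], []⟩,
    ⟨1, [⟨0, 11, 0, 2, 1, 2, 1, 0⟩], []⟩,
    ⟨1, [⟨1, 2, 0, 2, 1, 2, 1, 0⟩], []⟩,
    ⟨1, [⟨0, 7, 0, 2, 1, 2, 1, 0⟩], []⟩,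
    ⟨1, [⟨0, 5, 0, 2, 1, 2, 1, 0⟩], []⟩,
    ⟨1, [⟨0, 3, 0, 2, 1, 2, 1, 0⟩], []⟩,
    ⟨1, [⟨1, 2, 0, 2, 1, 2, 1, 0⟩], []⟩,
    ⟨1, [⟨1, 2, 0, 2, 1, 2, 1, 0⟩], []⟩]

def row3 : List Entry :=
  [⟨1, [⟨0, 3, 0, 3, 1, 3, 1, 0⟩], []⟩,
    ⟨1, [], [(5, 1)]⟩,
    ⟨1, [⟨0, 5, 0, 3, 2, 3, 2, 0⟩], []⟩,
    ⟨1, [⟨0, 23, 0, 3, 1, 3, 1, 0⟩], []⟩,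
    ⟨1, [⟨0, 3, 0, 3, 1, 3, 1, 0⟩], []⟩,
    ⟨1, [⟨0, 3, 0, 3, 1, 3, 1, 0⟩], []⟩,
    ⟨1, [⟨0, 3, 0, 3, 1, 3, 1, 0⟩], []⟩,
    ⟨1, [⟨0, 3, 0, 3, 1, 3, 1, 0⟩], []⟩,
    ⟨1, [⟨0, 3, 0, 3, 1, 3, 1, 0⟩], []⟩,
    ⟨1, [⟨0, 3, 0, 3, 1, 3, 1, 0⟩], []⟩,
    ⟨1, [⟨0, 3, 0, 3, 2, 3, 2, 0⟩], []⟩,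
    ⟨1, [⟨0, 3, 0, 3, 2, 3, 2, 0⟩], []⟩,
    ⟨1, [⟨0, 5, 0, 3, 1, 3, 1, 0⟩], []⟩,
    ⟨1, [⟨0, 3, 0, 3, 1, 3, 1, 0⟩], []⟩,
    ⟨1, [⟨0, 3, 0, 3, 1, 3, 1, 0⟩], []⟩,
    ⟨1, [⟨0, 3, 0, 3, 1, 3, 1, 0⟩], []⟩,
    ⟨1, [⟨0, 3, 0, 3, 1, 3, 1, 0⟩], []⟩]

def row4 : List Entry :=
  [⟨3, [⟨0, 29, 0, 3, 1, 3, 1, 0⟩, ⟨1, 2, 0, 4, 1, 2, 2, 0⟩], []⟩,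
    ⟨3, [⟨-3, 3, 0, 3, 4, 3, 4, 0⟩, ⟨0, 5, 0, 4, 1, 2, 2, 0⟩], []⟩,
    ⟨3, [⟨0, 5, 0, 3, 2, 3, 2, 0⟩, ⟨0, 23, 0, 4, 1, 4, 1, 0⟩], []⟩,
    ⟨3, [⟨0, 3, 1, 4, 1, 3, 1, 0⟩, ⟨0, 7, 0, 4, 1, 4, 1, 0⟩], []⟩,
    ⟨3, [⟨0, 3, 0, 3, 1, 3, 1, 0⟩, ⟨0, 19, 0, 4, 1, 4, 1, 0⟩], []⟩,
    ⟨3, [⟨0, 3, 0, 3, 1, 3, 1, 0⟩, ⟨0, 17, 0, 4, 1, 4, 1, 0⟩], []⟩,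
    ⟨3, [⟨0, 3, 1, 4, 1, 3, 1, 0⟩, ⟨0, 5, 0, 4, 1, 4, 1, 0⟩], []⟩,
    ⟨3, [⟨0, 3, 0, 3, 1, 3, 1, 0⟩, ⟨0, 13, 0, 4, 1, 4, 1, 0⟩], []⟩,
    ⟨3, [⟨0, 3, 0, 3, 1, 3, 1, 0⟩, ⟨0, 11, 0, 4, 1, 4, 1, 0⟩], []⟩,
    ⟨3, [⟨0, 3, 1, 4, 2, 3, 2, 0⟩, ⟨1, 2, 0, 4, 1, 2, 2, 0⟩], []⟩,
    ⟨3, [⟨0, 3, 0, 3, 2, 3, 2, 0⟩, ⟨0, 7, 0, 4, 1, 4, 1, 0⟩], []⟩,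
    ⟨3, [⟨0, 3, 0, 3, 2, 3, 2, 0⟩, ⟨0, 5, 0, 4, 1, 4, 1, 0⟩], []⟩,
    ⟨3, [⟨0, 3, 1, 4, 1, 3, 1, 0⟩, ⟨1, 2, 0, 4, 1, 2, 2, 0⟩], []⟩,
    ⟨3, [⟨0, 3, 0, 3, 1, 3, 1, 0⟩, ⟨1, 2, 0, 4, 1, 2, 2, 0⟩], []⟩,
    ⟨3, [⟨0, 3, 0, 3, 1, 3, 1, 0⟩, ⟨1, 2, 0, 4, 1, 2, 2, 0⟩], []⟩,
    ⟨3, [⟨0, 3, 1, 4, 1, 3, 1, 0⟩, ⟨1, 2, 0, 4, 1, 2, 2, 0⟩], []⟩,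
    ⟨3, [⟨0, 3, 0, 3, 1, 3, 1, 0⟩, ⟨0, 5, 0, 4, 1, 4, 1, 0⟩], []⟩]

def row5 : List Entry :=
  [⟨1, [⟨0, 5, 0, 5, 2, 5, 2, 0⟩], []⟩,
    ⟨1, [⟨0, 5, 0, 5, 2, 5, 2, 0⟩], []⟩,
    ⟨1, [⟨0, 5, 0, 5, 2, 5, 2, 0⟩], []⟩,
    ⟨1, [⟨0, 19, 0, 5, 1, 5, 1, 0⟩], []⟩,
    ⟨1, [⟨0, 17, 0, 5, 1, 5, 1, 0⟩], []⟩,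
    ⟨1, [⟨0, 5, 0, 5, 1, 5, 1, 0⟩], []⟩,
    ⟨1, [⟨0, 5, 0, 5, 1, 5, 1, 0⟩], []⟩,
    ⟨1, [⟨0, 5, 0, 5, 1, 5, 1, 0⟩], []⟩,
    ⟨1, [⟨0, 3, 0, 5, 3, 5, 3, 0⟩], []⟩,
    ⟨1, [⟨0, 5, 0, 5, 1, 5, 1, 0⟩], []⟩,
    ⟨1, [⟨0, 5, 0, 5, 1, 5, 1, 0⟩], []⟩,
    ⟨1, [⟨0, 5, 0, 5, 1, 5, 1, 0⟩], []⟩,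
    ⟨1, [⟨0, 5, 0, 5, 1, 5, 1, 0⟩], []⟩,
    ⟨1, [⟨0, 5, 0, 5, 1, 5, 1, 0⟩], []⟩,
    ⟨1, [⟨0, 5, 0, 5, 1, 5, 1, 0⟩], []⟩,
    ⟨1, [⟨0, 5, 0, 5, 1, 5, 1, 0⟩], []⟩,
    ⟨1, [⟨0, 5, 0, 5, 1, 5, 1, 0⟩], []⟩]

def row6 : List Entry :=
  [⟨5, [⟨0, 5, 0, 5, 2, 5, 2, 0⟩, ⟨0, 23, 0, 6, 1, 6, 1, 0⟩], []⟩,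
    ⟨5, [⟨0, 5, 0, 5, 2, 5, 2, 0⟩, ⟨0, 7, 0, 6, 1, 6, 1, 0⟩], []⟩,
    ⟨5, [⟨0, 5, 0, 5, 2, 5, 2, 0⟩, ⟨0, 19, 0, 6, 1, 6, 1, 0⟩], []⟩,
    ⟨5, [⟨0, 19, 0, 5, 1, 5, 1, 0⟩, ⟨0, 17, 0, 6, 1, 6, 1, 0⟩], []⟩,
    ⟨5, [⟨0, 5, 1, 6, 1, 5, 1, 0⟩, ⟨0, 3, 0, 6, 1, 3, 2, 0⟩], []⟩,
    ⟨5, [⟨0, 5, 0, 5, 1, 5, 1, 0⟩, ⟨0, 3, 0, 6, 1, 3, 2, 0⟩], []⟩,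
    ⟨5, [⟨0, 5, 0, 5, 1, 5, 1, 0⟩, ⟨0, 3, 0, 6, 1, 3, 2, 0⟩], []⟩,
    ⟨5, [⟨0, 5, 0, 5, 1, 5, 1, 0⟩, ⟨0, 3, 0, 6, 1, 2, 3, 0⟩], []⟩,
    ⟨5, [⟨0, 5, 0, 5, 1, 5, 1, 0⟩, ⟨0, 3, 0, 6, 1, 2, 3, 0⟩], []⟩,
    ⟨5, [⟨0, 5, 1, 6, 1, 5, 1, 0⟩, ⟨0, 3, 0, 6, 1, 2, 3, 0⟩], []⟩,
    ⟨5, [⟨0, 5, 0, 5, 1, 5, 1, 0⟩, ⟨1, 2, 0, 6, 1, 2, 3, 0⟩], []⟩,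
    ⟨5, [⟨0, 5, 0, 5, 1, 5, 1, 0⟩, ⟨1, 2, 0, 6, 1, 2, 3, 0⟩], []⟩,
    ⟨5, [⟨0, 5, 0, 5, 1, 5, 1, 0⟩, ⟨1, 2, 0, 6, 1, 2, 3, 0⟩], []⟩,
    ⟨5, [⟨0, 5, 0, 5, 1, 5, 1, 0⟩, ⟨0, 3, 0, 6, 1, 3, 2, 0⟩], []⟩,
    ⟨5, [⟨0, 5, 1, 6, 1, 5, 1, 0⟩, ⟨0, 3, 0, 6, 1, 3, 2, 0⟩], []⟩,
    ⟨5, [⟨0, 5, 0, 5, 1, 5, 1, 0⟩, ⟨0, 3, 0, 6, 1, 3, 2, 0⟩], []⟩,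
    ⟨5, [⟨0, 5, 0, 5, 1, 5, 1, 0⟩, ⟨0, 3, 0, 6, 1, 2, 3, 0⟩], []⟩]

def row7 : List Entry :=
  [⟨1, [⟨0, 7, 0, 7, 1, 7, 1, 0⟩], []⟩,
    ⟨1, [⟨0, 7, 0, 7, 1, 7, 1, 0⟩], []⟩,
    ⟨1, [⟨0, 7, 0, 7, 1, 7, 1, 0⟩], []⟩,
    ⟨1, [⟨0, 7, 0, 7, 1, 7, 1, 0⟩], []⟩,
    ⟨1, [⟨0, 7, 0, 7, 1, 7, 1, 0⟩], []⟩,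
    ⟨1, [⟨0, 7, 0, 7, 1, 7, 1, 0⟩], []⟩,
    ⟨1, [⟨0, 7, 0, 7, 1, 7, 1, 0⟩], []⟩,
    ⟨1, [⟨0, 7, 0, 7, 1, 7, 1, 0⟩], []⟩,
    ⟨1, [⟨0, 7, 0, 7, 1, 7, 1, 0⟩], []⟩,
    ⟨1, [⟨0, 7, 0, 7, 1, 7, 1, 0⟩], []⟩,
    ⟨1, [⟨0, 7, 0, 7, 1, 7, 1, 0⟩], []⟩,
    ⟨1, [⟨0, 7, 0, 7, 1, 7, 1, 0⟩], []⟩,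
    ⟨1, [⟨0, 7, 0, 7, 1, 7, 1, 0⟩], []⟩,
    ⟨1, [⟨0, 7, 0, 7, 1, 7, 1, 0⟩], []⟩,
    ⟨1, [⟨0, 7, 0, 7, 1, 7, 1, 0⟩], []⟩,
    ⟨1, [⟨0, 7, 0, 7, 1, 7, 1, 0⟩], []⟩,
    ⟨1, [⟨0, 7, 0, 7, 1, 7, 1, 0⟩], []⟩]

def row8 : List Entry :=
  [⟨5, [⟨0, 5, 0, 5, 2, 5, 2, 0⟩, ⟨0, 19, 0, 8, 1, 8, 1, 0⟩], []⟩,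
    ⟨5, [⟨0, 5, 0, 5, 2, 5, 2, 0⟩, ⟨0, 17, 0, 8, 1, 8, 1, 0⟩], []⟩,
    ⟨5, [⟨0, 5, 3, 8, 1, 5, 1, 0⟩, ⟨0, 7, 0, 7, 1, 7, 1, 0⟩, ⟨1, 2, 0, 8, 1, 2, 4, 0⟩], []⟩,
    ⟨5, [⟨0, 5, 2, 7, 1, 5, 1, 0⟩, ⟨0, 13, 0, 8, 1, 8, 1, 0⟩], []⟩,
    ⟨5, [⟨0, 5, 1, 6, 1, 5, 1, 0⟩, ⟨0, 11, 0, 8, 1, 8, 1, 0⟩], []⟩,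
    ⟨5, [⟨0, 5, 0, 5, 1, 5, 1, 0⟩, ⟨0, 3, 0, 8, 1, 2, 4, 0⟩, ⟨0, 7, 0, 7, 1, 7, 1, 0⟩], []⟩,
    ⟨5, [⟨0, 5, 0, 5, 1, 5, 1, 0⟩, ⟨0, 7, 1, 8, 1, 7, 1, 0⟩, ⟨1, 2, 0, 8, 1, 2, 4, 0⟩], []⟩,
    ⟨5, [⟨0, 5, 3, 8, 1, 5, 1, 0⟩, ⟨0, 7, 0, 7, 1, 7, 1, 0⟩, ⟨1, 2, 0, 8, 1, 2, 4, 0⟩], []⟩,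
    ⟨5, [⟨0, 3, 0, 5, 3, 5, 4, 1⟩, ⟨0, 7, 0, 7, 1, 7, 1, 0⟩, ⟨1, 2, 0, 8, 1, 2, 4, 0⟩], []⟩,
    ⟨5, [⟨0, 5, 1, 6, 1, 5, 1, 0⟩, ⟨0, 7, 0, 7, 1, 7, 1, 0⟩, ⟨1, 2, 0, 8, 1, 2, 4, 0⟩], []⟩,
    ⟨5, [⟨0, 5, 0, 5, 1, 5, 1, 0⟩, ⟨0, 7, 0, 7, 1, 7, 1, 0⟩, ⟨1, 2, 0, 8, 1, 2, 4, 0⟩], []⟩,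
    ⟨5, [⟨0, 5, 0, 5, 1, 5, 1, 0⟩, ⟨0, 7, 0, 7, 1, 7, 1, 0⟩, ⟨1, 2, 0, 8, 1, 2, 4, 0⟩], []⟩,
    ⟨5, [⟨0, 5, 3, 8, 1, 5, 1, 0⟩, ⟨0, 7, 0, 7, 1, 7, 1, 0⟩, ⟨1, 2, 0, 8, 1, 2, 4, 0⟩], []⟩,
    ⟨5, [⟨0, 5, 2, 7, 1, 5, 1, 0⟩, ⟨0, 7, 1, 8, 1, 7, 1, 0⟩, ⟨1, 2, 0, 8, 1, 2, 4, 0⟩], []⟩,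
    ⟨5, [⟨0, 5, 1, 6, 1, 5, 1, 0⟩, ⟨0, 3, 0, 8, 1, 2, 4, 0⟩, ⟨0, 7, 0, 7, 1, 7, 1, 0⟩], []⟩,
    ⟨5, [⟨0, 5, 0, 5, 1, 5, 1, 0⟩, ⟨0, 11, 0, 8, 1, 8, 1, 0⟩], []⟩,
    ⟨5, [⟨0, 5, 0, 5, 1, 5, 1, 0⟩, ⟨0, 13, 0, 8, 1, 8, 1, 0⟩], []⟩]

def row9 : List Entry :=
  [⟨5, [⟨0, 5, 0, 5, 2, 5, 2, 0⟩, ⟨0, 3, 0, 9, 5, 9, 5, 0⟩], []⟩,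
    ⟨5, [⟨0, 5, 4, 9, 1, 5, 1, 0⟩, ⟨0, 17, 0, 8, 1, 8, 1, 0⟩], [(11, 1)]⟩,
    ⟨5, [⟨0, 5, 3, 8, 1, 5, 1, 0⟩, ⟨0, 13, 0, 9, 1, 9, 1, 0⟩], []⟩,
    ⟨5, [⟨0, 5, 2, 7, 1, 5, 1, 0⟩, ⟨0, 11, 0, 9, 1, 9, 1, 0⟩], []⟩,
    ⟨5, [⟨0, 5, 1, 6, 1, 5, 1, 0⟩, ⟨0, 3, 0, 9, 4, 9, 4, 0⟩], []⟩,
    ⟨5, [⟨0, 5, 0, 5, 1, 5, 1, 0⟩, ⟨0, 3, 0, 9, 4, 9, 4, 0⟩], []⟩,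
    ⟨5, [⟨0, 5, 4, 9, 1, 5, 1, 0⟩, ⟨0, 3, 0, 9, 4, 9, 4, 0⟩], []⟩,
    ⟨5, [⟨0, 5, 3, 8, 1, 5, 1, 0⟩, ⟨0, 3, 0, 9, 4, 9, 4, 0⟩], []⟩,
    ⟨5, [⟨0, 5, 2, 7, 1, 5, 1, 0⟩, ⟨0, 3, 0, 9, 4, 9, 4, 0⟩], []⟩,
    ⟨5, [⟨0, 5, 1, 6, 1, 5, 1, 0⟩, ⟨0, 3, 0, 9, 4, 9, 4, 0⟩], []⟩,
    ⟨5, [⟨0, 5, 0, 5, 1, 5, 1, 0⟩, ⟨0, 3, 0, 9, 4, 9, 4, 0⟩], []⟩,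
    ⟨5, [⟨0, 5, 4, 9, 1, 5, 1, 0⟩, ⟨0, 3, 0, 9, 4, 9, 4, 0⟩], []⟩,
    ⟨5, [⟨0, 5, 3, 8, 1, 5, 1, 0⟩, ⟨0, 3, 0, 9, 4, 9, 4, 0⟩], []⟩,
    ⟨5, [⟨0, 5, 2, 7, 1, 5, 1, 0⟩, ⟨0, 3, 0, 9, 4, 9, 4, 0⟩], []⟩,
    ⟨5, [⟨0, 5, 1, 6, 1, 5, 1, 0⟩, ⟨0, 3, 0, 9, 4, 9, 4, 0⟩], []⟩,
    ⟨5, [⟨0, 5, 0, 5, 1, 5, 1, 0⟩, ⟨0, 3, 0, 9, 4, 9, 4, 0⟩], []⟩,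
    ⟨5, [⟨0, 5, 4, 9, 1, 5, 1, 0⟩, ⟨0, 3, 0, 9, 4, 9, 4, 0⟩], []⟩]

def row10 : List Entry :=
  [⟨7, [⟨0, 7, 0, 7, 1, 7, 1, 0⟩, ⟨0, 17, 0, 9, 1, 9, 1, 0⟩, ⟨1, 2, 0, 10, 1, 2, 5, 0⟩], []⟩,
    ⟨7, [⟨0, 7, 0, 7, 1, 7, 1, 0⟩, ⟨0, 13, 0, 10, 1, 10, 1, 0⟩], []⟩,
    ⟨7, [⟨0, 7, 0, 7, 1, 7, 1, 0⟩, ⟨0, 11, 0, 10, 1, 10, 1, 0⟩], []⟩,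
    ⟨7, [⟨0, 7, 0, 7, 1, 7, 1, 0⟩, ⟨0, 3, 1, 10, 4, 9, 4, 0⟩, ⟨1, 2, 0, 10, 1, 2, 5, 0⟩], []⟩,
    ⟨7, [⟨0, 7, 3, 10, 1, 7, 1, 0⟩, ⟨0, 3, 0, 9, 4, 9, 4, 0⟩, ⟨1, 2, 0, 10, 1, 2, 5, 0⟩], []⟩,
    ⟨7, [⟨0, 7, 2, 9, 1, 7, 1, 0⟩, ⟨0, 5, 0, 10, 1, 5, 2, 0⟩], []⟩,
    ⟨7, [⟨0, 7, 1, 8, 1, 7, 1, 0⟩, ⟨0, 5, 0, 10, 1, 5, 2, 0⟩], []⟩,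
    ⟨7, [⟨0, 7, 0, 7, 1, 7, 1, 0⟩, ⟨0, 5, 0, 10, 1, 5, 2, 0⟩], []⟩,
    ⟨7, [⟨0, 7, 0, 7, 1, 7, 1, 0⟩, ⟨0, 5, 0, 10, 1, 5, 2, 0⟩], []⟩,
    ⟨7, [⟨0, 7, 0, 7, 1, 7, 1, 0⟩, ⟨0, 5, 0, 10, 1, 5, 2, 0⟩], []⟩,
    ⟨7, [⟨0, 7, 0, 7, 1, 7, 1, 0⟩, ⟨0, 5, 0, 10, 1, 5, 2, 0⟩], []⟩,
    ⟨7, [⟨0, 7, 3, 10, 1, 7, 1, 0⟩, ⟨0, 5, 0, 10, 1, 5, 2, 0⟩], []⟩,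
    ⟨7, [⟨0, 7, 2, 9, 1, 7, 1, 0⟩, ⟨0, 5, 0, 10, 1, 5, 2, 0⟩], []⟩,
    ⟨7, [⟨0, 7, 1, 8, 1, 7, 1, 0⟩, ⟨0, 5, 0, 10, 1, 5, 2, 0⟩], []⟩,
    ⟨7, [⟨0, 7, 0, 7, 1, 7, 1, 0⟩, ⟨0, 5, 0, 10, 1, 5, 2, 0⟩], []⟩,
    ⟨7, [⟨0, 7, 0, 7, 1, 7, 1, 0⟩, ⟨0, 5, 0, 10, 1, 5, 2, 0⟩], []⟩,
    ⟨7, [⟨0, 7, 0, 7, 1, 7, 1, 0⟩, ⟨0, 5, 0, 10, 1, 5, 2, 0⟩], []⟩]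

def row11 : List Entry :=
  [⟨7, [⟨0, 7, 0, 7, 1, 7, 1, 0⟩, ⟨0, 11, 0, 11, 1, 11, 1, 0⟩], []⟩,
    ⟨7, [⟨0, 7, 0, 7, 1, 7, 1, 0⟩, ⟨0, 11, 0, 11, 1, 11, 1, 0⟩], []⟩,
    ⟨7, [⟨0, 7, 0, 7, 1, 7, 1, 0⟩, ⟨0, 11, 0, 11, 1, 11, 1, 0⟩], []⟩,
    ⟨7, [⟨0, 7, 4, 11, 1, 7, 1, 0⟩, ⟨0, 11, 0, 11, 1, 11, 1, 0⟩], []⟩,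
    ⟨7, [⟨0, 7, 3, 10, 1, 7, 1, 0⟩, ⟨0, 11, 0, 11, 1, 11, 1, 0⟩], []⟩,
    ⟨7, [⟨0, 7, 2, 9, 1, 7, 1, 0⟩, ⟨0, 11, 0, 11, 1, 11, 1, 0⟩], []⟩,
    ⟨7, [⟨0, 7, 1, 8, 1, 7, 1, 0⟩, ⟨0, 11, 0, 11, 1, 11, 1, 0⟩], []⟩,
    ⟨7, [⟨0, 7, 0, 7, 1, 7, 1, 0⟩, ⟨0, 11, 0, 11, 1, 11, 1, 0⟩], []⟩,
    ⟨7, [⟨0, 7, 0, 7, 1, 7, 1, 0⟩, ⟨0, 11, 0, 11, 1, 11, 1, 0⟩], []⟩,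
    ⟨7, [⟨0, 7, 0, 7, 1, 7, 1, 0⟩, ⟨0, 11, 0, 11, 1, 11, 1, 0⟩], []⟩,
    ⟨7, [⟨0, 7, 4, 11, 1, 7, 1, 0⟩, ⟨0, 11, 0, 11, 1, 11, 1, 0⟩], []⟩,
    ⟨7, [⟨0, 7, 3, 10, 1, 7, 1, 0⟩, ⟨0, 11, 0, 11, 1, 11, 1, 0⟩], []⟩,
    ⟨7, [⟨0, 7, 2, 9, 1, 7, 1, 0⟩, ⟨0, 11, 0, 11, 1, 11, 1, 0⟩], []⟩,
    ⟨7, [⟨0, 7, 1, 8, 1, 7, 1, 0⟩, ⟨0, 11, 0, 11, 1, 11, 1, 0⟩], []⟩,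
    ⟨7, [⟨0, 7, 0, 7, 1, 7, 1, 0⟩, ⟨0, 11, 0, 11, 1, 11, 1, 0⟩], []⟩,
    ⟨7, [⟨0, 7, 0, 7, 1, 7, 1, 0⟩, ⟨0, 11, 0, 11, 1, 11, 1, 0⟩], []⟩,
    ⟨7, [⟨0, 7, 0, 7, 1, 7, 1, 0⟩, ⟨0, 11, 0, 11, 1, 11, 1, 0⟩], []⟩]

def row12 : List Entry :=
  [⟨7, [⟨0, 7, 0, 7, 1, 7, 1, 0⟩, ⟨0, 11, 1, 12, 1, 11, 1, 0⟩, ⟨1, 2, 0, 12, 1, 2, 6, 0⟩], []⟩,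
    ⟨7, [⟨0, 7, 0, 7, 1, 7, 1, 0⟩, ⟨0, 11, 0, 11, 1, 11, 1, 0⟩, ⟨1, 2, 0, 12, 1, 2, 6, 0⟩], []⟩,
    ⟨7, [⟨0, 7, 5, 12, 1, 7, 1, 0⟩, ⟨0, 11, 0, 11, 1, 11, 1, 0⟩, ⟨1, 2, 0, 12, 1, 2, 6, 0⟩], []⟩,
    ⟨7, [⟨0, 7, 4, 11, 1, 7, 1, 0⟩, ⟨0, 11, 0, 11, 1, 11, 1, 0⟩, ⟨1, 2, 0, 12, 1, 2, 6, 0⟩], []⟩,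
    ⟨7, [⟨0, 7, 3, 10, 1, 7, 1, 0⟩, ⟨0, 11, 0, 11, 1, 11, 1, 0⟩, ⟨1, 2, 0, 12, 1, 2, 6, 0⟩], []⟩,
    ⟨7, [⟨0, 7, 2, 9, 1, 7, 1, 0⟩, ⟨0, 11, 0, 11, 1, 11, 1, 0⟩, ⟨1, 2, 0, 12, 1, 2, 6, 0⟩], []⟩,
    ⟨7, [⟨0, 7, 1, 8, 1, 7, 1, 0⟩, ⟨0, 11, 0, 11, 1, 11, 1, 0⟩, ⟨1, 2, 0, 12, 1, 2, 6, 0⟩], []⟩,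
    ⟨7, [⟨0, 7, 0, 7, 1, 7, 1, 0⟩, ⟨0, 11, 0, 11, 1, 11, 1, 0⟩, ⟨1, 2, 0, 12, 1, 2, 6, 0⟩], []⟩,
    ⟨7, [⟨0, 7, 0, 7, 1, 7, 1, 0⟩, ⟨0, 11, 0, 11, 1, 11, 1, 0⟩, ⟨1, 2, 0, 12, 1, 2, 6, 0⟩], []⟩,
    ⟨7, [⟨0, 7, 5, 12, 1, 7, 1, 0⟩, ⟨0, 11, 0, 11, 1, 11, 1, 0⟩, ⟨1, 2, 0, 12, 1, 2, 6, 0⟩], []⟩,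
    ⟨7, [⟨0, 7, 4, 11, 1, 7, 1, 0⟩, ⟨0, 11, 0, 11, 1, 11, 1, 0⟩, ⟨1, 2, 0, 12, 1, 2, 6, 0⟩], []⟩,
    ⟨7, [⟨0, 7, 3, 10, 1, 7, 1, 0⟩, ⟨0, 11, 1, 12, 1, 11, 1, 0⟩, ⟨1, 2, 0, 12, 1, 2, 6, 0⟩], []⟩,
    ⟨7, [⟨0, 7, 2, 9, 1, 7, 1, 0⟩, ⟨0, 13, 0, 12, 1, 12, 1, 0⟩], []⟩,
    ⟨7, [⟨0, 7, 1, 8, 1, 7, 1, 0⟩, ⟨0, 11, 0, 11, 1, 11, 1, 0⟩, ⟨1, 2, 0, 12, 1, 2, 6, 0⟩], []⟩,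
    ⟨7, [⟨0, 7, 0, 7, 1, 7, 1, 0⟩, ⟨0, 17, 0, 12, 1, 12, 1, 0⟩], []⟩,
    ⟨7, [⟨0, 7, 0, 7, 1, 7, 1, 0⟩, ⟨0, 19, 0, 12, 1, 12, 1, 0⟩], []⟩,
    ⟨7, [⟨0, 7, 5, 12, 1, 7, 1, 0⟩, ⟨0, 11, 0, 11, 1, 11, 1, 0⟩, ⟨1, 2, 0, 12, 1, 2, 6, 0⟩], []⟩]

def row13 : List Entry :=
  [⟨7, [⟨0, 7, 0, 7, 1, 7, 1, 0⟩, ⟨0, 13, 0, 13, 1, 13, 1, 0⟩], []⟩,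
    ⟨7, [⟨0, 7, 6, 13, 1, 7, 1, 0⟩, ⟨0, 13, 0, 13, 1, 13, 1, 0⟩], []⟩,
    ⟨7, [⟨0, 7, 5, 12, 1, 7, 1, 0⟩, ⟨0, 13, 0, 13, 1, 13, 1, 0⟩], []⟩,
    ⟨7, [⟨0, 7, 4, 11, 1, 7, 1, 0⟩, ⟨0, 13, 0, 13, 1, 13, 1, 0⟩], []⟩,
    ⟨7, [⟨0, 7, 3, 10, 1, 7, 1, 0⟩, ⟨0, 13, 0, 13, 1, 13, 1, 0⟩], []⟩,
    ⟨7, [⟨0, 7, 2, 9, 1, 7, 1, 0⟩, ⟨0, 13, 0, 13, 1, 13, 1, 0⟩], []⟩,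
    ⟨7, [⟨0, 7, 1, 8, 1, 7, 1, 0⟩, ⟨0, 13, 0, 13, 1, 13, 1, 0⟩], []⟩,
    ⟨7, [⟨0, 7, 0, 7, 1, 7, 1, 0⟩, ⟨0, 13, 0, 13, 1, 13, 1, 0⟩], []⟩,
    ⟨7, [⟨0, 7, 6, 13, 1, 7, 1, 0⟩, ⟨0, 13, 0, 13, 1, 13, 1, 0⟩], []⟩,
    ⟨7, [⟨0, 7, 5, 12, 1, 7, 1, 0⟩, ⟨0, 13, 0, 13, 1, 13, 1, 0⟩], []⟩,
    ⟨7, [⟨0, 7, 4, 11, 1, 7, 1, 0⟩, ⟨0, 13, 0, 13, 1, 13, 1, 0⟩], []⟩,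
    ⟨7, [⟨0, 7, 3, 10, 1, 7, 1, 0⟩, ⟨0, 13, 0, 13, 1, 13, 1, 0⟩], []⟩,
    ⟨7, [⟨0, 7, 2, 9, 1, 7, 1, 0⟩, ⟨0, 13, 0, 13, 1, 13, 1, 0⟩], []⟩,
    ⟨7, [⟨0, 7, 1, 8, 1, 7, 1, 0⟩, ⟨0, 13, 0, 13, 1, 13, 1, 0⟩], []⟩,
    ⟨7, [⟨0, 7, 0, 7, 1, 7, 1, 0⟩, ⟨0, 13, 0, 13, 1, 13, 1, 0⟩], []⟩,
    ⟨7, [⟨0, 7, 6, 13, 1, 7, 1, 0⟩, ⟨0, 13, 0, 13, 1, 13, 1, 0⟩], []⟩,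
    ⟨7, [⟨0, 7, 5, 12, 1, 7, 1, 0⟩, ⟨0, 13, 0, 13, 1, 13, 1, 0⟩], []⟩]

def row14 : List Entry :=
  [⟨11, [⟨0, 11, 1, 12, 1, 11, 1, 0⟩, ⟨0, 7, 0, 14, 1, 7, 2, 0⟩], []⟩,
    ⟨11, [⟨0, 11, 0, 11, 1, 11, 1, 0⟩, ⟨0, 7, 0, 14, 1, 7, 2, 0⟩], []⟩,
    ⟨11, [⟨0, 11, 0, 11, 1, 11, 1, 0⟩, ⟨0, 7, 0, 14, 1, 7, 2, 0⟩], []⟩,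
    ⟨11, [⟨0, 11, 0, 11, 1, 11, 1, 0⟩, ⟨0, 7, 0, 14, 1, 7, 2, 0⟩], []⟩,
    ⟨11, [⟨0, 11, 0, 11, 1, 11, 1, 0⟩, ⟨0, 7, 0, 14, 1, 7, 2, 0⟩], []⟩,
    ⟨11, [⟨0, 11, 0, 11, 1, 11, 1, 0⟩, ⟨0, 7, 0, 14, 1, 7, 2, 0⟩], []⟩,
    ⟨11, [⟨0, 11, 0, 11, 1, 11, 1, 0⟩, ⟨0, 7, 0, 14, 1, 7, 2, 0⟩], []⟩,
    ⟨11, [⟨0, 11, 0, 11, 1, 11, 1, 0⟩, ⟨0, 7, 0, 14, 1, 7, 2, 0⟩], []⟩,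
    ⟨11, [⟨0, 11, 0, 11, 1, 11, 1, 0⟩, ⟨0, 7, 0, 14, 1, 7, 2, 0⟩], []⟩,
    ⟨11, [⟨0, 11, 3, 14, 1, 11, 1, 0⟩, ⟨0, 7, 0, 14, 1, 7, 2, 0⟩], []⟩,
    ⟨11, [⟨0, 11, 2, 13, 1, 11, 1, 0⟩, ⟨0, 7, 0, 14, 1, 7, 2, 0⟩], []⟩,
    ⟨11, [⟨0, 11, 1, 12, 1, 11, 1, 0⟩, ⟨0, 7, 0, 14, 1, 7, 2, 0⟩], []⟩,
    ⟨11, [⟨0, 11, 0, 11, 1, 11, 1, 0⟩, ⟨0, 7, 0, 14, 1, 7, 2, 0⟩], []⟩,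
    ⟨11, [⟨0, 11, 0, 11, 1, 11, 1, 0⟩, ⟨0, 7, 0, 14, 1, 7, 2, 0⟩], []⟩,
    ⟨11, [⟨0, 11, 0, 11, 1, 11, 1, 0⟩, ⟨0, 7, 0, 14, 1, 7, 2, 0⟩], []⟩,
    ⟨11, [⟨0, 11, 0, 11, 1, 11, 1, 0⟩, ⟨0, 7, 0, 14, 1, 7, 2, 0⟩], []⟩,
    ⟨11, [⟨0, 11, 0, 11, 1, 11, 1, 0⟩, ⟨0, 5, 0, 14, 2, 7, 4, 0⟩], []⟩]

def row15 : List Entry :=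
  [⟨11, [⟨0, 11, 1, 12, 1, 11, 1, 0⟩, ⟨0, 7, 0, 14, 1, 7, 2, 0⟩], [(41, 1)]⟩,
    ⟨11, [⟨0, 11, 0, 11, 1, 11, 1, 0⟩, ⟨0, 7, 0, 14, 1, 7, 2, 0⟩], [(47, 1)]⟩,
    ⟨11, [⟨0, 11, 0, 11, 1, 11, 1, 0⟩, ⟨0, 7, 0, 14, 1, 7, 2, 0⟩], [(31, 1)]⟩,
    ⟨11, [⟨0, 11, 0, 11, 1, 11, 1, 0⟩, ⟨0, 7, 0, 14, 1, 7, 2, 0⟩], [(43, 1)]⟩,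
    ⟨11, [⟨0, 11, 0, 11, 1, 11, 1, 0⟩, ⟨0, 7, 0, 14, 1, 7, 2, 0⟩], [(31, 1)]⟩,
    ⟨11, [⟨0, 11, 0, 11, 1, 11, 1, 0⟩, ⟨0, 5, 0, 15, 1, 5, 3, 0⟩], []⟩,
    ⟨11, [⟨0, 11, 0, 11, 1, 11, 1, 0⟩, ⟨0, 5, 0, 15, 1, 5, 3, 0⟩], []⟩,
    ⟨11, [⟨0, 11, 0, 11, 1, 11, 1, 0⟩, ⟨0, 5, 0, 15, 1, 5, 3, 0⟩], []⟩,
    ⟨11, [⟨0, 11, 4, 15, 1, 11, 1, 0⟩, ⟨0, 5, 0, 15, 1, 5, 3, 0⟩], []⟩,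
    ⟨11, [⟨0, 11, 3, 14, 1, 11, 1, 0⟩, ⟨0, 5, 0, 15, 1, 5, 3, 0⟩], []⟩,
    ⟨11, [⟨0, 11, 2, 13, 1, 11, 1, 0⟩, ⟨0, 5, 0, 15, 1, 5, 3, 0⟩], []⟩,
    ⟨11, [⟨0, 11, 1, 12, 1, 11, 1, 0⟩, ⟨0, 5, 0, 15, 1, 5, 3, 0⟩], []⟩,
    ⟨11, [⟨0, 11, 0, 11, 1, 11, 1, 0⟩, ⟨0, 5, 0, 15, 1, 5, 3, 0⟩], []⟩,
    ⟨11, [⟨0, 11, 0, 11, 1, 11, 1, 0⟩, ⟨0, 5, 0, 15, 1, 5, 3, 0⟩], []⟩,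
    ⟨11, [⟨0, 11, 0, 11, 1, 11, 1, 0⟩, ⟨0, 5, 0, 15, 1, 5, 3, 0⟩], []⟩,
    ⟨11, [⟨0, 11, 0, 11, 1, 11, 1, 0⟩, ⟨0, 5, 0, 15, 4, 15, 4, 0⟩], []⟩,
    ⟨11, [⟨0, 11, 0, 11, 1, 11, 1, 0⟩, ⟨0, 3, 0, 15, 8, 15, 8, 0⟩], []⟩]

def row16 : List Entry :=
  [⟨13, [⟨0, 13, 0, 13, 1, 13, 1, 0⟩, ⟨1, 2, 0, 16, 1, 2, 8, 0⟩], [(43, 2)]⟩,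
    ⟨13, [⟨0, 13, 0, 13, 1, 13, 1, 0⟩, ⟨1, 2, 0, 16, 1, 2, 8, 0⟩], [(41, 2)]⟩,
    ⟨13, [⟨0, 13, 0, 13, 1, 13, 1, 0⟩, ⟨1, 2, 0, 16, 1, 2, 8, 0⟩], [(37, 2)]⟩,
    ⟨13, [⟨0, 13, 0, 13, 1, 13, 1, 0⟩, ⟨1, 2, 0, 16, 1, 2, 8, 0⟩], [(37, 2)]⟩,
    ⟨11, [⟨0, 11, 0, 11, 1, 11, 1, 0⟩, ⟨0, 5, 1, 16, 1, 5, 3, 0⟩, ⟨1, 2, 0, 16, 1, 2, 8, 0⟩], []⟩,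
    ⟨11, [⟨0, 11, 0, 11, 1, 11, 1, 0⟩, ⟨0, 5, 0, 15, 1, 5, 3, 0⟩, ⟨1, 2, 0, 16, 1, 2, 8, 0⟩], []⟩,
    ⟨11, [⟨0, 11, 0, 11, 1, 11, 1, 0⟩, ⟨0, 5, 0, 15, 1, 5, 3, 0⟩, ⟨1, 2, 0, 16, 1, 2, 8, 0⟩], []⟩,
    ⟨11, [⟨0, 11, 5, 16, 1, 11, 1, 0⟩, ⟨0, 5, 0, 15, 1, 5, 3, 0⟩, ⟨1, 2, 0, 16, 1, 2, 8, 0⟩], []⟩,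
    ⟨11, [⟨0, 11, 4, 15, 1, 11, 1, 0⟩, ⟨0, 5, 0, 15, 1, 5, 3, 0⟩, ⟨1, 2, 0, 16, 1, 2, 8, 0⟩], []⟩,
    ⟨11, [⟨0, 11, 3, 14, 1, 11, 1, 0⟩, ⟨0, 5, 1, 16, 1, 5, 3, 0⟩, ⟨1, 2, 0, 16, 1, 2, 8, 0⟩], []⟩,
    ⟨11, [⟨0, 11, 2, 13, 1, 11, 1, 0⟩, ⟨0, 17, 0, 16, 1, 16, 1, 0⟩], []⟩,
    ⟨11, [⟨0, 11, 1, 12, 1, 11, 1, 0⟩, ⟨0, 19, 0, 16, 1, 16, 1, 0⟩], []⟩,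
    ⟨11, [⟨0, 11, 0, 11, 1, 11, 1, 0⟩, ⟨0, 19, 0, 15, 1, 15, 1, 0⟩, ⟨1, 2, 0, 16, 1, 2, 8, 0⟩], []⟩,
    ⟨11, [⟨0, 11, 0, 11, 1, 11, 1, 0⟩, ⟨0, 23, 0, 16, 1, 16, 1, 0⟩], []⟩,
    ⟨11, [⟨0, 11, 0, 11, 1, 11, 1, 0⟩, ⟨0, 5, 1, 16, 4, 15, 4, 0⟩, ⟨1, 2, 0, 16, 1, 2, 8, 0⟩], []⟩,
    ⟨11, [⟨0, 11, 0, 11, 1, 11, 1, 0⟩, ⟨0, 3, 1, 16, 8, 15, 8, 0⟩, ⟨1, 2, 0, 16, 1, 2, 8, 0⟩], []⟩,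
    ⟨11, [⟨0, 11, 0, 11, 1, 11, 1, 0⟩, ⟨0, 29, 0, 16, 1, 16, 1, 0⟩], []⟩]

def row17 : List Entry :=
  [⟨11, [⟨0, 11, 1, 12, 1, 11, 1, 0⟩, ⟨0, 17, 0, 17, 1, 17, 1, 0⟩], []⟩,
    ⟨11, [⟨0, 11, 0, 11, 1, 11, 1, 0⟩, ⟨0, 17, 0, 17, 1, 17, 1, 0⟩], []⟩,
    ⟨11, [⟨0, 11, 0, 11, 1, 11, 1, 0⟩, ⟨0, 17, 0, 17, 1, 17, 1, 0⟩], []⟩,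
    ⟨11, [⟨0, 11, 0, 11, 1, 11, 1, 0⟩, ⟨0, 17, 0, 17, 1, 17, 1, 0⟩], []⟩,
    ⟨11, [⟨0, 11, 0, 11, 1, 11, 1, 0⟩, ⟨0, 17, 0, 17, 1, 17, 1, 0⟩], []⟩,
    ⟨11, [⟨0, 11, 0, 11, 1, 11, 1, 0⟩, ⟨0, 17, 0, 17, 1, 17, 1, 0⟩], []⟩,
    ⟨11, [⟨0, 11, 6, 17, 1, 11, 1, 0⟩, ⟨0, 17, 0, 17, 1, 17, 1, 0⟩], []⟩,
    ⟨11, [⟨0, 11, 5, 16, 1, 11, 1, 0⟩, ⟨0, 17, 0, 17, 1, 17, 1, 0⟩], []⟩,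
    ⟨11, [⟨0, 11, 4, 15, 1, 11, 1, 0⟩, ⟨0, 17, 0, 17, 1, 17, 1, 0⟩], []⟩,
    ⟨11, [⟨0, 11, 3, 14, 1, 11, 1, 0⟩, ⟨0, 17, 0, 17, 1, 17, 1, 0⟩], []⟩,
    ⟨11, [⟨0, 11, 2, 13, 1, 11, 1, 0⟩, ⟨0, 17, 0, 17, 1, 17, 1, 0⟩], []⟩,
    ⟨11, [⟨0, 11, 1, 12, 1, 11, 1, 0⟩, ⟨0, 17, 0, 17, 1, 17, 1, 0⟩], []⟩,
    ⟨11, [⟨0, 11, 0, 11, 1, 11, 1, 0⟩, ⟨0, 17, 0, 17, 1, 17, 1, 0⟩], []⟩,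
    ⟨11, [⟨0, 11, 0, 11, 1, 11, 1, 0⟩, ⟨0, 17, 0, 17, 1, 17, 1, 0⟩], []⟩,
    ⟨11, [⟨0, 11, 0, 11, 1, 11, 1, 0⟩, ⟨0, 3, 0, 17, 9, 17, 9, 0⟩], []⟩,
    ⟨11, [⟨0, 11, 0, 11, 1, 11, 1, 0⟩, ⟨0, 17, 0, 17, 1, 17, 1, 0⟩], []⟩,
    ⟨11, [⟨0, 11, 0, 11, 1, 11, 1, 0⟩, ⟨0, 17, 0, 17, 1, 17, 1, 0⟩], []⟩]

def row18 : List Entry :=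
  [⟨11, [⟨0, 11, 1, 12, 1, 11, 1, 0⟩, ⟨0, 17, 0, 17, 1, 17, 1, 0⟩, ⟨1, 2, 0, 18, 1, 2, 9, 0⟩], []⟩,
    ⟨11, [⟨0, 11, 0, 11, 1, 11, 1, 0⟩, ⟨0, 17, 0, 17, 1, 17, 1, 0⟩, ⟨1, 2, 0, 18, 1, 2, 9, 0⟩], []⟩,
    ⟨11, [⟨0, 11, 0, 11, 1, 11, 1, 0⟩, ⟨0, 17, 0, 17, 1, 17, 1, 0⟩, ⟨1, 2, 0, 18, 1, 2, 9, 0⟩], []⟩,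
    ⟨11, [⟨0, 11, 0, 11, 1, 11, 1, 0⟩, ⟨0, 17, 0, 17, 1, 17, 1, 0⟩, ⟨1, 2, 0, 18, 1, 2, 9, 0⟩], []⟩,
    ⟨11, [⟨0, 11, 0, 11, 1, 11, 1, 0⟩, ⟨0, 3, 0, 18, 4, 9, 8, 0⟩], []⟩,
    ⟨11, [⟨0, 11, 7, 18, 1, 11, 1, 0⟩, ⟨0, 3, 0, 18, 4, 9, 8, 0⟩], []⟩,
    ⟨11, [⟨0, 11, 6, 17, 1, 11, 1, 0⟩, ⟨0, 3, 0, 18, 4, 9, 8, 0⟩], []⟩,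
    ⟨11, [⟨0, 11, 5, 16, 1, 11, 1, 0⟩, ⟨0, 3, 0, 18, 4, 9, 8, 0⟩], []⟩,
    ⟨11, [⟨0, 11, 4, 15, 1, 11, 1, 0⟩, ⟨0, 3, 0, 18, 4, 9, 8, 0⟩], []⟩,
    ⟨11, [⟨0, 11, 3, 14, 1, 11, 1, 0⟩, ⟨0, 3, 0, 18, 4, 9, 8, 0⟩], []⟩,
    ⟨11, [⟨0, 11, 2, 13, 1, 11, 1, 0⟩, ⟨0, 3, 0, 18, 4, 9, 8, 0⟩], []⟩,
    ⟨11, [⟨0, 11, 1, 12, 1, 11, 1, 0⟩, ⟨0, 3, 0, 18, 4, 9, 8, 0⟩], []⟩,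
    ⟨11, [⟨0, 11, 0, 11, 1, 11, 1, 0⟩, ⟨0, 3, 0, 18, 4, 9, 8, 0⟩], []⟩,
    ⟨11, [⟨0, 11, 0, 11, 1, 11, 1, 0⟩, ⟨0, 17, 0, 17, 1, 17, 1, 0⟩, ⟨0, 3, 0, 18, 1, 2, 9, 0⟩], []⟩,
    ⟨11, [⟨0, 11, 0, 11, 1, 11, 1, 0⟩, ⟨0, 29, 0, 18, 1, 18, 1, 0⟩], []⟩,
    ⟨11, [⟨0, 11, 0, 11, 1, 11, 1, 0⟩, ⟨0, 31, 0, 18, 1, 18, 1, 0⟩], []⟩,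
    ⟨11, [⟨0, 11, 7, 18, 1, 11, 1, 0⟩, ⟨0, 17, 0, 17, 1, 17, 1, 0⟩, ⟨0, 3, 0, 18, 1, 2, 9, 0⟩], []⟩]

def row19 : List Entry :=
  [⟨11, [⟨0, 11, 1, 12, 1, 11, 1, 0⟩, ⟨0, 19, 0, 19, 1, 19, 1, 0⟩], []⟩,
    ⟨11, [⟨0, 11, 0, 11, 1, 11, 1, 0⟩, ⟨0, 19, 0, 19, 1, 19, 1, 0⟩], []⟩,
    ⟨11, [⟨0, 11, 0, 11, 1, 11, 1, 0⟩, ⟨0, 19, 0, 19, 1, 19, 1, 0⟩], []⟩,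
    ⟨11, [⟨0, 11, 0, 11, 1, 11, 1, 0⟩, ⟨0, 19, 0, 19, 1, 19, 1, 0⟩], []⟩,
    ⟨11, [⟨0, 11, 8, 19, 1, 11, 1, 0⟩, ⟨0, 19, 0, 19, 1, 19, 1, 0⟩], []⟩,
    ⟨11, [⟨0, 11, 7, 18, 1, 11, 1, 0⟩, ⟨0, 19, 0, 19, 1, 19, 1, 0⟩], []⟩,
    ⟨11, [⟨0, 11, 6, 17, 1, 11, 1, 0⟩, ⟨0, 19, 0, 19, 1, 19, 1, 0⟩], []⟩,
    ⟨11, [⟨0, 11, 5, 16, 1, 11, 1, 0⟩, ⟨0, 19, 0, 19, 1, 19, 1, 0⟩], []⟩,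
    ⟨11, [⟨0, 11, 4, 15, 1, 11, 1, 0⟩, ⟨0, 19, 0, 19, 1, 19, 1, 0⟩], []⟩,
    ⟨11, [⟨0, 11, 3, 14, 1, 11, 1, 0⟩, ⟨0, 19, 0, 19, 1, 19, 1, 0⟩], []⟩,
    ⟨11, [⟨0, 11, 2, 13, 1, 11, 1, 0⟩, ⟨0, 19, 0, 19, 1, 19, 1, 0⟩], []⟩,
    ⟨11, [⟨0, 11, 1, 12, 1, 11, 1, 0⟩, ⟨0, 5, 0, 19, 5, 19, 5, 0⟩], []⟩,
    ⟨11, [⟨0, 11, 0, 11, 1, 11, 1, 0⟩, ⟨0, 19, 0, 19, 1, 19, 1, 0⟩], []⟩,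
    ⟨11, [⟨0, 11, 0, 11, 1, 11, 1, 0⟩, ⟨0, 19, 0, 19, 1, 19, 1, 0⟩], []⟩,
    ⟨11, [⟨0, 11, 0, 11, 1, 11, 1, 0⟩, ⟨0, 19, 0, 19, 1, 19, 1, 0⟩], []⟩,
    ⟨11, [⟨0, 11, 8, 19, 1, 11, 1, 0⟩, ⟨0, 19, 0, 19, 1, 19, 1, 0⟩], []⟩,
    ⟨11, [⟨0, 11, 7, 18, 1, 11, 1, 0⟩, ⟨0, 19, 0, 19, 1, 19, 1, 0⟩], []⟩]

def row20 : List Entry :=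
  [⟨11, [⟨0, 11, 1, 12, 1, 11, 1, 0⟩, ⟨0, 19, 0, 19, 1, 19, 1, 0⟩, ⟨1, 2, 0, 20, 1, 2, 10, 0⟩], []⟩,
    ⟨11, [⟨0, 11, 0, 11, 1, 11, 1, 0⟩, ⟨0, 19, 0, 19, 1, 19, 1, 0⟩, ⟨1, 2, 0, 20, 1, 2, 10, 0⟩], []⟩,
    ⟨11, [⟨0, 11, 0, 11, 1, 11, 1, 0⟩, ⟨0, 19, 0, 19, 1, 19, 1, 0⟩, ⟨1, 2, 0, 20, 1, 2, 10, 0⟩], []⟩,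
    ⟨11, [⟨0, 11, 9, 20, 1, 11, 1, 0⟩, ⟨0, 19, 0, 19, 1, 19, 1, 0⟩, ⟨1, 2, 0, 20, 1, 2, 10, 0⟩], []⟩,
    ⟨11, [⟨0, 11, 8, 19, 1, 11, 1, 0⟩, ⟨0, 19, 0, 19, 1, 19, 1, 0⟩, ⟨1, 2, 0, 20, 1, 2, 10, 0⟩], []⟩,
    ⟨17, [⟨0, 17, 0, 17, 1, 17, 1, 0⟩, ⟨0, 5, 0, 20, 1, 5, 4, 0⟩], []⟩,
    ⟨17, [⟨0, 17, 3, 20, 1, 17, 1, 0⟩, ⟨0, 5, 0, 20, 1, 5, 4, 0⟩], []⟩,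
    ⟨17, [⟨0, 17, 2, 19, 1, 17, 1, 0⟩, ⟨0, 5, 0, 20, 1, 5, 4, 0⟩], []⟩,
    ⟨17, [⟨0, 17, 1, 18, 1, 17, 1, 0⟩, ⟨0, 5, 0, 20, 1, 5, 4, 0⟩], []⟩,
    ⟨11, [⟨0, 11, 3, 14, 1, 11, 1, 0⟩, ⟨0, 23, 0, 20, 1, 20, 1, 0⟩], []⟩,
    ⟨17, [⟨0, 17, 0, 17, 1, 17, 1, 0⟩, ⟨0, 5, 0, 20, 1, 4, 5, 0⟩], []⟩,
    ⟨17, [⟨0, 17, 0, 17, 1, 17, 1, 0⟩, ⟨0, 5, 0, 20, 1, 4, 5, 0⟩], []⟩,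
    ⟨11, [⟨0, 11, 0, 11, 1, 11, 1, 0⟩, ⟨0, 29, 0, 20, 1, 20, 1, 0⟩], []⟩,
    ⟨11, [⟨0, 11, 0, 11, 1, 11, 1, 0⟩, ⟨0, 31, 0, 20, 1, 20, 1, 0⟩], []⟩,
    ⟨17, [⟨0, 17, 0, 17, 1, 17, 1, 0⟩, ⟨0, 5, 0, 20, 1, 4, 5, 0⟩], []⟩,
    ⟨11, [⟨0, 11, 8, 19, 1, 11, 1, 0⟩, ⟨0, 19, 0, 19, 1, 19, 1, 0⟩, ⟨1, 2, 0, 20, 1, 2, 10, 0⟩], []⟩,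
    ⟨11, [⟨0, 11, 7, 18, 1, 11, 1, 0⟩, ⟨0, 37, 0, 20, 1, 20, 1, 0⟩], []⟩]

def row21 : List Entry :=
  [⟨17, [⟨0, 17, 0, 17, 1, 17, 1, 0⟩, ⟨0, 7, 0, 21, 1, 7, 3, 0⟩], []⟩,
    ⟨17, [⟨0, 17, 0, 17, 1, 17, 1, 0⟩, ⟨0, 7, 0, 21, 1, 7, 3, 0⟩], []⟩,
    ⟨17, [⟨0, 17, 0, 17, 1, 17, 1, 0⟩, ⟨0, 7, 0, 21, 1, 7, 3, 0⟩], []⟩,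
    ⟨17, [⟨0, 17, 0, 17, 1, 17, 1, 0⟩, ⟨0, 7, 0, 21, 1, 7, 3, 0⟩], []⟩,
    ⟨17, [⟨0, 17, 0, 17, 1, 17, 1, 0⟩, ⟨0, 7, 0, 21, 1, 7, 3, 0⟩], []⟩,
    ⟨17, [⟨0, 17, 4, 21, 1, 17, 1, 0⟩, ⟨0, 7, 0, 21, 1, 7, 3, 0⟩], []⟩,
    ⟨17, [⟨0, 17, 3, 20, 1, 17, 1, 0⟩, ⟨0, 7, 0, 21, 1, 7, 3, 0⟩], []⟩,
    ⟨17, [⟨0, 17, 2, 19, 1, 17, 1, 0⟩, ⟨0, 7, 0, 21, 1, 7, 3, 0⟩], []⟩,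
    ⟨11, [⟨0, 11, 4, 15, 1, 11, 1, 0⟩, ⟨0, 23, 0, 21, 1, 21, 1, 0⟩], []⟩,
    ⟨17, [⟨0, 17, 0, 17, 1, 17, 1, 0⟩, ⟨0, 7, 0, 21, 1, 7, 3, 0⟩], []⟩,
    ⟨17, [⟨0, 17, 0, 17, 1, 17, 1, 0⟩, ⟨0, 7, 0, 21, 1, 7, 3, 0⟩], []⟩,
    ⟨11, [⟨0, 11, 1, 12, 1, 11, 1, 0⟩, ⟨0, 29, 0, 21, 1, 21, 1, 0⟩], []⟩,
    ⟨11, [⟨0, 11, 0, 11, 1, 11, 1, 0⟩, ⟨0, 31, 0, 21, 1, 21, 1, 0⟩], []⟩,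
    ⟨17, [⟨0, 17, 0, 17, 1, 17, 1, 0⟩, ⟨0, 7, 0, 21, 1, 7, 3, 0⟩], []⟩,
    ⟨17, [⟨0, 17, 0, 17, 1, 17, 1, 0⟩, ⟨0, 7, 0, 21, 1, 7, 3, 0⟩], []⟩,
    ⟨11, [⟨0, 11, 8, 19, 1, 11, 1, 0⟩, ⟨0, 37, 0, 21, 1, 21, 1, 0⟩], []⟩,
    ⟨17, [⟨0, 17, 0, 17, 1, 17, 1, 0⟩, ⟨0, 7, 0, 21, 1, 7, 3, 0⟩], []⟩]

def row22 : List Entry :=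
  [⟨13, [⟨0, 13, 0, 13, 1, 13, 1, 0⟩, ⟨0, 11, 0, 22, 1, 11, 2, 0⟩], []⟩,
    ⟨13, [⟨0, 13, 0, 13, 1, 13, 1, 0⟩, ⟨0, 11, 0, 22, 1, 11, 2, 0⟩], []⟩,
    ⟨13, [⟨0, 13, 9, 22, 1, 13, 1, 0⟩, ⟨0, 11, 0, 22, 1, 11, 2, 0⟩], []⟩,
    ⟨13, [⟨0, 13, 8, 21, 1, 13, 1, 0⟩, ⟨0, 11, 0, 22, 1, 11, 2, 0⟩], []⟩,
    ⟨13, [⟨0, 13, 7, 20, 1, 13, 1, 0⟩, ⟨0, 11, 0, 22, 1, 11, 2, 0⟩], []⟩,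
    ⟨13, [⟨0, 13, 6, 19, 1, 13, 1, 0⟩, ⟨0, 11, 0, 22, 1, 11, 2, 0⟩], []⟩,
    ⟨13, [⟨0, 13, 5, 18, 1, 13, 1, 0⟩, ⟨0, 11, 0, 22, 1, 11, 2, 0⟩], []⟩,
    ⟨13, [⟨0, 13, 4, 17, 1, 13, 1, 0⟩, ⟨0, 11, 0, 22, 1, 11, 2, 0⟩], []⟩,
    ⟨13, [⟨0, 13, 3, 16, 1, 13, 1, 0⟩, ⟨0, 11, 0, 22, 1, 11, 2, 0⟩], []⟩,
    ⟨13, [⟨0, 13, 2, 15, 1, 13, 1, 0⟩, ⟨0, 11, 0, 22, 1, 11, 2, 0⟩], []⟩,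
    ⟨13, [⟨0, 13, 1, 14, 1, 13, 1, 0⟩, ⟨0, 11, 0, 22, 1, 11, 2, 0⟩], []⟩,
    ⟨13, [⟨0, 13, 0, 13, 1, 13, 1, 0⟩, ⟨0, 11, 0, 22, 1, 11, 2, 0⟩], []⟩,
    ⟨13, [⟨0, 13, 0, 13, 1, 13, 1, 0⟩, ⟨0, 11, 0, 22, 1, 11, 2, 0⟩], []⟩,
    ⟨13, [⟨0, 13, 0, 13, 1, 13, 1, 0⟩, ⟨0, 11, 0, 22, 1, 11, 2, 0⟩], []⟩,
    ⟨13, [⟨0, 13, 0, 13, 1, 13, 1, 0⟩, ⟨0, 11, 0, 22, 1, 11, 2, 0⟩], []⟩,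
    ⟨13, [⟨0, 13, 9, 22, 1, 13, 1, 0⟩, ⟨0, 11, 0, 22, 1, 11, 2, 0⟩], []⟩,
    ⟨13, [⟨0, 13, 8, 21, 1, 13, 1, 0⟩, ⟨0, 11, 0, 22, 1, 11, 2, 0⟩], []⟩]

def row23 : List Entry :=
  [⟨13, [⟨0, 13, 0, 13, 1, 13, 1, 0⟩, ⟨0, 23, 0, 23, 1, 23, 1, 0⟩], []⟩,
    ⟨13, [⟨0, 13, 10, 23, 1, 13, 1, 0⟩, ⟨0, 23, 0, 23, 1, 23, 1, 0⟩], []⟩,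
    ⟨13, [⟨0, 13, 9, 22, 1, 13, 1, 0⟩, ⟨0, 23, 0, 23, 1, 23, 1, 0⟩], []⟩,
    ⟨13, [⟨0, 13, 8, 21, 1, 13, 1, 0⟩, ⟨0, 23, 0, 23, 1, 23, 1, 0⟩], []⟩,
    ⟨13, [⟨0, 13, 7, 20, 1, 13, 1, 0⟩, ⟨0, 23, 0, 23, 1, 23, 1, 0⟩], []⟩,
    ⟨13, [⟨0, 13, 6, 19, 1, 13, 1, 0⟩, ⟨0, 23, 0, 23, 1, 23, 1, 0⟩], []⟩,
    ⟨13, [⟨0, 13, 5, 18, 1, 13, 1, 0⟩, ⟨0, 23, 0, 23, 1, 23, 1, 0⟩], []⟩,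
    ⟨13, [⟨0, 13, 4, 17, 1, 13, 1, 0⟩, ⟨0, 23, 0, 23, 1, 23, 1, 0⟩], []⟩,
    ⟨13, [⟨0, 13, 3, 16, 1, 13, 1, 0⟩, ⟨0, 23, 0, 23, 1, 23, 1, 0⟩], []⟩,
    ⟨13, [⟨0, 13, 2, 15, 1, 13, 1, 0⟩, ⟨0, 23, 0, 23, 1, 23, 1, 0⟩], []⟩,
    ⟨13, [⟨0, 13, 1, 14, 1, 13, 1, 0⟩, ⟨0, 23, 0, 23, 1, 23, 1, 0⟩], []⟩,
    ⟨13, [⟨0, 13, 0, 13, 1, 13, 1, 0⟩, ⟨0, 23, 0, 23, 1, 23, 1, 0⟩], []⟩,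
    ⟨13, [⟨0, 13, 0, 13, 1, 13, 1, 0⟩, ⟨0, 23, 0, 23, 1, 23, 1, 0⟩], []⟩,
    ⟨13, [⟨0, 13, 0, 13, 1, 13, 1, 0⟩, ⟨0, 23, 0, 23, 1, 23, 1, 0⟩], []⟩,
    ⟨13, [⟨0, 13, 10, 23, 1, 13, 1, 0⟩, ⟨0, 23, 0, 23, 1, 23, 1, 0⟩], []⟩,
    ⟨13, [⟨0, 13, 9, 22, 1, 13, 1, 0⟩, ⟨0, 23, 0, 23, 1, 23, 1, 0⟩], []⟩,
    ⟨13, [⟨0, 13, 8, 21, 1, 13, 1, 0⟩, ⟨0, 23, 0, 23, 1, 23, 1, 0⟩], []⟩]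

def row24 : List Entry :=
  [⟨13, [⟨0, 13, 11, 24, 1, 13, 1, 0⟩, ⟨0, 23, 0, 23, 1, 23, 1, 0⟩, ⟨1, 2, 0, 24, 1, 2, 12, 0⟩], []⟩,
    ⟨13, [⟨0, 13, 10, 23, 1, 13, 1, 0⟩, ⟨0, 23, 0, 23, 1, 23, 1, 0⟩, ⟨1, 2, 0, 24, 1, 2, 12, 0⟩], []⟩,
    ⟨13, [⟨0, 13, 9, 22, 1, 13, 1, 0⟩, ⟨0, 23, 0, 23, 1, 23, 1, 0⟩, ⟨1, 2, 0, 24, 1, 2, 12, 0⟩], []⟩,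
    ⟨13, [⟨0, 13, 8, 21, 1, 13, 1, 0⟩, ⟨0, 23, 0, 23, 1, 23, 1, 0⟩, ⟨1, 2, 0, 24, 1, 2, 12, 0⟩], []⟩,
    ⟨13, [⟨0, 13, 7, 20, 1, 13, 1, 0⟩, ⟨0, 23, 0, 23, 1, 23, 1, 0⟩, ⟨1, 2, 0, 24, 1, 2, 12, 0⟩], []⟩,
    ⟨13, [⟨0, 13, 6, 19, 1, 13, 1, 0⟩, ⟨0, 23, 1, 24, 1, 23, 1, 0⟩, ⟨1, 2, 0, 24, 1, 2, 12, 0⟩], []⟩,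
    ⟨13, [⟨0, 13, 5, 18, 1, 13, 1, 0⟩, ⟨0, 23, 0, 23, 1, 23, 1, 0⟩, ⟨0, 5, 0, 24, 1, 4, 6, 0⟩], []⟩,
    ⟨13, [⟨0, 13, 4, 17, 1, 13, 1, 0⟩, ⟨0, 23, 0, 23, 1, 23, 1, 0⟩, ⟨0, 3, 0, 24, 1, 2, 12, 0⟩], []⟩,
    ⟨13, [⟨0, 13, 3, 16, 1, 13, 1, 0⟩, ⟨0, 29, 0, 24, 1, 24, 1, 0⟩], []⟩,
    ⟨13, [⟨0, 13, 2, 15, 1, 13, 1, 0⟩, ⟨0, 31, 0, 24, 1, 24, 1, 0⟩], []⟩,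
    ⟨13, [⟨0, 13, 1, 14, 1, 13, 1, 0⟩, ⟨0, 23, 0, 23, 1, 23, 1, 0⟩, ⟨1, 2, 0, 24, 1, 2, 12, 0⟩], []⟩,
    ⟨13, [⟨0, 13, 0, 13, 1, 13, 1, 0⟩, ⟨0, 23, 0, 23, 1, 23, 1, 0⟩, ⟨1, 2, 0, 24, 1, 2, 12, 0⟩], []⟩,
    ⟨13, [⟨0, 13, 0, 13, 1, 13, 1, 0⟩, ⟨0, 37, 0, 24, 1, 24, 1, 0⟩], []⟩,
    ⟨13, [⟨0, 13, 11, 24, 1, 13, 1, 0⟩, ⟨0, 23, 0, 23, 1, 23, 1, 0⟩, ⟨1, 2, 0, 24, 1, 2, 12, 0⟩], []⟩,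
    ⟨13, [⟨0, 13, 10, 23, 1, 13, 1, 0⟩, ⟨0, 41, 0, 24, 1, 24, 1, 0⟩], []⟩,
    ⟨13, [⟨0, 13, 9, 22, 1, 13, 1, 0⟩, ⟨0, 43, 0, 24, 1, 24, 1, 0⟩], []⟩,
    ⟨13, [⟨0, 13, 8, 21, 1, 13, 1, 0⟩, ⟨0, 23, 0, 23, 1, 23, 1, 0⟩, ⟨1, 2, 0, 24, 1, 2, 12, 0⟩], []⟩]

def row25 : List Entry :=
  [⟨13, [⟨0, 13, 11, 24, 1, 13, 1, 0⟩, ⟨0, 5, 0, 25, 6, 25, 6, 0⟩], []⟩,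
    ⟨13, [⟨0, 13, 10, 23, 1, 13, 1, 0⟩, ⟨0, 5, 0, 25, 6, 25, 6, 0⟩], []⟩,
    ⟨13, [⟨0, 13, 9, 22, 1, 13, 1, 0⟩, ⟨0, 5, 0, 25, 6, 25, 6, 0⟩], []⟩,
    ⟨13, [⟨0, 13, 8, 21, 1, 13, 1, 0⟩, ⟨0, 5, 0, 25, 6, 25, 6, 0⟩], []⟩,
    ⟨13, [⟨0, 13, 7, 20, 1, 13, 1, 0⟩, ⟨0, 5, 0, 25, 6, 25, 6, 0⟩], []⟩,
    ⟨13, [⟨0, 13, 6, 19, 1, 13, 1, 0⟩, ⟨0, 5, 0, 25, 6, 25, 6, 0⟩], []⟩,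
    ⟨13, [⟨0, 13, 5, 18, 1, 13, 1, 0⟩, ⟨0, 5, 0, 25, 6, 25, 6, 0⟩], []⟩,
    ⟨13, [⟨0, 13, 4, 17, 1, 13, 1, 0⟩, ⟨0, 5, 0, 25, 6, 25, 6, 0⟩], []⟩,
    ⟨13, [⟨0, 13, 3, 16, 1, 13, 1, 0⟩, ⟨0, 5, 0, 25, 6, 25, 6, 0⟩], []⟩,
    ⟨13, [⟨0, 13, 2, 15, 1, 13, 1, 0⟩, ⟨0, 5, 0, 25, 6, 25, 6, 0⟩], []⟩,
    ⟨13, [⟨0, 13, 1, 14, 1, 13, 1, 0⟩, ⟨0, 5, 0, 25, 6, 25, 6, 0⟩], []⟩,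
    ⟨13, [⟨0, 13, 0, 13, 1, 13, 1, 0⟩, ⟨0, 5, 0, 25, 6, 25, 6, 0⟩], []⟩,
    ⟨13, [⟨0, 13, 12, 25, 1, 13, 1, 0⟩, ⟨0, 5, 0, 25, 6, 25, 6, 0⟩], []⟩,
    ⟨13, [⟨0, 13, 11, 24, 1, 13, 1, 0⟩, ⟨0, 5, 0, 25, 6, 25, 6, 0⟩], []⟩,
    ⟨13, [⟨0, 13, 10, 23, 1, 13, 1, 0⟩, ⟨0, 5, 0, 25, 6, 25, 6, 0⟩], []⟩,
    ⟨13, [⟨0, 13, 9, 22, 1, 13, 1, 0⟩, ⟨0, 5, 0, 25, 6, 25, 6, 0⟩], []⟩,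
    ⟨13, [⟨0, 13, 8, 21, 1, 13, 1, 0⟩, ⟨0, 5, 0, 25, 6, 25, 6, 0⟩], []⟩]

def row26 : List Entry :=
  [⟨17, [⟨0, 17, 9, 26, 1, 17, 1, 0⟩, ⟨0, 13, 0, 26, 1, 13, 2, 0⟩], []⟩,
    ⟨17, [⟨0, 17, 8, 25, 1, 17, 1, 0⟩, ⟨0, 13, 0, 26, 1, 13, 2, 0⟩], []⟩,
    ⟨17, [⟨0, 17, 7, 24, 1, 17, 1, 0⟩, ⟨0, 13, 0, 26, 1, 13, 2, 0⟩], []⟩,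
    ⟨17, [⟨0, 17, 6, 23, 1, 17, 1, 0⟩, ⟨0, 13, 0, 26, 1, 13, 2, 0⟩], []⟩,
    ⟨17, [⟨0, 17, 5, 22, 1, 17, 1, 0⟩, ⟨0, 13, 0, 26, 1, 13, 2, 0⟩], []⟩,
    ⟨17, [⟨0, 17, 4, 21, 1, 17, 1, 0⟩, ⟨0, 13, 0, 26, 1, 13, 2, 0⟩], []⟩,
    ⟨17, [⟨0, 17, 3, 20, 1, 17, 1, 0⟩, ⟨0, 13, 0, 26, 1, 13, 2, 0⟩], []⟩,
    ⟨17, [⟨0, 17, 2, 19, 1, 17, 1, 0⟩, ⟨0, 13, 0, 26, 1, 13, 2, 0⟩], []⟩,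
    ⟨17, [⟨0, 17, 1, 18, 1, 17, 1, 0⟩, ⟨0, 13, 0, 26, 1, 13, 2, 0⟩], []⟩,
    ⟨17, [⟨0, 17, 0, 17, 1, 17, 1, 0⟩, ⟨0, 13, 0, 26, 1, 13, 2, 0⟩], []⟩,
    ⟨17, [⟨0, 17, 0, 17, 1, 17, 1, 0⟩, ⟨0, 13, 0, 26, 1, 13, 2, 0⟩], []⟩,
    ⟨17, [⟨0, 17, 0, 17, 1, 17, 1, 0⟩, ⟨0, 13, 0, 26, 1, 13, 2, 0⟩], []⟩,
    ⟨17, [⟨0, 17, 0, 17, 1, 17, 1, 0⟩, ⟨0, 13, 0, 26, 1, 13, 2, 0⟩], []⟩,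
    ⟨17, [⟨0, 17, 0, 17, 1, 17, 1, 0⟩, ⟨0, 13, 0, 26, 1, 13, 2, 0⟩], []⟩,
    ⟨17, [⟨0, 3, 0, 17, 9, 17, 13, 4⟩, ⟨0, 13, 0, 26, 1, 13, 2, 0⟩], []⟩,
    ⟨17, [⟨0, 17, 0, 17, 1, 17, 1, 0⟩, ⟨0, 13, 0, 26, 1, 13, 2, 0⟩], []⟩,
    ⟨17, [⟨0, 17, 0, 17, 1, 17, 1, 0⟩, ⟨0, 13, 0, 26, 1, 13, 2, 0⟩], []⟩]

def row27 : List Entry :=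
  [⟨17, [⟨0, 17, 9, 26, 1, 17, 1, 0⟩, ⟨0, 3, 0, 27, 13, 27, 13, 0⟩], []⟩,
    ⟨17, [⟨0, 17, 8, 25, 1, 17, 1, 0⟩, ⟨0, 3, 0, 27, 13, 27, 13, 0⟩], []⟩,
    ⟨17, [⟨0, 17, 7, 24, 1, 17, 1, 0⟩, ⟨0, 3, 0, 27, 13, 27, 13, 0⟩], []⟩,
    ⟨17, [⟨0, 17, 6, 23, 1, 17, 1, 0⟩, ⟨0, 3, 0, 27, 13, 27, 13, 0⟩], []⟩,
    ⟨17, [⟨0, 17, 5, 22, 1, 17, 1, 0⟩, ⟨0, 3, 0, 27, 13, 27, 13, 0⟩], []⟩,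
    ⟨17, [⟨0, 17, 4, 21, 1, 17, 1, 0⟩, ⟨0, 3, 0, 27, 13, 27, 13, 0⟩], []⟩,
    ⟨17, [⟨0, 17, 3, 20, 1, 17, 1, 0⟩, ⟨0, 3, 0, 27, 13, 27, 13, 0⟩], []⟩,
    ⟨17, [⟨0, 17, 2, 19, 1, 17, 1, 0⟩, ⟨0, 3, 0, 27, 13, 27, 13, 0⟩], []⟩,
    ⟨17, [⟨0, 17, 1, 18, 1, 17, 1, 0⟩, ⟨0, 3, 0, 27, 13, 27, 13, 0⟩], []⟩,
    ⟨17, [⟨0, 17, 0, 17, 1, 17, 1, 0⟩, ⟨0, 3, 0, 27, 13, 27, 13, 0⟩], []⟩,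
    ⟨17, [⟨0, 17, 0, 17, 1, 17, 1, 0⟩, ⟨0, 3, 0, 27, 13, 27, 13, 0⟩], []⟩,
    ⟨17, [⟨0, 17, 0, 17, 1, 17, 1, 0⟩, ⟨0, 3, 0, 27, 13, 27, 13, 0⟩], []⟩,
    ⟨17, [⟨0, 17, 0, 17, 1, 17, 1, 0⟩, ⟨0, 3, 0, 27, 13, 27, 13, 0⟩], []⟩,
    ⟨17, [⟨0, 17, 0, 17, 1, 17, 1, 0⟩, ⟨0, 3, 0, 27, 13, 27, 13, 0⟩], []⟩,
    ⟨17, [⟨0, 17, 0, 17, 1, 17, 1, 0⟩, ⟨0, 3, 0, 27, 13, 27, 13, 0⟩], []⟩,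
    ⟨17, [⟨0, 17, 0, 17, 1, 17, 1, 0⟩, ⟨0, 3, 0, 27, 13, 27, 13, 0⟩], []⟩,
    ⟨17, [⟨0, 17, 10, 27, 1, 17, 1, 0⟩, ⟨0, 3, 0, 27, 13, 27, 13, 0⟩], []⟩]

def row28 : List Entry :=
  [⟨23, [⟨0, 23, 0, 23, 1, 23, 1, 0⟩, ⟨0, 7, 0, 28, 1, 7, 4, 0⟩], []⟩,
    ⟨23, [⟨0, 23, 5, 28, 1, 23, 1, 0⟩, ⟨0, 7, 0, 28, 1, 7, 4, 0⟩], []⟩,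
    ⟨23, [⟨0, 23, 4, 27, 1, 23, 1, 0⟩, ⟨0, 7, 0, 28, 1, 7, 4, 0⟩], []⟩,
    ⟨23, [⟨0, 23, 3, 26, 1, 23, 1, 0⟩, ⟨0, 7, 0, 28, 1, 7, 4, 0⟩], []⟩,
    ⟨17, [⟨0, 17, 5, 22, 1, 17, 1, 0⟩, ⟨0, 29, 0, 28, 1, 28, 1, 0⟩], []⟩,
    ⟨17, [⟨0, 17, 4, 21, 1, 17, 1, 0⟩, ⟨0, 31, 0, 28, 1, 28, 1, 0⟩], []⟩,
    ⟨23, [⟨0, 23, 0, 23, 1, 23, 1, 0⟩, ⟨0, 7, 0, 28, 1, 7, 4, 0⟩], []⟩,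
    ⟨23, [⟨0, 23, 0, 23, 1, 23, 1, 0⟩, ⟨0, 7, 0, 28, 1, 7, 4, 0⟩], []⟩,
    ⟨17, [⟨0, 17, 1, 18, 1, 17, 1, 0⟩, ⟨0, 37, 0, 28, 1, 28, 1, 0⟩], []⟩,
    ⟨23, [⟨0, 23, 0, 23, 1, 23, 1, 0⟩, ⟨0, 7, 0, 28, 1, 7, 4, 0⟩], []⟩,
    ⟨17, [⟨0, 17, 0, 17, 1, 17, 1, 0⟩, ⟨0, 41, 0, 28, 1, 28, 1, 0⟩], []⟩,
    ⟨17, [⟨0, 17, 0, 17, 1, 17, 1, 0⟩, ⟨0, 43, 0, 28, 1, 28, 1, 0⟩], []⟩,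
    ⟨23, [⟨0, 23, 0, 23, 1, 23, 1, 0⟩, ⟨0, 7, 0, 28, 1, 7, 4, 0⟩], []⟩,
    ⟨17, [⟨0, 17, 0, 17, 1, 17, 1, 0⟩, ⟨0, 47, 0, 28, 1, 28, 1, 0⟩], []⟩,
    ⟨17, [⟨0, 17, 0, 17, 1, 17, 1, 0⟩, ⟨0, 7, 0, 28, 5, 28, 5, 0⟩], []⟩,
    ⟨17, [⟨0, 17, 11, 28, 1, 17, 1, 0⟩, ⟨0, 7, 0, 28, 5, 28, 5, 0⟩], []⟩,
    ⟨17, [⟨0, 17, 10, 27, 1, 17, 1, 0⟩, ⟨0, 7, 0, 28, 5, 28, 5, 0⟩], []⟩]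

def row29 : List Entry :=
  [⟨17, [⟨0, 17, 9, 26, 1, 17, 1, 0⟩, ⟨0, 29, 0, 29, 1, 29, 1, 0⟩], []⟩,
    ⟨17, [⟨0, 17, 8, 25, 1, 17, 1, 0⟩, ⟨0, 29, 0, 29, 1, 29, 1, 0⟩], []⟩,
    ⟨17, [⟨0, 17, 7, 24, 1, 17, 1, 0⟩, ⟨0, 29, 0, 29, 1, 29, 1, 0⟩], []⟩,
    ⟨17, [⟨0, 17, 6, 23, 1, 17, 1, 0⟩, ⟨0, 29, 0, 29, 1, 29, 1, 0⟩], []⟩,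
    ⟨17, [⟨0, 17, 5, 22, 1, 17, 1, 0⟩, ⟨0, 29, 0, 29, 1, 29, 1, 0⟩], []⟩,
    ⟨17, [⟨0, 17, 4, 21, 1, 17, 1, 0⟩, ⟨0, 29, 0, 29, 1, 29, 1, 0⟩], []⟩,
    ⟨17, [⟨0, 17, 3, 20, 1, 17, 1, 0⟩, ⟨0, 29, 0, 29, 1, 29, 1, 0⟩], []⟩,
    ⟨17, [⟨0, 17, 2, 19, 1, 17, 1, 0⟩, ⟨0, 29, 0, 29, 1, 29, 1, 0⟩], []⟩,
    ⟨17, [⟨0, 17, 1, 18, 1, 17, 1, 0⟩, ⟨0, 29, 0, 29, 1, 29, 1, 0⟩], []⟩,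
    ⟨17, [⟨0, 17, 0, 17, 1, 17, 1, 0⟩, ⟨0, 29, 0, 29, 1, 29, 1, 0⟩], []⟩,
    ⟨17, [⟨0, 17, 0, 17, 1, 17, 1, 0⟩, ⟨0, 29, 0, 29, 1, 29, 1, 0⟩], []⟩,
    ⟨17, [⟨0, 17, 0, 17, 1, 17, 1, 0⟩, ⟨0, 29, 0, 29, 1, 29, 1, 0⟩], []⟩,
    ⟨17, [⟨0, 17, 0, 17, 1, 17, 1, 0⟩, ⟨0, 29, 0, 29, 1, 29, 1, 0⟩], []⟩,
    ⟨17, [⟨0, 17, 0, 17, 1, 17, 1, 0⟩, ⟨0, 29, 0, 29, 1, 29, 1, 0⟩], []⟩,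
    ⟨17, [⟨0, 17, 12, 29, 1, 17, 1, 0⟩, ⟨0, 29, 0, 29, 1, 29, 1, 0⟩], []⟩,
    ⟨17, [⟨0, 17, 11, 28, 1, 17, 1, 0⟩, ⟨0, 29, 0, 29, 1, 29, 1, 0⟩], []⟩,
    ⟨17, [⟨0, 17, 10, 27, 1, 17, 1, 0⟩, ⟨0, 29, 0, 29, 1, 29, 1, 0⟩], []⟩]

def row30 : List Entry :=
  [⟨17, [⟨0, 17, 9, 26, 1, 17, 1, 0⟩, ⟨0, 29, 0, 29, 1, 29, 1, 0⟩, ⟨1, 2, 0, 30, 1, 2, 15, 0⟩], []⟩,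
    ⟨17, [⟨0, 17, 8, 25, 1, 17, 1, 0⟩, ⟨0, 29, 0, 29, 1, 29, 1, 0⟩, ⟨1, 2, 0, 30, 1, 2, 15, 0⟩], []⟩,
    ⟨17, [⟨0, 17, 7, 24, 1, 17, 1, 0⟩, ⟨0, 29, 1, 30, 1, 29, 1, 0⟩, ⟨1, 2, 0, 30, 1, 2, 15, 0⟩], []⟩,
    ⟨17, [⟨0, 17, 6, 23, 1, 17, 1, 0⟩, ⟨0, 31, 0, 30, 1, 30, 1, 0⟩], []⟩,
    ⟨17, [⟨0, 17, 5, 22, 1, 17, 1, 0⟩, ⟨0, 29, 0, 29, 1, 29, 1, 0⟩, ⟨1, 2, 0, 30, 1, 2, 15, 0⟩], []⟩,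
    ⟨17, [⟨0, 17, 4, 21, 1, 17, 1, 0⟩, ⟨0, 29, 0, 29, 1, 29, 1, 0⟩, ⟨1, 2, 0, 30, 1, 2, 15, 0⟩], []⟩,
    ⟨17, [⟨0, 17, 3, 20, 1, 17, 1, 0⟩, ⟨0, 37, 0, 30, 1, 30, 1, 0⟩], []⟩,
    ⟨17, [⟨0, 17, 2, 19, 1, 17, 1, 0⟩, ⟨0, 29, 0, 29, 1, 29, 1, 0⟩, ⟨1, 2, 0, 30, 1, 2, 15, 0⟩], []⟩,
    ⟨17, [⟨0, 17, 1, 18, 1, 17, 1, 0⟩, ⟨0, 41, 0, 30, 1, 30, 1, 0⟩], []⟩,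
    ⟨17, [⟨0, 17, 0, 17, 1, 17, 1, 0⟩, ⟨0, 43, 0, 30, 1, 30, 1, 0⟩], []⟩,
    ⟨17, [⟨0, 17, 0, 17, 1, 17, 1, 0⟩, ⟨0, 29, 0, 29, 1, 29, 1, 0⟩, ⟨1, 2, 0, 30, 1, 2, 15, 0⟩], []⟩,
    ⟨17, [⟨0, 17, 0, 17, 1, 17, 1, 0⟩, ⟨0, 47, 0, 30, 1, 30, 1, 0⟩], []⟩,
    ⟨17, [⟨0, 17, 0, 17, 1, 17, 1, 0⟩, ⟨0, 29, 0, 29, 1, 29, 1, 0⟩, ⟨1, 2, 0, 30, 1, 2, 15, 0⟩], []⟩,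
    ⟨17, [⟨0, 17, 13, 30, 1, 17, 1, 0⟩, ⟨0, 29, 0, 29, 1, 29, 1, 0⟩, ⟨1, 2, 0, 30, 1, 2, 15, 0⟩], []⟩,
    ⟨17, [⟨0, 17, 12, 29, 1, 17, 1, 0⟩, ⟨0, 53, 0, 30, 1, 30, 1, 0⟩], []⟩,
    ⟨17, [⟨0, 17, 11, 28, 1, 17, 1, 0⟩, ⟨0, 29, 0, 29, 1, 29, 1, 0⟩, ⟨1, 2, 0, 30, 1, 2, 15, 0⟩], []⟩,
    ⟨17, [⟨0, 17, 10, 27, 1, 17, 1, 0⟩, ⟨0, 29, 0, 29, 1, 29, 1, 0⟩, ⟨1, 2, 0, 30, 1, 2, 15, 0⟩], []⟩]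

def row31 : List Entry :=
  [⟨17, [⟨0, 17, 9, 26, 1, 17, 1, 0⟩, ⟨0, 31, 0, 31, 1, 31, 1, 0⟩], []⟩,
    ⟨17, [⟨0, 17, 8, 25, 1, 17, 1, 0⟩, ⟨0, 31, 0, 31, 1, 31, 1, 0⟩], []⟩,
    ⟨17, [⟨0, 17, 7, 24, 1, 17, 1, 0⟩, ⟨0, 31, 0, 31, 1, 31, 1, 0⟩], []⟩,
    ⟨17, [⟨0, 17, 6, 23, 1, 17, 1, 0⟩, ⟨0, 31, 0, 31, 1, 31, 1, 0⟩], []⟩,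
    ⟨17, [⟨0, 17, 5, 22, 1, 17, 1, 0⟩, ⟨0, 31, 0, 31, 1, 31, 1, 0⟩], []⟩,
    ⟨17, [⟨0, 17, 4, 21, 1, 17, 1, 0⟩, ⟨0, 31, 0, 31, 1, 31, 1, 0⟩], []⟩,
    ⟨17, [⟨0, 17, 3, 20, 1, 17, 1, 0⟩, ⟨0, 31, 0, 31, 1, 31, 1, 0⟩], []⟩,
    ⟨17, [⟨0, 17, 2, 19, 1, 17, 1, 0⟩, ⟨0, 31, 0, 31, 1, 31, 1, 0⟩], []⟩,
    ⟨17, [⟨0, 17, 1, 18, 1, 17, 1, 0⟩, ⟨0, 31, 0, 31, 1, 31, 1, 0⟩], []⟩,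
    ⟨17, [⟨0, 17, 0, 17, 1, 17, 1, 0⟩, ⟨0, 31, 0, 31, 1, 31, 1, 0⟩], []⟩,
    ⟨17, [⟨0, 17, 0, 17, 1, 17, 1, 0⟩, ⟨0, 31, 0, 31, 1, 31, 1, 0⟩], []⟩,
    ⟨17, [⟨0, 17, 0, 17, 1, 17, 1, 0⟩, ⟨0, 31, 0, 31, 1, 31, 1, 0⟩], []⟩,
    ⟨17, [⟨0, 17, 14, 31, 1, 17, 1, 0⟩, ⟨0, 31, 0, 31, 1, 31, 1, 0⟩], []⟩,
    ⟨17, [⟨0, 17, 13, 30, 1, 17, 1, 0⟩, ⟨0, 31, 0, 31, 1, 31, 1, 0⟩], []⟩,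
    ⟨17, [⟨0, 17, 12, 29, 1, 17, 1, 0⟩, ⟨0, 31, 0, 31, 1, 31, 1, 0⟩], []⟩,
    ⟨17, [⟨0, 17, 11, 28, 1, 17, 1, 0⟩, ⟨0, 31, 0, 31, 1, 31, 1, 0⟩], []⟩,
    ⟨17, [⟨0, 17, 10, 27, 1, 17, 1, 0⟩, ⟨0, 31, 0, 31, 1, 31, 1, 0⟩], []⟩]

def row32 : List Entry :=
  [⟨17, [⟨0, 17, 9, 26, 1, 17, 1, 0⟩, ⟨0, 31, 0, 31, 1, 31, 1, 0⟩, ⟨1, 2, 0, 32, 1, 2, 16, 0⟩], []⟩,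
    ⟨17, [⟨0, 17, 8, 25, 1, 17, 1, 0⟩, ⟨0, 31, 1, 32, 1, 31, 1, 0⟩, ⟨1, 2, 0, 32, 1, 2, 16, 0⟩], []⟩,
    ⟨17, [⟨0, 17, 7, 24, 1, 17, 1, 0⟩, ⟨0, 31, 0, 31, 1, 31, 1, 0⟩, ⟨1, 2, 0, 32, 1, 2, 16, 0⟩], []⟩,
    ⟨17, [⟨0, 17, 6, 23, 1, 17, 1, 0⟩, ⟨0, 31, 0, 31, 1, 31, 1, 0⟩, ⟨1, 2, 0, 32, 1, 2, 16, 0⟩], []⟩,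
    ⟨17, [⟨0, 17, 5, 22, 1, 17, 1, 0⟩, ⟨0, 37, 0, 32, 1, 32, 1, 0⟩], []⟩,
    ⟨17, [⟨0, 17, 4, 21, 1, 17, 1, 0⟩, ⟨0, 31, 0, 31, 1, 31, 1, 0⟩, ⟨1, 2, 0, 32, 1, 2, 16, 0⟩], []⟩,
    ⟨17, [⟨0, 17, 3, 20, 1, 17, 1, 0⟩, ⟨0, 41, 0, 32, 1, 32, 1, 0⟩], []⟩,
    ⟨17, [⟨0, 17, 2, 19, 1, 17, 1, 0⟩, ⟨0, 43, 0, 32, 1, 32, 1, 0⟩], []⟩,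
    ⟨17, [⟨0, 17, 1, 18, 1, 17, 1, 0⟩, ⟨0, 31, 0, 31, 1, 31, 1, 0⟩, ⟨1, 2, 0, 32, 1, 2, 16, 0⟩], []⟩,
    ⟨17, [⟨0, 17, 0, 17, 1, 17, 1, 0⟩, ⟨0, 47, 0, 32, 1, 32, 1, 0⟩], []⟩,
    ⟨17, [⟨0, 17, 0, 17, 1, 17, 1, 0⟩, ⟨0, 31, 0, 31, 1, 31, 1, 0⟩, ⟨1, 2, 0, 32, 1, 2, 16, 0⟩], []⟩,
    ⟨17, [⟨0, 17, 15, 32, 1, 17, 1, 0⟩, ⟨0, 31, 0, 31, 1, 31, 1, 0⟩, ⟨1, 2, 0, 32, 1, 2, 16, 0⟩], []⟩,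
    ⟨17, [⟨0, 17, 14, 31, 1, 17, 1, 0⟩, ⟨0, 53, 0, 32, 1, 32, 1, 0⟩], []⟩,
    ⟨17, [⟨0, 17, 13, 30, 1, 17, 1, 0⟩, ⟨0, 31, 0, 31, 1, 31, 1, 0⟩, ⟨1, 2, 0, 32, 1, 2, 16, 0⟩], []⟩,
    ⟨17, [⟨0, 17, 12, 29, 1, 17, 1, 0⟩, ⟨0, 31, 0, 31, 1, 31, 1, 0⟩, ⟨1, 2, 0, 32, 1, 2, 16, 0⟩], []⟩,
    ⟨17, [⟨0, 17, 11, 28, 1, 17, 1, 0⟩, ⟨0, 59, 0, 32, 1, 32, 1, 0⟩], []⟩,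
    ⟨17, [⟨0, 17, 10, 27, 1, 17, 1, 0⟩, ⟨0, 61, 0, 32, 1, 32, 1, 0⟩], []⟩]

def row33 : List Entry :=
  [⟨23, [⟨0, 23, 6, 29, 1, 23, 1, 0⟩, ⟨0, 11, 0, 33, 1, 11, 3, 0⟩], []⟩,
    ⟨23, [⟨0, 23, 5, 28, 1, 23, 1, 0⟩, ⟨0, 11, 0, 33, 1, 11, 3, 0⟩], []⟩,
    ⟨23, [⟨0, 23, 4, 27, 1, 23, 1, 0⟩, ⟨0, 11, 0, 33, 1, 11, 3, 0⟩], []⟩,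
    ⟨17, [⟨0, 17, 6, 23, 1, 17, 1, 0⟩, ⟨0, 37, 0, 33, 1, 33, 1, 0⟩], []⟩,
    ⟨23, [⟨0, 23, 2, 25, 1, 23, 1, 0⟩, ⟨0, 11, 0, 33, 1, 11, 3, 0⟩], []⟩,
    ⟨17, [⟨0, 17, 4, 21, 1, 17, 1, 0⟩, ⟨0, 41, 0, 33, 1, 33, 1, 0⟩], []⟩,
    ⟨17, [⟨0, 17, 3, 20, 1, 17, 1, 0⟩, ⟨0, 43, 0, 33, 1, 33, 1, 0⟩], []⟩,
    ⟨23, [⟨0, 23, 0, 23, 1, 23, 1, 0⟩, ⟨0, 11, 0, 33, 1, 11, 3, 0⟩], []⟩,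
    ⟨17, [⟨0, 17, 1, 18, 1, 17, 1, 0⟩, ⟨0, 47, 0, 33, 1, 33, 1, 0⟩], []⟩,
    ⟨23, [⟨0, 23, 0, 23, 1, 23, 1, 0⟩, ⟨0, 11, 0, 33, 1, 11, 3, 0⟩], []⟩,
    ⟨23, [⟨0, 23, 0, 23, 1, 23, 1, 0⟩, ⟨0, 11, 0, 33, 1, 11, 3, 0⟩], []⟩,
    ⟨17, [⟨0, 17, 15, 32, 1, 17, 1, 0⟩, ⟨0, 53, 0, 33, 1, 33, 1, 0⟩], []⟩,
    ⟨23, [⟨0, 23, 0, 23, 1, 23, 1, 0⟩, ⟨0, 11, 0, 33, 1, 11, 3, 0⟩], []⟩,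
    ⟨23, [⟨0, 23, 0, 23, 1, 23, 1, 0⟩, ⟨0, 11, 0, 33, 1, 11, 3, 0⟩], []⟩,
    ⟨17, [⟨0, 17, 12, 29, 1, 17, 1, 0⟩, ⟨0, 59, 0, 33, 1, 33, 1, 0⟩], []⟩,
    ⟨17, [⟨0, 17, 11, 28, 1, 17, 1, 0⟩, ⟨0, 61, 0, 33, 1, 33, 1, 0⟩], []⟩,
    ⟨23, [⟨0, 23, 0, 23, 1, 23, 1, 0⟩, ⟨0, 11, 0, 33, 1, 11, 3, 0⟩], []⟩]

def row34 : List Entry :=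
  [⟨19, [⟨0, 19, 8, 27, 1, 19, 1, 0⟩, ⟨0, 17, 0, 34, 1, 17, 2, 0⟩], []⟩,
    ⟨19, [⟨0, 19, 7, 26, 1, 19, 1, 0⟩, ⟨0, 17, 0, 34, 1, 17, 2, 0⟩], []⟩,
    ⟨19, [⟨0, 19, 6, 25, 1, 19, 1, 0⟩, ⟨0, 17, 0, 34, 1, 17, 2, 0⟩], []⟩,
    ⟨19, [⟨0, 19, 5, 24, 1, 19, 1, 0⟩, ⟨0, 17, 0, 34, 1, 17, 2, 0⟩], []⟩,
    ⟨19, [⟨0, 19, 4, 23, 1, 19, 1, 0⟩, ⟨0, 17, 0, 34, 1, 17, 2, 0⟩], []⟩,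
    ⟨19, [⟨0, 19, 3, 22, 1, 19, 1, 0⟩, ⟨0, 17, 0, 34, 1, 17, 2, 0⟩], []⟩,
    ⟨19, [⟨0, 19, 2, 21, 1, 19, 1, 0⟩, ⟨0, 17, 0, 34, 1, 17, 2, 0⟩], []⟩,
    ⟨19, [⟨0, 19, 1, 20, 1, 19, 1, 0⟩, ⟨0, 17, 0, 34, 1, 17, 2, 0⟩], []⟩,
    ⟨19, [⟨0, 19, 0, 19, 1, 19, 1, 0⟩, ⟨0, 7, 0, 34, 3, 17, 6, 0⟩], []⟩,
    ⟨19, [⟨0, 19, 0, 19, 1, 19, 1, 0⟩, ⟨0, 17, 0, 34, 1, 17, 2, 0⟩], []⟩,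
    ⟨19, [⟨0, 19, 0, 19, 1, 19, 1, 0⟩, ⟨0, 17, 0, 34, 1, 17, 2, 0⟩], []⟩,
    ⟨19, [⟨0, 19, 0, 19, 1, 19, 1, 0⟩, ⟨0, 17, 0, 34, 1, 17, 2, 0⟩], []⟩,
    ⟨19, [⟨0, 19, 15, 34, 1, 19, 1, 0⟩, ⟨0, 17, 0, 34, 1, 17, 2, 0⟩], []⟩,
    ⟨19, [⟨0, 19, 14, 33, 1, 19, 1, 0⟩, ⟨0, 17, 0, 34, 1, 17, 2, 0⟩], []⟩,
    ⟨19, [⟨0, 19, 13, 32, 1, 19, 1, 0⟩, ⟨0, 17, 0, 34, 1, 17, 2, 0⟩], []⟩,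
    ⟨19, [⟨0, 19, 12, 31, 1, 19, 1, 0⟩, ⟨0, 17, 0, 34, 1, 17, 2, 0⟩], []⟩,
    ⟨19, [⟨0, 19, 11, 30, 1, 19, 1, 0⟩, ⟨0, 17, 0, 34, 1, 17, 2, 0⟩], []⟩]

def row35 : List Entry :=
  [⟨29, [⟨0, 29, 3, 32, 1, 29, 1, 0⟩, ⟨0, 7, 0, 35, 1, 7, 5, 0⟩], []⟩,
    ⟨19, [⟨0, 19, 7, 26, 1, 19, 1, 0⟩, ⟨0, 37, 0, 35, 1, 35, 1, 0⟩], []⟩,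
    ⟨29, [⟨0, 29, 1, 30, 1, 29, 1, 0⟩, ⟨0, 7, 0, 35, 1, 7, 5, 0⟩], []⟩,
    ⟨19, [⟨0, 19, 5, 24, 1, 19, 1, 0⟩, ⟨0, 41, 0, 35, 1, 35, 1, 0⟩], []⟩,
    ⟨19, [⟨0, 19, 4, 23, 1, 19, 1, 0⟩, ⟨0, 43, 0, 35, 1, 35, 1, 0⟩], []⟩,
    ⟨29, [⟨0, 29, 0, 29, 1, 29, 1, 0⟩, ⟨0, 7, 0, 35, 1, 7, 5, 0⟩], []⟩,
    ⟨19, [⟨0, 19, 2, 21, 1, 19, 1, 0⟩, ⟨0, 47, 0, 35, 1, 35, 1, 0⟩], []⟩,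
    ⟨19, [⟨0, 19, 1, 20, 1, 19, 1, 0⟩, ⟨0, 7, 0, 35, 6, 35, 6, 0⟩], []⟩,
    ⟨19, [⟨0, 19, 0, 19, 1, 19, 1, 0⟩, ⟨0, 7, 0, 35, 6, 35, 6, 0⟩], []⟩,
    ⟨19, [⟨0, 19, 0, 19, 1, 19, 1, 0⟩, ⟨0, 7, 0, 35, 6, 35, 6, 0⟩], []⟩,
    ⟨19, [⟨0, 19, 0, 19, 1, 19, 1, 0⟩, ⟨0, 7, 0, 35, 6, 35, 6, 0⟩], []⟩,
    ⟨19, [⟨0, 19, 16, 35, 1, 19, 1, 0⟩, ⟨0, 7, 0, 35, 6, 35, 6, 0⟩], []⟩,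
    ⟨19, [⟨0, 19, 15, 34, 1, 19, 1, 0⟩, ⟨0, 7, 0, 35, 6, 35, 6, 0⟩], []⟩,
    ⟨19, [⟨0, 19, 14, 33, 1, 19, 1, 0⟩, ⟨0, 61, 0, 35, 1, 35, 1, 0⟩], []⟩,
    ⟨19, [⟨0, 19, 13, 32, 1, 19, 1, 0⟩, ⟨0, 17, 0, 34, 1, 17, 2, 0⟩], [(67, 1)]⟩,
    ⟨19, [⟨0, 19, 12, 31, 1, 19, 1, 0⟩, ⟨0, 17, 0, 34, 1, 17, 2, 0⟩], [(67, 1)]⟩,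
    ⟨19, [⟨0, 19, 11, 30, 1, 19, 1, 0⟩, ⟨0, 67, 0, 35, 1, 35, 1, 0⟩], []⟩]

def row36 : List Entry :=
  [⟨19, [⟨0, 19, 8, 27, 1, 19, 1, 0⟩, ⟨0, 37, 0, 36, 1, 36, 1, 0⟩], []⟩,
    ⟨19, [⟨0, 19, 7, 26, 1, 19, 1, 0⟩, ⟨0, 37, 0, 35, 1, 35, 1, 0⟩, ⟨1, 2, 0, 36, 1, 2, 18, 0⟩], []⟩,
    ⟨19, [⟨0, 19, 6, 25, 1, 19, 1, 0⟩, ⟨0, 41, 0, 36, 1, 36, 1, 0⟩], []⟩,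
    ⟨19, [⟨0, 19, 5, 24, 1, 19, 1, 0⟩, ⟨0, 43, 0, 36, 1, 36, 1, 0⟩], []⟩,
    ⟨19, [⟨0, 19, 4, 23, 1, 19, 1, 0⟩, ⟨0, 43, 0, 35, 1, 35, 1, 0⟩, ⟨1, 2, 0, 36, 1, 2, 18, 0⟩], []⟩,
    ⟨19, [⟨0, 19, 3, 22, 1, 19, 1, 0⟩, ⟨0, 47, 0, 36, 1, 36, 1, 0⟩], []⟩,
    ⟨19, [⟨0, 19, 2, 21, 1, 19, 1, 0⟩, ⟨0, 7, 1, 36, 6, 35, 6, 0⟩, ⟨1, 2, 0, 36, 1, 2, 18, 0⟩], []⟩,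
    ⟨19, [⟨0, 19, 1, 20, 1, 19, 1, 0⟩, ⟨0, 7, 0, 35, 6, 35, 6, 0⟩, ⟨1, 2, 0, 36, 1, 2, 18, 0⟩], []⟩,
    ⟨19, [⟨0, 19, 0, 19, 1, 19, 1, 0⟩, ⟨0, 53, 0, 36, 1, 36, 1, 0⟩], []⟩,
    ⟨19, [⟨0, 19, 0, 19, 1, 19, 1, 0⟩, ⟨0, 7, 0, 35, 6, 35, 6, 0⟩, ⟨1, 2, 0, 36, 1, 2, 18, 0⟩], []⟩,
    ⟨19, [⟨0, 19, 17, 36, 1, 19, 1, 0⟩, ⟨0, 7, 0, 35, 6, 35, 6, 0⟩, ⟨1, 2, 0, 36, 1, 2, 18, 0⟩], []⟩,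
    ⟨19, [⟨0, 19, 16, 35, 1, 19, 1, 0⟩, ⟨0, 59, 0, 36, 1, 36, 1, 0⟩], []⟩,
    ⟨19, [⟨0, 19, 15, 34, 1, 19, 1, 0⟩, ⟨0, 61, 0, 36, 1, 36, 1, 0⟩], []⟩,
    ⟨19, [⟨0, 19, 14, 33, 1, 19, 1, 0⟩, ⟨0, 61, 0, 35, 1, 35, 1, 0⟩, ⟨1, 2, 0, 36, 1, 2, 18, 0⟩], []⟩,
    ⟨19, [⟨0, 19, 13, 32, 1, 19, 1, 0⟩, ⟨0, 17, 0, 34, 1, 17, 2, 0⟩, ⟨1, 2, 0, 36, 1, 2, 18, 0⟩], [(71, 2)]⟩,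
    ⟨19, [⟨0, 19, 12, 31, 1, 19, 1, 0⟩, ⟨0, 67, 0, 36, 1, 36, 1, 0⟩], []⟩,
    ⟨19, [⟨0, 19, 11, 30, 1, 19, 1, 0⟩, ⟨0, 67, 0, 35, 1, 35, 1, 0⟩, ⟨1, 2, 0, 36, 1, 2, 18, 0⟩], []⟩]

def row37 : List Entry :=
  [⟨19, [⟨0, 19, 8, 27, 1, 19, 1, 0⟩, ⟨0, 37, 0, 37, 1, 37, 1, 0⟩], []⟩,
    ⟨19, [⟨0, 19, 7, 26, 1, 19, 1, 0⟩, ⟨0, 37, 0, 37, 1, 37, 1, 0⟩], []⟩,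
    ⟨19, [⟨0, 19, 6, 25, 1, 19, 1, 0⟩, ⟨0, 37, 0, 37, 1, 37, 1, 0⟩], []⟩,
    ⟨19, [⟨0, 19, 5, 24, 1, 19, 1, 0⟩, ⟨0, 37, 0, 37, 1, 37, 1, 0⟩], []⟩,
    ⟨19, [⟨0, 19, 4, 23, 1, 19, 1, 0⟩, ⟨0, 37, 0, 37, 1, 37, 1, 0⟩], []⟩,
    ⟨19, [⟨0, 19, 3, 22, 1, 19, 1, 0⟩, ⟨0, 37, 0, 37, 1, 37, 1, 0⟩], []⟩,
    ⟨19, [⟨0, 19, 2, 21, 1, 19, 1, 0⟩, ⟨0, 37, 0, 37, 1, 37, 1, 0⟩], []⟩,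
    ⟨19, [⟨0, 19, 1, 20, 1, 19, 1, 0⟩, ⟨0, 37, 0, 37, 1, 37, 1, 0⟩], []⟩,
    ⟨19, [⟨0, 19, 0, 19, 1, 19, 1, 0⟩, ⟨0, 37, 0, 37, 1, 37, 1, 0⟩], []⟩,
    ⟨19, [⟨0, 19, 18, 37, 1, 19, 1, 0⟩, ⟨0, 37, 0, 37, 1, 37, 1, 0⟩], []⟩,
    ⟨19, [⟨0, 19, 17, 36, 1, 19, 1, 0⟩, ⟨0, 37, 0, 37, 1, 37, 1, 0⟩], []⟩,
    ⟨19, [⟨0, 19, 16, 35, 1, 19, 1, 0⟩, ⟨0, 37, 0, 37, 1, 37, 1, 0⟩], []⟩,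
    ⟨19, [⟨0, 19, 15, 34, 1, 19, 1, 0⟩, ⟨0, 37, 0, 37, 1, 37, 1, 0⟩], []⟩,
    ⟨19, [⟨0, 19, 14, 33, 1, 19, 1, 0⟩, ⟨0, 37, 0, 37, 1, 37, 1, 0⟩], []⟩,
    ⟨19, [⟨0, 19, 13, 32, 1, 19, 1, 0⟩, ⟨0, 37, 0, 37, 1, 37, 1, 0⟩], []⟩,
    ⟨19, [⟨0, 19, 12, 31, 1, 19, 1, 0⟩, ⟨0, 37, 0, 37, 1, 37, 1, 0⟩], []⟩,
    ⟨19, [⟨0, 19, 11, 30, 1, 19, 1, 0⟩, ⟨0, 37, 0, 37, 1, 37, 1, 0⟩], []⟩]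

def row38 : List Entry :=
  [⟨23, [⟨0, 23, 6, 29, 1, 23, 1, 0⟩, ⟨0, 19, 0, 38, 1, 19, 2, 0⟩], []⟩,
    ⟨23, [⟨0, 23, 5, 28, 1, 23, 1, 0⟩, ⟨0, 19, 0, 38, 1, 19, 2, 0⟩], []⟩,
    ⟨23, [⟨0, 23, 4, 27, 1, 23, 1, 0⟩, ⟨0, 19, 0, 38, 1, 19, 2, 0⟩], []⟩,
    ⟨23, [⟨0, 23, 3, 26, 1, 23, 1, 0⟩, ⟨0, 19, 0, 38, 1, 19, 2, 0⟩], []⟩,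
    ⟨23, [⟨0, 23, 2, 25, 1, 23, 1, 0⟩, ⟨0, 19, 0, 38, 1, 19, 2, 0⟩], []⟩,
    ⟨23, [⟨0, 23, 1, 24, 1, 23, 1, 0⟩, ⟨0, 19, 0, 38, 1, 19, 2, 0⟩], []⟩,
    ⟨23, [⟨0, 23, 0, 23, 1, 23, 1, 0⟩, ⟨0, 19, 0, 38, 1, 19, 2, 0⟩], []⟩,
    ⟨23, [⟨0, 23, 0, 23, 1, 23, 1, 0⟩, ⟨0, 19, 0, 38, 1, 19, 2, 0⟩], []⟩,
    ⟨23, [⟨0, 23, 0, 23, 1, 23, 1, 0⟩, ⟨0, 19, 0, 38, 1, 19, 2, 0⟩], []⟩,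
    ⟨23, [⟨0, 23, 0, 23, 1, 23, 1, 0⟩, ⟨0, 19, 0, 38, 1, 19, 2, 0⟩], []⟩,
    ⟨23, [⟨0, 23, 0, 23, 1, 23, 1, 0⟩, ⟨0, 19, 0, 38, 1, 19, 2, 0⟩], []⟩,
    ⟨23, [⟨0, 23, 0, 23, 1, 23, 1, 0⟩, ⟨0, 19, 0, 38, 1, 19, 2, 0⟩], []⟩,
    ⟨23, [⟨0, 23, 0, 23, 1, 23, 1, 0⟩, ⟨0, 19, 0, 38, 1, 19, 2, 0⟩], []⟩,
    ⟨23, [⟨0, 23, 0, 23, 1, 23, 1, 0⟩, ⟨0, 19, 0, 38, 1, 19, 2, 0⟩], []⟩,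
    ⟨23, [⟨0, 23, 15, 38, 1, 23, 1, 0⟩, ⟨0, 19, 0, 38, 1, 19, 2, 0⟩], []⟩,
    ⟨23, [⟨0, 23, 14, 37, 1, 23, 1, 0⟩, ⟨0, 19, 0, 38, 1, 19, 2, 0⟩], []⟩,
    ⟨23, [⟨0, 23, 13, 36, 1, 23, 1, 0⟩, ⟨0, 19, 0, 38, 1, 19, 2, 0⟩], []⟩]

def row39 : List Entry :=
  [⟨23, [⟨0, 23, 6, 29, 1, 23, 1, 0⟩, ⟨0, 43, 0, 39, 1, 39, 1, 0⟩], []⟩,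
    ⟨29, [⟨0, 29, 2, 31, 1, 29, 1, 0⟩, ⟨0, 13, 0, 39, 1, 13, 3, 0⟩], []⟩,
    ⟨23, [⟨0, 23, 4, 27, 1, 23, 1, 0⟩, ⟨0, 47, 0, 39, 1, 39, 1, 0⟩], []⟩,
    ⟨29, [⟨0, 29, 0, 29, 1, 29, 1, 0⟩, ⟨0, 13, 0, 39, 1, 13, 3, 0⟩], []⟩,
    ⟨29, [⟨0, 29, 0, 29, 1, 29, 1, 0⟩, ⟨0, 13, 0, 39, 1, 13, 3, 0⟩], []⟩,
    ⟨23, [⟨0, 23, 1, 24, 1, 23, 1, 0⟩, ⟨0, 53, 0, 39, 1, 39, 1, 0⟩], []⟩,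
    ⟨29, [⟨0, 29, 0, 29, 1, 29, 1, 0⟩, ⟨0, 13, 0, 39, 1, 13, 3, 0⟩], []⟩,
    ⟨29, [⟨0, 29, 0, 29, 1, 29, 1, 0⟩, ⟨0, 13, 0, 39, 1, 13, 3, 0⟩], []⟩,
    ⟨23, [⟨0, 23, 0, 23, 1, 23, 1, 0⟩, ⟨0, 59, 0, 39, 1, 39, 1, 0⟩], []⟩,
    ⟨23, [⟨0, 23, 0, 23, 1, 23, 1, 0⟩, ⟨0, 61, 0, 39, 1, 39, 1, 0⟩], []⟩,
    ⟨29, [⟨0, 29, 0, 29, 1, 29, 1, 0⟩, ⟨0, 13, 0, 39, 1, 13, 3, 0⟩], []⟩,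
    ⟨29, [⟨0, 29, 0, 29, 1, 29, 1, 0⟩, ⟨0, 13, 0, 39, 1, 13, 3, 0⟩], []⟩,
    ⟨23, [⟨0, 23, 0, 23, 1, 23, 1, 0⟩, ⟨0, 67, 0, 39, 1, 39, 1, 0⟩], []⟩,
    ⟨29, [⟨0, 29, 0, 29, 1, 29, 1, 0⟩, ⟨0, 13, 0, 39, 1, 13, 3, 0⟩], []⟩,
    ⟨23, [⟨0, 23, 15, 38, 1, 23, 1, 0⟩, ⟨0, 71, 0, 39, 1, 39, 1, 0⟩], []⟩,
    ⟨23, [⟨0, 23, 14, 37, 1, 23, 1, 0⟩, ⟨0, 73, 0, 39, 1, 39, 1, 0⟩], []⟩,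
    ⟨29, [⟨0, 29, 0, 29, 1, 29, 1, 0⟩, ⟨0, 13, 0, 39, 1, 13, 3, 0⟩], []⟩]

def row40 : List Entry :=
  [⟨23, [⟨0, 23, 6, 29, 1, 23, 1, 0⟩, ⟨0, 43, 0, 39, 1, 39, 1, 0⟩, ⟨1, 2, 0, 40, 1, 2, 20, 0⟩], []⟩,
    ⟨23, [⟨0, 23, 5, 28, 1, 23, 1, 0⟩, ⟨0, 47, 0, 40, 1, 40, 1, 0⟩], []⟩,
    ⟨23, [⟨0, 23, 4, 27, 1, 23, 1, 0⟩, ⟨0, 47, 0, 39, 1, 39, 1, 0⟩, ⟨1, 2, 0, 40, 1, 2, 20, 0⟩], []⟩,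
    ⟨29, [⟨0, 29, 0, 29, 1, 29, 1, 0⟩, ⟨0, 13, 0, 39, 1, 13, 3, 0⟩, ⟨1, 2, 0, 40, 1, 2, 20, 0⟩], []⟩,
    ⟨23, [⟨0, 23, 2, 25, 1, 23, 1, 0⟩, ⟨0, 53, 0, 40, 1, 40, 1, 0⟩], []⟩,
    ⟨23, [⟨0, 23, 1, 24, 1, 23, 1, 0⟩, ⟨0, 53, 0, 39, 1, 39, 1, 0⟩, ⟨1, 2, 0, 40, 1, 2, 20, 0⟩], []⟩,
    ⟨29, [⟨0, 29, 0, 29, 1, 29, 1, 0⟩, ⟨0, 13, 0, 39, 1, 13, 3, 0⟩, ⟨1, 2, 0, 40, 1, 2, 20, 0⟩], []⟩,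
    ⟨23, [⟨0, 23, 0, 23, 1, 23, 1, 0⟩, ⟨0, 59, 0, 40, 1, 40, 1, 0⟩], []⟩,
    ⟨23, [⟨0, 23, 0, 23, 1, 23, 1, 0⟩, ⟨0, 61, 0, 40, 1, 40, 1, 0⟩], []⟩,
    ⟨23, [⟨0, 23, 0, 23, 1, 23, 1, 0⟩, ⟨0, 61, 0, 39, 1, 39, 1, 0⟩, ⟨1, 2, 0, 40, 1, 2, 20, 0⟩], []⟩,
    ⟨29, [⟨0, 29, 0, 29, 1, 29, 1, 0⟩, ⟨0, 13, 1, 40, 1, 13, 3, 0⟩, ⟨1, 2, 0, 40, 1, 2, 20, 0⟩], []⟩,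
    ⟨23, [⟨0, 23, 0, 23, 1, 23, 1, 0⟩, ⟨0, 67, 0, 40, 1, 40, 1, 0⟩], []⟩,
    ⟨23, [⟨0, 23, 17, 40, 1, 23, 1, 0⟩, ⟨0, 67, 0, 39, 1, 39, 1, 0⟩, ⟨1, 2, 0, 40, 1, 2, 20, 0⟩], []⟩,
    ⟨23, [⟨0, 23, 16, 39, 1, 23, 1, 0⟩, ⟨0, 71, 0, 40, 1, 40, 1, 0⟩], []⟩,
    ⟨23, [⟨0, 23, 15, 38, 1, 23, 1, 0⟩, ⟨0, 73, 0, 40, 1, 40, 1, 0⟩], []⟩,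
    ⟨23, [⟨0, 23, 14, 37, 1, 23, 1, 0⟩, ⟨0, 73, 0, 39, 1, 39, 1, 0⟩, ⟨1, 2, 0, 40, 1, 2, 20, 0⟩], []⟩,
    ⟨29, [⟨0, 29, 0, 29, 1, 29, 1, 0⟩, ⟨0, 13, 0, 39, 1, 13, 3, 0⟩, ⟨1, 2, 0, 40, 1, 2, 20, 0⟩], []⟩]
def Entry.ok (n : ℕ) (u : ℤ) (e : Entry) : Bool :=
  irrChk2 n (coefL n (2 * u + 1)) e.certs e.mcs && 
   ((e.pp.beq 1) || (isP e.pp && e.certs.any fun c => (c.b % e.pp).beq 0))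

def rowOk (n : ℕ) : ℤ → List Entry → Bool
  | _, [] => true
  | u, e :: es => e.ok n u && rowOk n (u + 1) es

set_option maxRecDepth 100000
theorem row2_ok : rowOk 2 (-18) row2 = true := by decide +kernel
theorem row3_ok : rowOk 3 (-18) row3 = true := by decide +kernel
theorem row4_ok : rowOk 4 (-18) row4 = true := by decide +kernel
theorem row5_ok : rowOk 5 (-18) row5 = true := by decide +kernel
theorem row6_ok : rowOk 6 (-18) row6 = true := by decide +kernel
theorem row7_ok : rowOk 7 (-18) row7 = true := by decide +kernel
theorem row8_ok : rowOk 8 (-18) row8 = true := by decide +kernel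
theorem row9_ok : rowOk 9 (-18) row9 = true := by decide +kernel
theorem row10_ok : rowOk 10 (-18) row10 = true := by decide +kernel
theorem row11_ok : rowOk 11 (-18) row11 = true := by decide +kernel
theorem row12_ok : rowOk 12 (-18) row12 = true := by decide +kernel
theorem row13_ok : rowOk 13 (-18) row13 = true := by decide +kernel
theorem row14_ok : rowOk 14 (-18) row14 = true := by decide +kernel
theorem row15_ok : rowOk 15 (-18) row15 = true := by decide +kernel
theorem row16_ok : rowOk 16 (-18) row16 = true := by decide +kernel
theorem row17_ok : rowOk 17 (-18) row17 = true := by decide +kernel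
theorem row18_ok : rowOk 18 (-18) row18 = true := by decide +kernel
theorem row19_ok : rowOk 19 (-18) row19 = true := by decide +kernel
theorem row20_ok : rowOk 20 (-18) row20 = true := by decide +kernel
theorem row21_ok : rowOk 21 (-18) row21 = true := by decide +kernel
theorem row22_ok : rowOk 22 (-18) row22 = true := by decide +kernel
theorem row23_ok : rowOk 23 (-18) row23 = true := by decide +kernel
theorem row24_ok : rowOk 24 (-18) row24 = true := by decide +kernel
theorem row25_ok : rowOk 25 (-18) row25 = true := by decide +kernel
theorem row26_ok : rowOk 26 (-18) row26 = true := by decide +kernel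
theorem row27_ok : rowOk 27 (-18) row27 = true := by decide +kernel
theorem row28_ok : rowOk 28 (-18) row28 = true := by decide +kernel
theorem row29_ok : rowOk 29 (-18) row29 = true := by decide +kernel
theorem row30_ok : rowOk 30 (-18) row30 = true := by decide +kernel
theorem row31_ok : rowOk 31 (-18) row31 = true := by decide +kernel
theorem row32_ok : rowOk 32 (-18) row32 = true := by decide +kernel
theorem row33_ok : rowOk 33 (-18) row33 = true := by decide +kernel
theorem row34_ok : rowOk 34 (-18) row34 = true := by decide +kernel
theorem row35_ok : rowOk 35 (-18) row35 = true := by decide +kernel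
theorem row36_ok : rowOk 36 (-18) row36 = true := by decide +kernel
theorem row37_ok : rowOk 37 (-18) row37 = true := by decide +kernel
theorem row38_ok : rowOk 38 (-18) row38 = true := by decide +kernel
theorem row39_ok : rowOk 39 (-18) row39 = true := by decide +kernel
theorem row40_ok : rowOk 40 (-18) row40 = true := by decide +kernel

section
section
open Equiv Equiv.Perm MulAction

/-- Primitivity from a prime-order element with large support. -/
theorem jordan_prim {α : Type*} [Fintype α] [DecidableEq α] (G : Subgroup (Perm α)) [IsPretransitive G α] (p : ℕ)
    [hp : Fact p.Prime] (h1 : Fintype.card α < 2 * p) (hdvd : p ∣ Nat.card G) :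
    ∃ g ∈ G, g.IsCycle ∧ g.support.card = p ∧ orderOf g = p ∧
      IsPreprimitive (fixingSubgroup G (g.support : Set α)ᶜ)
      (SubMulAction.ofFixingSubgroup G (g.support : Set α)ᶜ) ∧ IsPreprimitive G α := by
  obtain ⟨⟨g, hg⟩, hgo⟩ := exists_prime_orderOf_dvd_card' p hdvd
  rw [Subgroup.orderOf_mk] at hgo
  have hc : g.IsCycle := isCycle_of_prime_order' (by rw [hgo]; exact hp.out) (by rw [hgo]; exact h1)
  have hs : g.support.card = p := by rw [← hc.orderOf, hgo]
  have htr := isPretransitive_of_isCycle_mem hc hg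
  have hcard : Nat.card (SubMulAction.ofFixingSubgroup G (g.support : Set α)ᶜ) = p := by
    classical
    rw [← hs, Nat.card_eq_fintype_card, Fintype.card_subtype]
    congr 1
    ext x
    simp [SubMulAction.mem_ofFixingSubgroup_iff]
  have hpr : IsPreprimitive (fixingSubgroup G (g.support : Set α)ᶜ)
      (SubMulAction.ofFixingSubgroup G (g.support : Set α)ᶜ) :=
    IsPreprimitive.of_prime_card (by rw [hcard]; exact hp.out)
  refine ⟨g, hg, hc, hs, hgo, hpr, ?_⟩
  refine IsPreprimitive.of_card_lt (f := SubMulAction.ofFixingSubgroup_equivariantMap G (g.support : Set α)ᶜ) ?_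
  rw [← Set.image_univ, Set.ncard_image_of_injective _
    (SubMulAction.ofFixingSubgroup_equivariantMap_injective), Set.ncard_univ, hcard, Nat.card_eq_fintype_card]
  exact h1

/-- `p`-adic valuation of the order of a group of permutations of fewer than `2 * p` points. -/
theorem card_fact_le {α : Type*} [Fintype α] [DecidableEq α] (H : Subgroup (Perm α)) (p : ℕ)
    [hp : Fact p.Prime] (h0 : p ≤ Fintype.card α) (h1 : Fintype.card α < 2 * p) (hdvd : p ∣ Nat.card H) :
    (Nat.card H).factorization p = 1 := by
  have hH : Nat.card H ∣ (Fintype.card α).factorial := by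
    rw [← Fintype.card_perm, ← Nat.card_eq_fintype_card]
    exact Subgroup.card_subgroup_dvd_card H
  apply le_antisymm
  · have := (Nat.factorization_le_iff_dvd Nat.card_pos.ne' (Nat.factorial_ne_zero _)).mpr hH p
    refine this.trans ?_
    obtain ⟨m, hm⟩ := Nat.exists_eq_add_of_le h0
    rw [Nat.factorization_def _ hp.out, hm]
    have h2 := padicValNat_factorial_mul_add (p := p) 1 (show m < p by omega)
    have h3 := padicValNat_factorial_mul (p := p) 1
    rw [mul_one] at h2 h3
    rw [h2, h3]
    simp
  · exact (hp.out.dvd_iff_one_le_factorization Nat.card_pos.ne').mp hdvd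

/-- If `x ∈ G` preserves the fixed points of the `p`-cycle `g`, adjust it to normalize `⟨g⟩`. -/
theorem jordan_adjust {α : Type*} [Fintype α] [DecidableEq α] (G : Subgroup (Perm α)) (p : ℕ)
    [hp : Fact p.Prime] (h1 : Fintype.card α < 2 * p) (g : Perm α) (hg : g ∈ G)
    (hs : g.support.card = p) (hgo : orderOf g = p) (x : Perm α) (hx : x ∈ G)
    (hxs : ∀ a, a ∉ g.support → x a ∉ g.support) :
    ∃ y ∈ G, (∀ a, a ∉ g.support → y a = x a) ∧ ∃ i : ℤ, y * g * y⁻¹ = g ^ i := by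
  have h0 : p ≤ Fintype.card α := by rw [← hs]; exact Finset.card_le_univ _
  let H : Subgroup (Perm α) :=
    { carrier := {h | h ∈ G ∧ ∀ a, a ∉ g.support → h a = a}
      mul_mem' := fun {a b} ha hb => ⟨G.mul_mem ha.1 hb.1, fun c hc => by
        rw [Perm.mul_apply, hb.2 c hc, ha.2 c hc]⟩
      one_mem' := ⟨G.one_mem, fun _ _ => rfl⟩
      inv_mem' := fun {a} ha => ⟨G.inv_mem ha.1, fun c hc => by
        rw [Perm.inv_eq_iff_eq, ha.2 c hc]⟩ }
  have hgH : g ∈ H := ⟨hg, fun a ha => by simpa using ha⟩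
  have hxs' : ∀ a, a ∉ g.support → x⁻¹ a ∉ g.support := by
    have hb : Set.SurjOn x (g.supportᶜ : Finset α) (g.supportᶜ : Finset α) :=
      Finset.surjOn_of_injOn_of_card_le x (fun a ha => by
        simp only [Finset.coe_compl, Set.mem_compl_iff, Finset.mem_coe] at ha ⊢
        exact hxs a ha) x.injective.injOn le_rfl
    intro a ha
    obtain ⟨b, hb, rfl⟩ := hb (by simpa using ha : a ∈ ((g.supportᶜ : Finset α) : Set α))
    simpa using hb
  have hxgH : x * g * x⁻¹ ∈ H := ⟨G.mul_mem (G.mul_mem hx hg) (G.inv_mem hx), fun a ha => by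
    have : g (x⁻¹ a) = x⁻¹ a := by simpa using hxs' a ha
    rw [Perm.mul_apply, Perm.mul_apply, this]; simp⟩
  have hco : orderOf (x * g * x⁻¹) = p := by
    rw [← hgo]
    exact orderOf_injective (MulAut.conj x).toMonoidHom (MulAut.conj x).injective g
  have hdvd : p ∣ Nat.card H := by
    have := orderOf_dvd_natCard (⟨g, hgH⟩ : H)
    rwa [Subgroup.orderOf_mk, hgo] at this
  have hfac := card_fact_le H p h0 h1 hdvd
  let P : Sylow p H := Sylow.ofCard (Subgroup.zpowers (⟨g, hgH⟩ : H)) (by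
    rw [Nat.card_zpowers, Subgroup.orderOf_mk, hgo, hfac, pow_one])
  let Q : Sylow p H := Sylow.ofCard (Subgroup.zpowers (⟨x * g * x⁻¹, hxgH⟩ : H)) (by
    rw [Nat.card_zpowers, Subgroup.orderOf_mk, hco, hfac, pow_one])
  obtain ⟨h, hh⟩ := MulAction.exists_smul_eq H Q P
  have hmem : h * (⟨x * g * x⁻¹, hxgH⟩ : H) * h⁻¹ ∈ (P : Subgroup H) := by
    rw [← hh]
    rw [Sylow.coe_subgroup_smul]
    exact Subgroup.smul_mem_pointwise_smul _ (MulAut.conj h) _ (Subgroup.mem_zpowers _)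
  obtain ⟨i, hi⟩ := Subgroup.mem_zpowers_iff.mp hmem
  refine ⟨h.1 * x, G.mul_mem h.2.1 hx, fun a ha => ?_, i, ?_⟩
  · rw [Perm.mul_apply, h.2.2 _ (hxs a ha)]
  · have := congrArg Subtype.val hi
    simp only [Subgroup.coe_zpow, Subgroup.coe_mul, Subgroup.coe_inv] at this
    rw [this]; group

/-- A transitive group of degree `n` whose order is divisible by a prime `p` with
`n / 2 < p ≤ n - 3` contains the alternating group. -/
theorem jordan_prime {α : Type*} [Fintype α] [DecidableEq α] (G : Subgroup (Perm α))
    [IsPretransitive G α] (p : ℕ) [hp : Fact p.Prime] (h1 : Fintype.card α < 2 * p)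
    (h3 : p + 3 ≤ Fintype.card α) (hdvd : p ∣ Nat.card G) : alternatingGroup α ≤ G := by
  obtain ⟨g, hg, hc, hs, hgo, hpr, hprim⟩ := jordan_prim G p h1 hdvd
  obtain ⟨m, hm⟩ := Nat.exists_eq_add_of_le h3
  have hncard : Set.ncard ((g.support : Set α)ᶜ) = m + 2 + 1 := by
    apply Nat.add_left_cancel (n := Set.ncard (g.support : Set α))
    rw [Set.ncard_add_ncard_compl, Set.ncard_coe_finset, hs, Nat.card_eq_fintype_card, hm]
    ring
  have hp2 := hp.out.two_le
  have hmp := hprim.isMultiplyPreprimitive hncard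
    (by rw [Nat.card_eq_fintype_card, hm]; omega) hpr
  have hmt : IsMultiplyPretransitive G α (m + 2 + 2) := hmp.isMultiplyPretransitive
  have hmt3 : IsMultiplyPretransitive G α (m + 3) :=
    isMultiplyPretransitive_of_le' (n := m + 2 + 2) (by omega)
      (by rw [ENat.card_eq_coe_fintype_card, hm]; exact_mod_cast (by omega))
  have hcΔ : Fintype.card {a // a ∉ g.support} = m + 3 := by
    rw [Fintype.card_subtype_compl, Fintype.card_coe, hs, hm]; omega
  let e : Fin (m + 3) ≃ {a // a ∉ g.support} := (Fintype.equivFinOfCardEq hcΔ).symm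
  let ι : Fin (m + 3) ↪ α := e.toEmbedding.trans (Function.Embedding.subtype _)
  have hιs : ∀ i, ι i ∉ g.support := fun i => (e i).2
  have hsurj : ∀ a, a ∉ g.support → ∃ i, ι i = a := fun a ha => ⟨e.symm ⟨a, ha⟩, by simp [ι]⟩
  have key : ∀ π : Perm (Fin (m + 3)), ∃ y ∈ G, (∀ i, y (ι i) = ι (π i)) ∧
      ∃ i : ℤ, y * g * y⁻¹ = g ^ i := by
    intro π
    obtain ⟨⟨x, hx⟩, hxe⟩ := MulAction.exists_smul_eq G ι (π.toEmbedding.trans ι)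
    have hx' : ∀ i, x (ι i) = ι (π i) := fun i => by
      have := DFunLike.congr_fun hxe i
      simpa using this
    obtain ⟨y, hy, hyx, i, hi⟩ := jordan_adjust G p h1 g hg hs hgo x hx (by
      intro a ha
      obtain ⟨i, rfl⟩ := hsurj a ha
      rw [hx']; exact hιs _)
    exact ⟨y, hy, fun i => by rw [hyx _ (hιs i), hx'], i, hi⟩
  let a : Perm (Fin (m + 3)) := swap ⟨0, by omega⟩ ⟨1, by omega⟩
  let b : Perm (Fin (m + 3)) := swap ⟨0, by omega⟩ ⟨2, by omega⟩
  obtain ⟨X, hXG, hX, i, hi⟩ := key a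
  obtain ⟨Y, hYG, hY, j, hj⟩ := key b
  have h3c : IsThreeCycle ((b * a)⁻¹ * (a * b)) := by
    have h : IsThreeCycle (a * b) := isThreeCycle_swap_mul_swap_same
      (by simp [Fin.ext_iff]) (by simp [Fin.ext_iff]) (by simp [Fin.ext_iff])
    have : (b * a)⁻¹ * (a * b) = (a * b) * (a * b) := by
      rw [mul_inv_rev]
      simp [a, b, swap_inv]
    rw [this]
    exact h.isThreeCycle_sq
  have hXY : (X * Y) * g * (X * Y)⁻¹ = g ^ (i * j) := by
    have : (X * Y) * g * (X * Y)⁻¹ = X * (Y * g * Y⁻¹) * X⁻¹ := by group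
    rw [this, hj, ← conj_zpow, hi, zpow_mul]
  have hYX : (Y * X) * g * (Y * X)⁻¹ = g ^ (i * j) := by
    have : (Y * X) * g * (Y * X)⁻¹ = Y * (X * g * X⁻¹) * Y⁻¹ := by group
    rw [this, hi, ← conj_zpow, hj, mul_comm, zpow_mul]
  let z := (Y * X)⁻¹ * (X * Y)
  have hzG : z ∈ G := G.mul_mem (G.inv_mem (G.mul_mem hYG hXG)) (G.mul_mem hXG hYG)
  have hcom : Commute z g := by
    have h : (X * Y) * g * (X * Y)⁻¹ = (Y * X) * g * (Y * X)⁻¹ := hXY.trans hYX.symm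
    change z * g = g * z
    calc z * g = (Y * X)⁻¹ * ((X * Y) * g * (X * Y)⁻¹) * (X * Y) := by simp only [z]; group
      _ = g * z := by rw [h]; simp only [z]; group
  have hzι : ∀ k, z (ι k) = ι (((b * a)⁻¹ * (a * b)) k) := by
    intro k
    have : ∀ l, (Y * X) (ι l) = ι ((b * a) l) := fun l => by simp [hX, hY]
    have h4 : (X * Y) (ι k) = ι ((a * b) k) := by simp [hX, hY]
    change (Y * X)⁻¹ ((X * Y) (ι k)) = _
    rw [Perm.inv_eq_iff_eq, h4, this, ← Perm.mul_apply, mul_inv_cancel_left]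
  obtain ⟨hz', hz2⟩ := hc.commute_iff.mp hcom
  obtain ⟨r, hr⟩ := Subgroup.mem_zpowers_iff.mp hz2
  let w := z * (g ^ r)⁻¹
  have hwG : w ∈ G := G.mul_mem hzG (G.inv_mem (G.zpow_mem hg r))
  have hgfix : ∀ k, (g ^ r) (ι k) = ι k := fun k => by
    have : g (ι k) = ι k := by simpa using hιs k
    exact zpow_apply_eq_self_of_apply_eq_self this r
  have hw : w = Perm.extendDomain ((b * a)⁻¹ * (a * b)) e := by
    ext x
    by_cases hx : x ∈ g.support
    · rw [extendDomain_apply_not_subtype _ _ (by simpa using hx)]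
      have hx2 : (g ^ r)⁻¹ x ∈ g.support := by
        rw [← zpow_neg, zpow_apply_mem_support]; exact hx
      have : z ((g ^ r)⁻¹ x) = (g ^ r) ((g ^ r)⁻¹ x) := by
        have h5 := DFunLike.congr_fun hr ((g ^ r)⁻¹ x)
        rw [h5, ofSubtype_apply_of_mem _ hx2]
        rfl
      change z ((g ^ r)⁻¹ x) = x
      rw [this]; simp
    · obtain ⟨k, rfl⟩ := hsurj x hx
      change z ((g ^ r)⁻¹ (ι k)) = _
      rw [show (g ^ r)⁻¹ (ι k) = ι k by rw [Perm.inv_eq_iff_eq, hgfix], hzι]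
      exact (extendDomain_apply_image _ e k).symm
  have hw3 : IsThreeCycle w := by
    rw [IsThreeCycle, hw, cycleType_extendDomain]
    exact h3c
  exact alternatingGroup_le_of_isPreprimitive_of_isThreeCycle_mem hprim hw3 hwG

end
end

theorem lcalZ_coeff' (n : ℕ) (c : ℤ) (j : ℕ) : (lcalZ n c).coeff j = lcf n c j := by
  rw [lcalZ_coeff]
  split_ifs with h
  · rfl
  · simp [lcf, Nat.choose_eq_zero_of_lt (by omega : n < j)]

theorem prod_top (c : ℤ) (j n : ℕ) (h : j ≤ n) : ∏ i ∈ Finset.Icc (j + 1) (n + 1), (c + 2 * (i : ℤ)) =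
    (∏ i ∈ Finset.Icc (j + 1) n, (c + 2 * (i : ℤ))) * (c + 2 * ((n : ℤ) + 1)) := by
  rw [Finset.prod_Icc_succ_top (by omega)]; push_cast; ring

theorem prod_bot (c : ℤ) (j n : ℕ) (h : j + 1 ≤ n) : ∏ i ∈ Finset.Icc (j + 1) n, (c + 2 * (i : ℤ)) =
    (c + 2 * ((j : ℤ) + 1)) * ∏ i ∈ Finset.Icc (j + 1 + 1) n, (c + 2 * (i : ℤ)) := by
  rw [← Finset.mul_prod_Ioc_eq_prod_Icc h]
  rw [show Finset.Ioc (j + 1) n = Finset.Icc (j + 1 + 1) n from by ext; simp [Nat.succ_le_iff]]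
  push_cast; ring

theorem choose_rel (n k : ℕ) (h : k ≤ n) :
    (n.choose k : ℤ) * (n + 1) = ((n + 1).choose k : ℤ) * (n + 1 - k) := by
  have := Nat.choose_mul_succ_eq n k
  zify [show k ≤ n + 1 by omega] at this
  exact this

theorem lcf_rel1 (n : ℕ) (c : ℤ) (j : ℕ) :
    ((n : ℤ) + 1 - j) * lcf (n + 1) c j = (n + 1) * (c + 2 * ((n : ℤ) + 1)) * lcf n c j := by
  rcases le_or_gt j n with h | h
  · rw [lcf, lcf, prod_top c j n h]
    linear_combination (-(∏ i ∈ Finset.Icc (j + 1) n, (c + 2 * (i : ℤ))) * (c + 2 * ((n : ℤ) + 1))) * choose_rel n j h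
  · have h0 : lcf n c j = 0 := by simp [lcf, Nat.choose_eq_zero_of_lt h]
    rw [h0]
    rcases Nat.eq_or_lt_of_le (show n + 1 ≤ j from h) with h1 | h1
    · subst h1; push_cast; ring
    · simp [lcf, Nat.choose_eq_zero_of_lt h1]

theorem lcf_rel2 (n : ℕ) (c : ℤ) (j : ℕ) :
    lcf (n + 2) c (j + 1) = lcf (n + 1) c j + (4 * (n : ℤ) + 6 + c) * lcf (n + 1) c (j + 1) -
      2 * (n + 1) * (2 * (n : ℤ) + 2 + c) * lcf n c (j + 1) := by
  rcases lt_trichotomy j n with h | h | h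
  · simp only [lcf]
    rw [prod_top c (j + 1) (n + 1) (by omega), prod_bot c j (n + 1) (by omega), prod_top c (j + 1) n (by omega)]
    have e1 := choose_rel n j (by omega)
    have e2 : ((n + 2).choose (j + 1) : ℤ) = (n + 1).choose j + (n + 1).choose (j + 1) := by
      exact_mod_cast Nat.choose_succ_succ (n + 1) j
    have e3 : ((n + 1).choose (j + 1) : ℤ) = n.choose j + n.choose (j + 1) := by
      exact_mod_cast Nat.choose_succ_succ n j
    rw [e2, e3]
    push_cast
    linear_combination (-2 * (∏ i ∈ Finset.Icc (j + 1 + 1) n, (c + 2 * (i : ℤ))) * (c + 2 * ((n : ℤ) + 1))) * e1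
  · subst h
    have e4 : lcf (j + 2) c (j + 1) = (j + 2) * (c + 2 * ((j : ℤ) + 2)) := by
      simp [lcf, Nat.choose_succ_self_right]; ring
    have e5 : lcf (j + 1) c j = (j + 1) * (c + 2 * ((j : ℤ) + 1)) := by
      simp [lcf, Nat.choose_succ_self_right]
    have e6 : lcf (j + 1) c (j + 1) = 1 := by simp [lcf]
    have e7 : lcf j c (j + 1) = 0 := by simp [lcf]
    rw [e4, e5, e6, e7]; ring
  · have e7 : lcf n c (j + 1) = 0 := by simp [lcf, Nat.choose_eq_zero_of_lt (show n < j + 1 by omega)]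
    have e6 : lcf (n + 1) c (j + 1) = 0 := by simp [lcf, Nat.choose_eq_zero_of_lt (show n + 1 < j + 1 by omega)]
    rw [e7, e6]
    rcases Nat.eq_or_lt_of_le (show n + 1 ≤ j from h) with h1 | h1
    · subst h1; simp [lcf]
    · simp [lcf, Nat.choose_eq_zero_of_lt (show n + 2 < j + 1 by omega), Nat.choose_eq_zero_of_lt h1]

theorem lcalZ_rec (n : ℕ) (c : ℤ) : lcalZ (n + 2) c =
    C (-(2 * (n + 1) * (2 * (n : ℤ) + 2 + c))) * lcalZ n c + lcalZ (n + 1) c * (X + C (4 * (n : ℤ) + 6 + c)) := by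
  ext j
  rw [mul_add (lcalZ (n + 1) c), coeff_add, coeff_add, coeff_C_mul, coeff_mul_C]
  cases j with
  | zero =>
    simp only [lcalZ_coeff', coeff_mul_X_zero, lcf, Nat.choose_zero_right]
    rw [prod_top c 0 (n + 1) (by omega), prod_top c 0 n (by omega)]
    push_cast; ring
  | succ j =>
    rw [coeff_mul_X]
    simp only [lcalZ_coeff']
    rw [lcf_rel2]; ring

theorem lcalZ_deriv (n : ℕ) (c : ℤ) : X * derivative (lcalZ (n + 1) c) =
    C ((n : ℤ) + 1) * lcalZ (n + 1) c - C ((n + 1) * (c + 2 * ((n : ℤ) + 1))) * lcalZ n c := by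
  ext j
  rw [coeff_sub, coeff_C_mul, coeff_C_mul, lcalZ_coeff', lcalZ_coeff', ← lcf_rel1]
  cases j with
  | zero => simp
  | succ j =>
    rw [coeff_X_mul, coeff_derivative, lcalZ_coeff']
    push_cast; ring

/-- product formula for the resultant -/
def resP (c : ℤ) : ℕ → ℤ
  | 0 => 1
  | n + 1 => (-(2 * (n + 1) * (2 * (n : ℤ) + 2 + c))) ^ (n + 1) * resP c n

theorem lcalZ_res (n : ℕ) (c : ℤ) : resultant (lcalZ (n + 1) c) (lcalZ n c) (n + 1) n = resP c n := by
  induction n with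
  | zero =>
    have : lcalZ 0 c = 1 := by simp [lcalZ, lcf]
    rw [this]; simp [resP]
  | succ n ih =>
    have hd := lcalZ_natDegree
    rw [lcalZ_rec, resultant_add_mul_left _ _ _ _ _ (by rw [natDegree_X_add_C]; omega) (hd _ _).le,
      resultant_C_mul_left, resP, show n + 1 + 1 = n + 2 from rfl,
      resultant_add_left_deg _ _ _ _ _ (hd _ _).le, resultant_comm, ih, lcalZ_coeff']
    have h1 : lcf (n + 1) c (n + 1) = 1 := by simp [lcf]
    have h2 : ((-1 : ℤ)) ^ (n * (n + 1)) = 1 := (Nat.even_mul_succ_self n).neg_one_pow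
    have h3 : ((-1 : ℤ)) ^ ((n + 1) * 2) = 1 := by rw [mul_comm, pow_mul]; simp
    rw [h1, h2, h3]; ring

/-- Square class representative of the discriminant of `lcalZ n c`. -/
def dsc (n : ℕ) (c : ℤ) : ℤ :=
  (-1) ^ (n * (n - 1) / 2) * (n * (c + 2 * (n : ℤ))) ^ n * resP c (n - 1) * lcf n c 0

theorem vander_sq {L : Type*} [Field L] (n : ℕ) (θ : Fin n → L) :
    (Matrix.vandermonde θ).det ^ 2 =
      (-1) ^ (n * (n - 1) / 2) * ∏ i, (derivative (∏ j, (X - C (θ j)))).eval (θ i) := by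
  have h1 : ∀ i, (derivative (∏ j, (X - C (θ j)))).eval (θ i) = ∏ j ∈ {i}ᶜ, (θ i - θ j) := by
    intro i
    rw [derivative_prod_finset, eval_finsetSum, Finset.sum_eq_single i]
    · simp [eval_prod, Finset.compl_eq_univ_sdiff, Finset.sdiff_singleton_eq_erase]
    · intro b _ hb
      rw [eval_mul, eval_prod, Finset.prod_eq_zero (i := i)]
      · simp
      · simp [hb.symm]
      · simp
    · simp
  simp_rw [h1]
  rw [← Finset.prod_prod_Ioi_mul_eq_prod_prod_off_diag (fun j i => θ i - θ j), Matrix.det_vandermonde,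
    ← Finset.prod_pow]
  have h2 : ∀ i : Fin n, ∏ j ∈ Ioi i, ((θ i - θ j) * (θ j - θ i)) =
      (-1) ^ (n - 1 - (i : ℕ)) * (∏ j ∈ Ioi i, (θ j - θ i)) ^ 2 := by
    intro i
    rw [← Fin.card_Ioi, ← Finset.prod_pow, ← Finset.prod_const, ← Finset.prod_mul_distrib]
    exact Finset.prod_congr rfl fun _ _ => by ring
  simp_rw [h2]
  rw [Finset.prod_mul_distrib, Finset.prod_pow_eq_pow_sum, Fin.sum_univ_eq_sum_range (fun i => n - 1 - i),
    Finset.sum_range_reflect (fun i => i), Finset.sum_range_id, ← mul_assoc, ← mul_pow]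
  simp

theorem dsc_vander {L : Type*} [Field L] (n : ℕ) (hn : 1 ≤ n) (c : ℤ) (θ : Fin n → L)
    (hθ : (lcalZ n c).map (Int.castRingHom L) = ∏ j, (X - C (θ j))) :
    ((Matrix.vandermonde θ).det * (lcf n c 0 : L)) ^ 2 = (dsc n c : L) := by
  obtain ⟨m, rfl⟩ := Nat.exists_eq_add_of_le' hn
  set F := (lcalZ (m + 1) c).map (Int.castRingHom L) with hF
  set F0 := (lcalZ m c).map (Int.castRingHom L) with hF0
  have hmon : F.Monic := (lcalZ_monic _ _).map _
  have hdeg : F.natDegree = m + 1 := by rw [hF, (lcalZ_monic _ _).natDegree_map, lcalZ_natDegree]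
  have hdeg0 : F0.natDegree = m := by rw [hF0, (lcalZ_monic _ _).natDegree_map, lcalZ_natDegree]
  have hroots : F.roots = Finset.univ.val.map θ := by
    rw [hθ, Polynomial.roots_prod _ _ (Finset.prod_ne_zero_iff.mpr fun _ _ => X_sub_C_ne_zero _)]
    simp [Multiset.bind_singleton]
  have hsp : F.Splits := by
    rw [hθ]; exact Polynomial.Splits.prod fun _ _ => Polynomial.Splits.X_sub_C _
  have hres : (resP c m : L) = ∏ i, F0.eval (θ i) := by
    have h := resultant_eq_prod_eval F F0 m hdeg0.le hsp
    rw [hdeg, resultant_map_map, lcalZ_res, hmon.leadingCoeff, hroots, one_pow, one_mul, Multiset.map_map] at h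
    exact h
  have hder : ∀ i, θ i * (derivative F).eval (θ i) = -(((m + 1 : ℕ) : L) * (c + 2 * ((m + 1 : ℕ) : L))) * F0.eval (θ i) := by
    intro i
    have h := congrArg (fun q => (q.map (Int.castRingHom L)).eval (θ i)) (lcalZ_deriv m c)
    have h0 : F.eval (θ i) = 0 := by
      rw [hθ, eval_prod]; exact Finset.prod_eq_zero (Finset.mem_univ i) (by simp)
    simp only [Polynomial.map_mul, Polynomial.map_sub, map_X, map_C, eval_mul, eval_sub, eval_X, eval_C,
      ← derivative_map, ← hF, ← hF0, h0] at h
    rw [h]; push_cast [eq_intCast]; ring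
  have hprod : (lcf (m + 1) c 0 : L) = (-1) ^ (m + 1) * ∏ i, θ i := by
    have h : F.eval 0 = (lcf (m + 1) c 0 : L) := by
      rw [← coeff_zero_eq_eval_zero, hF, coeff_map, lcalZ_coeff']; simp
    rw [← h, hθ, eval_prod]
    simp [Finset.prod_neg]
  have hall : (∏ i, θ i) * ∏ i, (derivative F).eval (θ i) =
      (-(((m + 1 : ℕ) : L) * (c + 2 * ((m + 1 : ℕ) : L)))) ^ (m + 1) * resP c m := by
    rw [← Finset.prod_mul_distrib, hres]
    simp_rw [hder]
    rw [Finset.prod_mul_distrib]; simp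
  have hv := vander_sq (m + 1) θ
  rw [← hθ] at hv
  have h1 : ((-1 : L) ^ (m + 1)) * (-1) ^ (m + 1) = 1 := by rw [← mul_pow]; simp
  have hall' : (lcf (m + 1) c 0 : L) * ∏ i, (derivative F).eval (θ i) =
      (((m + 1 : ℕ) : L) * (c + 2 * ((m + 1 : ℕ) : L))) ^ (m + 1) * resP c m := by
    rw [hprod, mul_assoc, hall, neg_pow (((m + 1 : ℕ) : L) * _), ← mul_assoc, ← mul_assoc, h1, one_mul]
  rw [mul_pow, hv, dsc, Nat.add_sub_cancel]
  simp only [Int.cast_mul, Int.cast_pow, Int.cast_neg, Int.cast_one, Int.cast_natCast, Int.cast_add, Int.cast_ofNat]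
  linear_combination ((-1) ^ ((m + 1) * m / 2) * (lcf (m + 1) c 0 : L)) * hall'

theorem exists_rho {L : Type*} [Field L] [Algebra ℚ L] (f : ℚ[X]) [f.IsSplittingField ℚ L] (hm : f.Monic)
    (hirr : Irreducible f) (n : ℕ) (hn : f.natDegree = n) :
    ∃ θ : Fin n → L, Function.Injective θ ∧ f.map (algebraMap ℚ L) = ∏ j, (X - C (θ j)) ∧
      ∃ ρ : Gal(L/ℚ) →* Equiv.Perm (Fin n), Function.Injective ρ ∧ (∀ σ i, σ (θ i) = θ (ρ σ i)) ∧
        ∀ i j, ∃ σ, ρ σ i = j := by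
  classical
  have hsp : (f.map (algebraMap ℚ L)).Splits := IsSplittingField.splits L f
  have hcard : Fintype.card (f.rootSet L) = n := by
    rw [card_rootSet_eq_natDegree hirr.separable hsp, hn]
  have hmm : (f.map (algebraMap ℚ L)).Monic := hm.map _
  have hnd : (f.map (algebraMap ℚ L)).roots.Nodup := nodup_roots (hirr.separable.map)
  let e : Fin n ≃ f.rootSet L := (Fintype.equivFinOfCardEq hcard).symm
  let θ : Fin n → L := fun i => (e i : L)
  have hθi : Function.Injective θ := fun i j h => e.injective (Subtype.ext h)
  have hθr : ∀ i, aeval (θ i) f = 0 := fun i => (mem_rootSet.mp (e i).2).2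
  have hθs : ∀ x : L, aeval x f = 0 → ∃ i, θ i = x := fun x hx =>
    ⟨e.symm ⟨x, mem_rootSet.mpr ⟨hirr.ne_zero, hx⟩⟩, by simp [θ]⟩
  have hprod : f.map (algebraMap ℚ L) = ∏ j, (X - C (θ j)) := by
    rw [Splits.eq_prod_roots_of_monic hsp hmm]
    have h1 : (f.map (algebraMap ℚ L)).roots = (Finset.univ.val.map θ) := by
      refine (Multiset.Nodup.ext hnd (Finset.univ.nodup.map hθi)).mpr fun x => ?_
      rw [mem_roots hmm.ne_zero, IsRoot.def, eval_map_algebraMap]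
      constructor
      · intro h
        obtain ⟨i, hi⟩ := hθs x h
        exact Multiset.mem_map.mpr ⟨i, by simp, hi⟩
      · intro h
        obtain ⟨i, _, rfl⟩ := Multiset.mem_map.mp h
        exact hθr i
    rw [h1, Multiset.map_map]
    rfl
  refine ⟨θ, hθi, hprod, ?_⟩
  have hr : ∀ (σ : Gal(L/ℚ)) i, ∃ j, θ j = σ (θ i) := fun σ i => hθs _ (by
    rw [aeval_algEquiv]; simp [hθr i])
  choose r hr using hr
  let ρ0 : Gal(L/ℚ) →* Function.End (Fin n) :=
    { toFun := r
      map_one' := by funext i; apply hθi; rw [hr]; rfl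
      map_mul' := fun σ τ => by
        funext i; apply hθi
        change θ (r (σ * τ) i) = θ (r σ (r τ i))
        rw [hr, hr, hr]; rfl }
  have hρ : ∀ σ i, σ (θ i) = θ (ρ0.toHomPerm σ i) := fun σ i => (hr σ i).symm
  refine ⟨ρ0.toHomPerm, ?_, hρ, ?_⟩
  · rw [injective_iff_map_eq_one]
    intro σ hσ
    have : ∀ i, σ (θ i) = θ i := fun i => by rw [hρ, hσ]; rfl
    refine AlgEquiv.ext fun x => ?_
    have hx : x ∈ Algebra.adjoin ℚ (f.rootSet L) := by rw [IsSplittingField.adjoin_rootSet]; trivial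
    induction hx using Algebra.adjoin_induction with
    | mem x hx =>
      obtain ⟨i, rfl⟩ := hθs x (mem_rootSet.mp hx).2
      exact this i
    | algebraMap q => simp
    | add x y _ _ hx hy => rw [map_add, hx, hy, map_add]
    | mul x y _ _ hx hy => rw [map_mul, hx, hy, map_mul]
  · intro i j
    have hx := minpoly.eq_of_irreducible hirr (hθr i)
    have hy := minpoly.eq_of_irreducible hirr (hθr j)
    have : Normal ℚ L := Normal.of_isSplittingField f
    obtain ⟨g, hg⟩ := (Normal.minpoly_eq_iff_mem_orbit L).mp (hy.symm.trans hx)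
    refine ⟨g, hθi ?_⟩
    rw [← hρ]; exact hg

theorem vander_sign {L : Type*} [Field L] [Algebra ℚ L] (n : ℕ) (θ : Fin n → L) (σ : Gal(L/ℚ))
    (π : Equiv.Perm (Fin n)) (h : ∀ i, σ (θ i) = θ (π i)) :
    σ (Matrix.vandermonde θ).det = ((Equiv.Perm.sign π : ℤ) : L) * (Matrix.vandermonde θ).det := by
  rw [← Matrix.det_permute, AlgEquiv.map_det]
  congr 1
  ext i j
  simp [Matrix.vandermonde_apply, h]

theorem sign_of_sq {L : Type*} [Field L] [Algebra ℚ L] (n : ℕ) (hn : 1 ≤ n) (c : ℤ) (θ : Fin n → L)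
    (hθ : (lcalZ n c).map (Int.castRingHom L) = ∏ j, (X - C (θ j))) (h0 : dsc n c ≠ 0)
    (ρ : Gal(L/ℚ) →* Equiv.Perm (Fin n)) (hρ : ∀ σ i, σ (θ i) = θ (ρ σ i)) (t : ℤ) (ht : dsc n c = t ^ 2)
    (σ : Gal(L/ℚ)) : Equiv.Perm.sign (ρ σ) = 1 := by
  have : CharZero L := algebraRat.charZero L
  have h := dsc_vander n hn c θ hθ
  set W := (Matrix.vandermonde θ).det * (lcf n c 0 : L) with hW
  have hW0 : W ≠ 0 := by
    intro h1; rw [h1] at h; apply h0; simpa using h.symm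
  have h2 : σ W = ((Equiv.Perm.sign (ρ σ) : ℤ) : L) * W := by
    rw [hW, map_mul, vander_sign n θ σ (ρ σ) (hρ σ), map_intCast]; ring
  have h3 : σ W = W := by
    rw [ht] at h
    push_cast at h
    rcases sq_eq_sq_iff_eq_or_eq_neg.mp h with h4 | h4 <;> rw [h4] <;> simp
  rw [h3] at h2
  rcases Int.units_eq_one_or (Equiv.Perm.sign (ρ σ)) with h5 | h5
  · exact h5
  · exfalso
    rw [h5] at h2
    push_cast at h2
    apply hW0
    linear_combination h2 / 2

theorem sign_of_not_sq {L : Type*} [Field L] [Algebra ℚ L] [FiniteDimensional ℚ L] [IsGalois ℚ L] (n : ℕ) (hn : 1 ≤ n) (c : ℤ) (θ : Fin n → L)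
    (hθ : (lcalZ n c).map (Int.castRingHom L) = ∏ j, (X - C (θ j)))
    (ρ : Gal(L/ℚ) →* Equiv.Perm (Fin n)) (hρ : ∀ σ i, σ (θ i) = θ (ρ σ i)) (ht : ¬ IsSquare (dsc n c)) :
    ∃ σ, Equiv.Perm.sign (ρ σ) = -1 := by
  have : CharZero L := algebraRat.charZero L
  by_contra! hcon
  have h := dsc_vander n hn c θ hθ
  set W := (Matrix.vandermonde θ).det * (lcf n c 0 : L) with hW
  have h2 : ∀ σ : Gal(L/ℚ), σ W = W := fun σ => by
    have h5 : Equiv.Perm.sign (ρ σ) = 1 := (Int.units_eq_one_or _).resolve_right (hcon σ)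
    rw [hW, map_mul, vander_sign n θ σ (ρ σ) (hρ σ), map_intCast, h5]; simp
  obtain ⟨q, hq⟩ := (IsGalois.mem_range_algebraMap_iff_fixed (F := ℚ) W).mpr h2
  apply ht
  rw [← Rat.isSquare_intCast_iff]
  refine ⟨q, ?_⟩
  apply (algebraMap ℚ L).injective
  rw [map_mul, hq, ← sq, h]; simp

/-- Nonsquare test modulo small numbers. -/
def nsq (r : ℤ) : Bool :=
  decide (r < 0) || [3, 5, 7, 11, 13, 17, 19, 23, 29, 31, 37, 41, 43, 47, 53, 59, 61, 67, 71, 73, 79, 83, 89, 97, 101].any fun l => l != 0 && (List.range l).all fun i => ((i : ℤ) * i - r) % (l : ℤ) != 0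

theorem nsq_spec (r : ℤ) (h : nsq r = true) : ¬ IsSquare r := by
  rintro ⟨s, hs⟩
  simp only [nsq, Bool.or_eq_true, decide_eq_true_eq, List.any_eq_true, Bool.and_eq_true, List.all_eq_true,
    List.mem_range, bne_iff_ne, ne_eq] at h
  rcases h with h | ⟨l, _, hl0, hl⟩
  · nlinarith
  · have hl' : (0 : ℤ) < l := by omega
    have h1 := Int.emod_nonneg s hl'.ne'
    have h2 := Int.emod_lt_of_pos s hl'
    apply hl (s % l).toNat (by omega)
    rw [Int.toNat_of_nonneg h1, hs, Int.sub_emod, ← Int.mul_emod, sub_self, Int.zero_emod]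

theorem eq_top_of {n : ℕ} (G : Subgroup (Equiv.Perm (Fin n))) (h : alternatingGroup (Fin n) ≤ G)
    (hs : ∃ g ∈ G, Equiv.Perm.sign g = -1) : G = ⊤ := by
  obtain ⟨g, hg, hgs⟩ := hs
  rw [eq_top_iff]
  intro x _
  rcases Int.units_eq_one_or (Equiv.Perm.sign x) with h5 | h5
  · exact h (Equiv.Perm.mem_alternatingGroup.mpr h5)
  · have : x * g⁻¹ ∈ G := h (Equiv.Perm.mem_alternatingGroup.mpr (by simp [h5, hgs]))
    simpa using G.mul_mem this hg

theorem exists_frob (L : Type*) [Field L] [NumberField L] [IsGalois ℚ L] (q : ℕ) [hq : Fact q.Prime] :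
    ∃ Q : Ideal (NumberField.RingOfIntegers L), Q.IsMaximal ∧ (q : NumberField.RingOfIntegers L) ∈ Q ∧
      ∃ σ : Gal(L/ℚ), ∀ x, Ideal.Quotient.mk Q (σ • x) = (Ideal.Quotient.mk Q x) ^ q := by
  have hpp : Prime (q : ℤ) := Nat.prime_iff_prime_int.mp hq.out
  let P : Ideal ℤ := Ideal.span {(q : ℤ)}
  have hP0 : P ≠ ⊥ := by simpa [P] using hpp.ne_zero
  have hPp : P.IsPrime := (Ideal.span_singleton_prime hpp.ne_zero).mpr hpp
  obtain ⟨⟨Q, hQ, hQP⟩⟩ := (inferInstance : Nonempty (Ideal.primesOver P (NumberField.RingOfIntegers L)))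
  have hQ0 : Q ≠ ⊥ := Ideal.ne_bot_of_liesOver_of_ne_bot hP0 Q
  have hmax : Q.IsMaximal := hQ.isMaximal hQ0
  have hunder : Q.under ℤ = P := hQP.over.symm
  have hfin : Finite (NumberField.RingOfIntegers L ⧸ Q) := Ideal.finiteQuotientOfFreeOfNeBot Q hQ0
  have hcard : Nat.card (ℤ ⧸ Q.under ℤ) = q := by
    rw [hunder, Nat.card_congr (Int.quotientSpanNatEquivZMod q).toEquiv, Nat.card_zmod]
  refine ⟨Q, hmax, ?_, ?_⟩
  · have : (q : ℤ) ∈ Q.under ℤ := by rw [hunder]; exact Ideal.mem_span_singleton_self _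
    simpa [Ideal.under, Ideal.mem_comap] using this
  · have : Algebra.IsInvariant ℤ (NumberField.RingOfIntegers L) Gal(L/ℚ) := inferInstance
    obtain ⟨σ, hσ⟩ := IsArithFrobAt.exists_of_isInvariant ℤ Gal(L/ℚ) Q
    refine ⟨σ, fun x => ?_⟩
    have := hσ.mk_apply x
    rw [hcard] at this
    exact this

/-- evaluation of a coefficient list -/
noncomputable def evL {k : Type*} [CommRing k] (t : k) (l : List ℤ) : k := ((ofL l).map (Int.castRingHom k)).eval t

theorem evL_nil {k : Type*} [CommRing k] (t : k) : evL t [] = 0 := by simp [evL, ofL]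

theorem evL_cons {k : Type*} [CommRing k] (t : k) (x : ℤ) (l : List ℤ) : evL t (x :: l) = x + t * evL t l := by
  simp [evL, ofL]

theorem evL_add {k : Type*} [CommRing k] (t : k) (l l' : List ℤ) : evL t (addL l l') = evL t l + evL t l' := by
  simp [evL, ofL_addL]

theorem evL_smul {k : Type*} [CommRing k] (t : k) (a : ℤ) (l : List ℤ) : evL t (smulL a l) = a * evL t l := by
  simp [evL, ofL_smulL]

def rdL (q : ℕ) : List ℤ → List ℤ
  | [] => []
  | x :: xs => x % (q : ℤ) :: rdL q xs

theorem evL_rd {k : Type*} [CommRing k] (q : ℕ) [CharP k q] (t : k) : ∀ l, evL t (rdL q l) = evL t l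
  | [] => rfl
  | x :: xs => by
    have : ((x % (q : ℤ) : ℤ) : k) = (x : k) := (CharP.intCast_eq_intCast k q).mpr (Int.mod_modEq x q)
    rw [rdL, evL_cons, evL_cons, evL_rd q t xs, this]

/-- last element and the list without it -/
def spL : List ℤ → List ℤ × ℤ
  | [] => ([], 0)
  | [x] => ([], x)
  | x :: y :: xs => let s := spL (y :: xs); (x :: s.1, s.2)

theorem evL_sp {k : Type*} [CommRing k] (t : k) : ∀ (x : ℤ) (l : List ℤ), evL t (x :: l) =
    evL t (spL (x :: l)).1 + (spL (x :: l)).2 * t ^ l.length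
  | x, [] => by simp [spL, evL_cons, evL_nil]
  | x, y :: xs => by
    rw [evL_cons, evL_sp t y xs, spL]
    simp only [evL_cons, List.length_cons]
    ring

/-- multiply by `X` modulo the monic polynomial with low coefficients `fl`, and mod q -/
def mxL (q : ℕ) (fl : List ℤ) (r : List ℤ) : List ℤ :=
  match r with
  | [] => []
  | x :: xs =>
    if (xs.length + 1).beq fl.length then
      let s := spL (x :: xs)
      rdL q (addL (0 :: s.1) (smulL (-s.2) fl))
    else 0 :: x :: xs

theorem evL_mx {k : Type*} [CommRing k] (q : ℕ) [CharP k q] (t : k) (fl : List ℤ) (hf : t ^ fl.length + evL t fl = 0)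
    (r : List ℤ) : evL t (mxL q fl r) = t * evL t r := by
  cases r with
  | nil => simp [mxL, evL_nil]
  | cons x xs =>
    rw [mxL]
    split_ifs with h
    · rw [Nat.beq_eq] at h
      simp only [evL_rd, evL_add, evL_smul]
      rw [evL_cons t 0, evL_sp t x xs]
      rw [← h, pow_succ] at hf
      push_cast
      linear_combination (-((spL (x :: xs)).2 : k)) * hf
    · rw [evL_cons]; simp

def mulL (q : ℕ) (fl : List ℤ) : List ℤ → List ℤ → List ℤ
  | [], _ => []
  | x :: xs, r => rdL q (addL (smulL x r) (mxL q fl (mulL q fl xs r)))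

theorem evL_mul {k : Type*} [CommRing k] (q : ℕ) [CharP k q] (t : k) (fl : List ℤ) (hf : t ^ fl.length + evL t fl = 0)
    (r : List ℤ) : ∀ l, evL t (mulL q fl l r) = evL t l * evL t r
  | [] => by simp [mulL, evL_nil]
  | x :: xs => by
    rw [mulL, evL_rd, evL_add, evL_smul, evL_mx q t fl hf, evL_mul q t fl hf r xs, evL_cons]; ring

def powL (q : ℕ) (fl : List ℤ) (r : List ℤ) : ℕ → ℕ → List ℤ
  | 0, _ => [0]
  | fuel + 1, e =>
    if e.beq 0 then [1]
    else
      let s := powL q fl r fuel (e / 2)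
      let s2 := mulL q fl s s
      if (e % 2).beq 0 then s2 else mulL q fl r s2

theorem evL_pow {k : Type*} [CommRing k] (q : ℕ) [CharP k q] (t : k) (fl : List ℤ) (hf : t ^ fl.length + evL t fl = 0)
    (r : List ℤ) : ∀ fuel e, e < 2 ^ fuel → evL t (powL q fl r (fuel + 1) e) = evL t r ^ e
  | fuel, e, he => by
    rw [powL]
    split_ifs with h0 h1
    · rw [Nat.beq_eq] at h0; subst h0; simp [evL_cons, evL_nil]
    all_goals
      rw [Nat.beq_eq] at h0 h1
      obtain ⟨fuel, rfl⟩ : ∃ f', fuel = f' + 1 := Nat.exists_eq_succ_of_ne_zero (by rintro rfl; simp at he; omega)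
      have ih := evL_pow q t fl hf r fuel (e / 2) (by rw [pow_succ] at he; omega)
      simp only [evL_mul q t fl hf, ih]
      rw [← pow_add]
    · congr 1; omega
    · rw [← pow_succ']; congr 1; omega

def frobL (q : ℕ) (fl : List ℤ) : ℕ → List ℤ
  | 0 => [0, 1]
  | m + 1 => powL q fl (frobL q fl m) 9 q

theorem evL_frob {k : Type*} [CommRing k] (q : ℕ) [CharP k q] (hq : q < 256) (t : k) (fl : List ℤ) (hf : t ^ fl.length + evL t fl = 0) :
    ∀ m, evL t (frobL q fl m) = t ^ (q ^ m)
  | 0 => by simp [frobL, evL_cons, evL_nil]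
  | m + 1 => by
    rw [frobL, evL_pow q t fl hf _ 8 q hq, evL_frob q hq t fl hf m, ← pow_mul, pow_succ]

structure SwapCert where
  q : ℕ
  m : ℕ
  h0 : ℤ
  h1 : ℤ

def SwapCert.ok (s : SwapCert) (n : ℕ) (c : ℤ) : Bool :=
  let fl := (spL (coefL n c)).1
  let W := frobL s.q fl s.m
  let D := rdL s.q (addL W [0, -1])
  (isP s.q || s.q.beq 109) && fl.length.beq n && (spL (coefL n c)).2 == 1 && (coefL n c).length.beq (n + 1) &&
    dsc n c % s.q != 0 && Nat.ble D.length n && D.any (fun x => x != 0) &&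
    (mulL s.q fl [s.h0, s.h1, 1] D).all fun x => x == 0

theorem rdL_mod (q : ℕ) (hq : q ≠ 0) : ∀ l, ∀ x ∈ rdL q l, 0 ≤ x ∧ x < q
  | [], x, hx => by simp [rdL] at hx
  | y :: ys, x, hx => by
    rw [rdL, List.mem_cons] at hx
    rcases hx with rfl | hx
    · exact ⟨Int.emod_nonneg _ (by omega), Int.emod_lt_of_pos _ (by omega)⟩
    · exact rdL_mod q hq ys x hx

theorem evL_zero {k : Type*} [CommRing k] (t : k) : ∀ l : List ℤ, (∀ x ∈ l, x = 0) → evL t l = 0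
  | [], _ => evL_nil t
  | y :: ys, h => by
    rw [evL_cons, evL_zero t ys fun x hx => h x (List.mem_cons_of_mem _ hx), h y List.mem_cons_self]; simp

theorem ofL_natDegree_lt (n : ℕ) (hn : 0 < n) (l : List ℤ) (h : l.length ≤ n) : (ofL l).natDegree < n := by
  refine lt_of_le_of_lt (b := n - 1) (natDegree_le_iff_coeff_eq_zero.mpr ?_) (by omega)
  intro m hm
  rw [ofL_coeff, List.getD_eq_default _ _ (by omega)]

theorem SwapCert.isSwap (s : SwapCert) (n : ℕ) (hn : 1 ≤ n) (c : ℤ) (hs : s.ok n c = true)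
    (L : Type*) [Field L] [NumberField L] [IsGalois ℚ L] (θ : Fin n → L)
    (hθ : (lcalZ n c).map (Int.castRingHom L) = ∏ j, (X - C (θ j)))
    (ρ : Gal(L/ℚ) →* Equiv.Perm (Fin n)) (hρ : ∀ σ i, σ (θ i) = θ (ρ σ i)) (hθi : Function.Injective θ) :
    ∃ σ, (ρ σ).IsSwap := by
  classical
  obtain ⟨q, m, h0, h1⟩ := s
  simp only [SwapCert.ok, Bool.and_eq_true, Bool.or_eq_true, Nat.beq_eq, beq_iff_eq, bne_iff_ne, ne_eq, Nat.ble_eq,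
    List.any_eq_true, List.all_eq_true] at hs
  obtain ⟨⟨⟨⟨⟨⟨⟨hq, hfl⟩, hlast⟩, hlen⟩, hd⟩, hD⟩, hD0⟩, hmul⟩ := hs
  have hqp : q.Prime := by
    rcases hq with hq | rfl
    · exact isP_prime hq
    · norm_num
  have hq256 : q < 256 := by
    rcases hq with hq | rfl
    · simp only [isP, List.any_cons, List.any_nil, Bool.or_eq_true, Nat.beq_eq, Bool.false_eq_true, or_false] at hq
      omega
    · norm_num
  have : Fact q.Prime := ⟨hqp⟩
  set fl := (spL (coefL n c)).1 with hfldef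
  set W := frobL q fl m with hW
  set D := rdL q (addL W [0, -1]) with hDdef
  obtain ⟨Q, hQ, hqQ, σ, hσ⟩ := exists_frob L q
  let k := NumberField.RingOfIntegers L ⧸ Q
  let φ : NumberField.RingOfIntegers L →+* k := Ideal.Quotient.mk Q
  letI : Field k := Ideal.Quotient.field Q
  have hqk : (q : k) = 0 := by
    have := Ideal.Quotient.eq_zero_iff_mem.mpr hqQ
    simpa using this
  have : CharP k q := by
    obtain ⟨r, hr⟩ := CharP.exists k
    have h5 := (CharP.cast_eq_zero_iff k r q).mp hqk
    rcases (Nat.dvd_prime hqp).mp h5 with h6 | h6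
    · exact absurd h6 (CharP.char_ne_one k r)
    · rw [← h6]; exact hr
  -- lift the roots
  have hIntg : ∀ i, IsIntegral ℤ (θ i) := fun i => ⟨lcalZ n c, lcalZ_monic n c, by
    rw [← eval_map]
    change eval _ ((lcalZ n c).map (Int.castRingHom L)) = 0
    rw [hθ, eval_prod]; exact Finset.prod_eq_zero (Finset.mem_univ i) (by simp)⟩
  let a : Fin n → NumberField.RingOfIntegers L := fun i => ⟨θ i, hIntg i⟩
  have ha : ∀ i, (a i : L) = θ i := fun i => rfl
  have hinj : Function.Injective (algebraMap (NumberField.RingOfIntegers L) L) := NumberField.RingOfIntegers.coe_injective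
  have hFa : (lcalZ n c).map (Int.castRingHom (NumberField.RingOfIntegers L)) = ∏ j, (X - C (a j)) := by
    apply Polynomial.map_injective _ hinj
    rw [Polynomial.map_map, Polynomial.map_prod]
    simp only [Polynomial.map_sub, map_X, map_C]
    rw [RingHom.ext_int ((algebraMap (NumberField.RingOfIntegers L) L).comp (Int.castRingHom _)) (Int.castRingHom L)]
    exact hθ
  let t : Fin n → k := fun i => φ (a i)
  have hFt : (lcalZ n c).map (Int.castRingHom k) = ∏ j, (X - C (t j)) := by
    have := congrArg (Polynomial.map φ) hFa
    rw [Polynomial.map_map, Polynomial.map_prod] at this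
    simp only [Polynomial.map_sub, map_X, map_C] at this
    rw [RingHom.ext_int (φ.comp (Int.castRingHom _)) (Int.castRingHom k)] at this
    exact this
  have htinj : Function.Injective t := by
    have h := dsc_vander n hn c t hFt
    rw [← Matrix.det_vandermonde_ne_zero_iff]
    intro h0
    rw [h0, zero_mul, zero_pow two_ne_zero] at h
    exact hd (Int.emod_eq_zero_of_dvd ((CharP.intCast_eq_zero_iff k q _).mp h.symm))
  have hft : ∀ i, t i ^ fl.length + evL (t i) fl = 0 := by
    intro i
    have h2 : evL (t i) (coefL n c) = 0 := by
      rw [evL, ofL_coefL, hFt, eval_prod]; exact Finset.prod_eq_zero (Finset.mem_univ i) (by simp)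
    obtain ⟨x, xs, hxs⟩ : ∃ x xs, coefL n c = x :: xs := by
      cases hc : coefL n c with
      | nil => rw [hc] at hlen; simp at hlen
      | cons x xs => exact ⟨x, xs, rfl⟩
    have h3 : xs.length = n := by rw [hxs] at hlen; simpa using hlen
    rw [hxs, evL_sp, ← hxs, hlast, h3] at h2
    rw [hfl, ← h2, hfldef]; simp; ring
  -- Frobenius acts on the reductions
  have hσt : ∀ τ : Gal(L/ℚ), ∀ i, φ (τ • a i) = t (ρ τ i) := by
    intro τ i
    change φ (τ • a i) = φ (a (ρ τ i))
    congr 1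
    apply hinj
    change algebraMap _ L (τ • a i) = θ (ρ τ i)
    rw [← hρ]
    rfl
  have hpow : ∀ (e : ℕ) x, φ ((σ ^ e) • x) = φ x ^ (q ^ e) := by
    intro e
    induction e with
    | zero => intro x; simp
    | succ e ih =>
      intro x
      rw [pow_succ', mul_smul]
      change Ideal.Quotient.mk Q _ = _
      rw [hσ]
      change (φ _) ^ q = _
      rw [ih, ← pow_mul, pow_succ]
  have hev : ∀ i, t (ρ (σ ^ m) i) - t i = evL (t i) D := by
    intro i
    rw [← hσt, hpow, hDdef, evL_rd, evL_add, hW, evL_frob q hq256 (t i) fl (hft i)]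
    simp [evL_cons, evL_nil, t]; ring
  have hne : ρ (σ ^ m) ≠ 1 := by
    intro h1
    have hz : ∀ i, evL (t i) D = 0 := fun i => by rw [← hev, h1]; simp
    have hpoly : (ofL D).map (Int.castRingHom k) = 0 := by
      apply Polynomial.eq_zero_of_natDegree_lt_card_of_eval_eq_zero _ htinj hz
      rw [Fintype.card_fin]
      exact lt_of_le_of_lt natDegree_map_le (ofL_natDegree_lt n hn D hD)
    obtain ⟨x, hx, hx0⟩ := hD0
    obtain ⟨j, hj, hjx⟩ := List.mem_iff_getElem.mp hx
    have h2 := congrArg (fun p => p.coeff j) hpoly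
    simp only [coeff_map, ofL_coeff, coeff_zero] at h2
    rw [List.getD_eq_getElem _ _ hj, hjx] at h2
    have h3 := (CharP.intCast_eq_zero_iff k q x).mp (by simpa using h2)
    obtain ⟨h4, h5⟩ := rdL_mod q hqp.ne_zero _ x hx
    exact hx0 (Int.eq_zero_of_dvd_of_nonneg_of_lt h4 h5 h3)
  refine ⟨σ ^ m, ?_⟩
  rw [← Equiv.Perm.card_support_eq_two]
  have hle : (ρ (σ ^ m)).support.card ≤ 2 := by
    let h : k[X] := X ^ 2 + C (h1 : k) * X + C (h0 : k)
    have hh : h.natDegree = 2 := by simp only [h]; compute_degree!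
    have hh0 : h ≠ 0 := by intro h0; rw [h0] at hh; simp at hh
    have hsub : (ρ (σ ^ m)).support.image t ⊆ h.roots.toFinset := by
      intro x hx
      obtain ⟨i, hi, rfl⟩ := Finset.mem_image.mp hx
      rw [Multiset.mem_toFinset, mem_roots hh0, IsRoot.def]
      have h2 := evL_mul q (t i) fl (hft i) D [h0, h1, 1]
      rw [evL_zero _ _ hmul, ← hev] at h2
      have h3 : t (ρ (σ ^ m) i) - t i ≠ 0 := fun h4 =>
        (Equiv.Perm.mem_support.mp hi) (htinj (sub_eq_zero.mp h4))
      have h4 := (mul_eq_zero.mp h2.symm).resolve_right h3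
      simp only [evL_cons, evL_nil] at h4
      simp only [h, eval_add, eval_pow, eval_X, eval_mul, eval_C]
      rw [← h4]; push_cast; ring
    calc (ρ (σ ^ m)).support.card = ((ρ (σ ^ m)).support.image t).card := (Finset.card_image_of_injective _ htinj).symm
      _ ≤ h.roots.toFinset.card := Finset.card_le_card hsub
      _ ≤ h.roots.card := Multiset.toFinset_card_le _
      _ ≤ 2 := hh ▸ card_roots' h
  have h2 : (ρ (σ ^ m)).support.card ≠ 0 := by
    rw [Ne, Finset.card_eq_zero, Equiv.Perm.support_eq_empty_iff]; exact hne
  have h3 := Equiv.Perm.card_support_ne_one (ρ (σ ^ m))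
  omega

set_option maxRecDepth 100000
def swOk (n : ℕ) : ℤ → List SwapCert → Bool
  | _, [] => true
  | u, s :: ss => s.ok n (2 * u + 1) && swOk n (u + 1) ss

def sw2 : List SwapCert := [⟨5, 1, 3, 3⟩, ⟨3, 1, 2, 2⟩, ⟨13, 1, 3, 11⟩, ⟨7, 1, 3, 6⟩, ⟨3, 1, 2, 2⟩, ⟨5, 1, 3, 3⟩, ⟨5, 1, 4, 2⟩, ⟨3, 1, 2, 2⟩, ⟨7, 1, 3, 5⟩, ⟨11, 1, 8, 7⟩, ⟨3, 1, 2, 2⟩, ⟨5, 1, 4, 2⟩, ⟨11, 1, 8, 8⟩, ⟨3, 1, 2, 2⟩, ⟨13, 1, 2, 7⟩, ⟨5, 1, 3, 3⟩, ⟨3, 1, 2, 2⟩]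

theorem sw2_ok : swOk 2 (-18) sw2 = true := by decide +kernel
def sw3 : List SwapCert := [⟨7, 1, 6, 3⟩, ⟨11, 1, 5, 4⟩, ⟨7, 1, 2, 0⟩, ⟨13, 1, 2, 4⟩, ⟨13, 1, 8, 5⟩, ⟨11, 1, 1, 1⟩, ⟨11, 1, 1, 0⟩, ⟨7, 1, 6, 3⟩, ⟨29, 1, 2, 9⟩, ⟨7, 1, 2, 0⟩, ⟨19, 1, 1, 6⟩, ⟨13, 1, 7, 0⟩, ⟨11, 1, 5, 4⟩, ⟨19, 1, 8, 16⟩, ⟨7, 1, 6, 3⟩, ⟨13, 1, 8, 1⟩, ⟨7, 1, 2, 0⟩]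

theorem sw3_ok : swOk 3 (-18) sw3 = true := by decide +kernel
def sw4 : List SwapCert := [⟨47, 1, 8, 2⟩, ⟨7, 1, 5, 5⟩, ⟨17, 1, 12, 0⟩, ⟨11, 1, 8, 3⟩, ⟨53, 1, 38, 7⟩, ⟨37, 1, 11, 27⟩, ⟨11, 1, 9, 8⟩, ⟨31, 1, 17, 7⟩, ⟨7, 1, 5, 5⟩, ⟨29, 1, 12, 27⟩, ⟨19, 1, 10, 15⟩, ⟨23, 1, 9, 3⟩, ⟨11, 1, 1, 6⟩, ⟨19, 1, 3, 8⟩, ⟨11, 1, 8, 3⟩, ⟨7, 1, 5, 5⟩, ⟨13, 1, 5, 5⟩]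

theorem sw4_ok : swOk 4 (-18) sw4 = true := by decide +kernel
def sw5 : List SwapCert := [⟨19, 3, 4, 8⟩, ⟨13, 3, 4, 7⟩, ⟨13, 1, 7, 3⟩, ⟨11, 3, 5, 4⟩, ⟨43, 1, 24, 40⟩, ⟨29, 1, 20, 13⟩, ⟨29, 3, 21, 13⟩, ⟨31, 3, 3, 2⟩, ⟨31, 3, 17, 25⟩, ⟨59, 3, 29, 2⟩, ⟨23, 1, 3, 12⟩, ⟨29, 3, 3, 26⟩, ⟨61, 3, 33, 41⟩, ⟨19, 3, 8, 8⟩, ⟨11, 3, 5, 4⟩, ⟨13, 1, 7, 3⟩, ⟨17, 3, 13, 7⟩]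

theorem sw5_ok : swOk 5 (-18) sw5 = true := by decide +kernel
def sw6 : List SwapCert := [⟨7, 3, 1, 0⟩, ⟨19, 1, 3, 8⟩, ⟨41, 3, 2, 24⟩, ⟨61, 3, 15, 27⟩, ⟨47, 3, 21, 4⟩, ⟨59, 1, 57, 20⟩, ⟨47, 3, 43, 29⟩, ⟨7, 3, 1, 0⟩, ⟨37, 3, 7, 11⟩, ⟨31, 3, 21, 24⟩, ⟨47, 3, 15, 3⟩, ⟨13, 3, 10, 9⟩, ⟨13, 3, 3, 1⟩, ⟨13, 3, 10, 8⟩, ⟨7, 3, 1, 0⟩, ⟨23, 3, 13, 5⟩, ⟨17, 3, 10, 14⟩]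

theorem sw6_ok : swOk 6 (-18) sw6 = true := by decide +kernel
def sw7 : List SwapCert := [⟨19, 5, 3, 9⟩, ⟨37, 5, 28, 33⟩, ⟨109, 5, 87, 52⟩, ⟨11, 3, 7, 10⟩, ⟨53, 3, 30, 29⟩, ⟨43, 5, 10, 14⟩, ⟨59, 3, 58, 23⟩, ⟨29, 5, 21, 4⟩, ⟨37, 5, 8, 21⟩, ⟨31, 5, 3, 10⟩, ⟨41, 3, 20, 14⟩, ⟨19, 5, 13, 3⟩, ⟨17, 5, 15, 7⟩, ⟨19, 3, 2, 4⟩, ⟨11, 3, 7, 10⟩, ⟨17, 3, 5, 7⟩, ⟨43, 3, 33, 6⟩]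

theorem sw7_ok : swOk 7 (-18) sw7 = true := by decide +kernel

set_option maxRecDepth 100000

/-- the exceptional pairs with a square root of the discriminant -/
def excL : List (ℕ × ℤ × ℤ) :=
  [(8, -5, 15990969487175398195200000000),
    (8, -6, 899117401403031552000000000),
    (9, -5, 297371002478667455882596869734400000000),
    (9, -6, 4759023816531029243662958592000000000),
    (16, -9, 115847276721098952424001689964040469889297869029034205915029375910699220806138064623029045959744128875713024491520000000000000000000000000000000000),
    (16, -10, 103841875645784539833375434172474820799008755214068152470442397491219418098201886851164985684120011381886869479358464000000000000000000000000000),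
    (24, -13, 4637317905478804916483627524233629782795070527689370434961203667606805572626518359457676903413224719683777146732622195188120717388884112753672204618408007872333705470198677821405078417345251630535324531929573319543937972924884900328680505174531682624256602581627691313723702228719407230075357190601949828363348872727101440000000000000000000000000000000000000000000000000000),
    (24, -14, 72736729204761599942717573324837114633740139453158986609768017163205511062408084527367911825327190370797166333675330262553638499106901577285428560938525390094040690302547353605221578468761302294893901562253825394119647385302299287159281220758768938631146763114499373727719186507095025255788216041598969823048499200000000000000000000000000000000000000000000000000000000),
    (25, -13, 8435232130939411793376398280513294199036082368710359214603529230965806296128936736672907324488232406445198915630721230969576422264952475877493642871573698125455312893243313413049833647792641623773896811925757573670012739830571991349062055041088902042714112361186728437539754356693096688241634529916973094010880000000000000000000000000000000000000000000000000000000000000000000000000000000000000000000000000000000),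
    (25, -14, 44753364706452679631381763606752009249696105165933126783435114378062922559774857980890839575187750163683778653833797853177919700968814896712397006225559827666824479085015095562129044768466632946910784956423119346490367816480841788854364027362921317910748483885203738053289479329654075144432099406611652404385969078327163486208000000000000000000000000000000000000000000000000000000000000000000000000000000000),
    (32, -17, 99045475117322527675148628859601376613306997633141191981863093134778039126873224257238167770569128777144593648592699671818201641945443961385596924049312304432557378648682454301687911158024297844230552666117313787441840667850703107339285633864398441324696113952995944993797319220223436492034423752627190387031003325112500051393939249209741190196238847008690378772479497657707143583610814588946725283470551597549820410547100720165631412522077846961988732220991308145007674090162700754766389343447146055492445209204540721803501254754502230569647059579541465458968333874692654340111335424000000000000000000000000000000000000000000000000000000000000000000000000000000000000000000000000000000000000000000000000000000000000000),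
    (32, -18, 27814548010445801139566248223886818134388928236491028418504600948327867915105478365397326927972837927822081761051573667579846271465488985616555929007979569096331893213676220115188196554662514081331822309253875267335145238722686078974524467660026486305862347828784191611886921156539208864034594536701496543417258164085460616255660592076267235101184324164307857864442519100818844819223323256806084031483557440717648881927327529374224419828858359119628556010284541689133238378435384936042501820354623520581276543239106177515466349190621475587000138329865322595860256687537520640000000000000000000000000000000000000000000000000000000000000000000000000000000000000000000000000000000000000000000000000000000000000000000)]

def excB (n : ℕ) (u : ℤ) : Bool := excL.any fun e => e.1.beq n && e.2.1 == u

theorem excL_ok : (excL.all fun e => dsc e.1 (2 * e.2.1 + 1) == e.2.2 ^ 2 && e.2.2 != 0) = true := by decide +kernel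

def dRow (n : ℕ) : Bool := (List.range 17).all fun i =>
  excB n (-18 + (i : ℤ)) || nsq (dsc n (2 * (-18 + (i : ℤ)) + 1))

theorem dRow_ok : ((List.range 41).all fun n => Nat.blt n 8 || dRow n) = true := by decide +kernel

theorem excB_iff (n : ℕ) (u : ℤ) : excB n u = true ↔ ((n : ℤ), u) ∈ exceptionalSet := by
  have h : ∀ k : ℕ, k = n ↔ (n : ℤ) = (k : ℤ) := fun k => by omega
  simp only [excB, excL, List.any_cons, List.any_nil, Bool.or_false, Bool.or_eq_true, Bool.and_eq_true, Nat.beq_eq,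
    beq_iff_eq, exceptionalSet, Set.mem_insert_iff, Set.mem_singleton_iff, Prod.mk.injEq, h, Nat.cast_ofNat,
    @eq_comm ℤ _ u]

theorem exc_sq (n : ℕ) (u : ℤ) (h : excB n u = true) : ∃ t : ℤ, t ≠ 0 ∧ dsc n (2 * u + 1) = t ^ 2 := by
  rw [excB, List.any_eq_true] at h
  obtain ⟨⟨m, v, t⟩, he, h⟩ := h
  simp only [Bool.and_eq_true, Nat.beq_eq, beq_iff_eq] at h
  obtain ⟨rfl, rfl⟩ := h
  have := (List.all_eq_true.mp excL_ok) _ he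
  simp only [Bool.and_eq_true, beq_iff_eq, bne_iff_ne, ne_eq] at this
  exact ⟨t, this.2, this.1⟩

theorem exc_ge (n : ℕ) (u : ℤ) (h : excB n u = true) : 8 ≤ n := by
  rw [excB_iff] at h
  simp only [exceptionalSet, Set.mem_insert_iff, Set.mem_singleton_iff, Prod.mk.injEq] at h
  omega

theorem nexc_nsq (n : ℕ) (h8 : 8 ≤ n) (h40 : n ≤ 40) (u : ℤ) (hu1 : -18 ≤ u) (hu2 : u ≤ -2) (h : ¬ excB n u = true) :
    ¬ IsSquare (dsc n (2 * u + 1)) := by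
  obtain ⟨i, hi⟩ := Int.eq_ofNat_of_zero_le (show 0 ≤ u + 18 by omega)
  obtain rfl : u = -18 + (i : ℤ) := by omega
  have h1 := (List.all_eq_true.mp dRow_ok) n (List.mem_range.mpr (by omega))
  have h2 : Nat.blt n 8 = false := by
    rw [Bool.eq_false_iff, Ne, Nat.blt_eq]; omega
  rw [h2, Bool.false_or, dRow, List.all_eq_true] at h1
  have h3 := h1 i (List.mem_range.mpr (by omega))
  rw [Bool.or_eq_true] at h3
  exact nsq_spec _ (h3.resolve_left h)

def ppOk (n : ℕ) (es : List Entry) : Bool :=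
  es.all fun e => if Nat.ble 8 n then Nat.blt n (2 * e.pp) && Nat.ble (e.pp + 3) n
    else (!(n.beq 4 || n.beq 6) || Nat.blt n (2 * e.pp))

theorem rowOk_get (n : ℕ) : ∀ (es : List Entry) (u : ℤ) (i : ℕ), i < es.length → rowOk n u es = true →
    ∃ e ∈ es, e.ok n (u + i) = true
  | [], u, i, hi, _ => by simp at hi
  | e :: es, u, 0, _, h => by
    rw [rowOk, Bool.and_eq_true] at h
    exact ⟨e, List.mem_cons_self, by simpa using h.1⟩
  | e :: es, u, i + 1, hi, h => by
    rw [rowOk, Bool.and_eq_true] at h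
    obtain ⟨e', he', h'⟩ := rowOk_get n es (u + 1) i (by simpa using hi) h.2
    exact ⟨e', List.mem_cons_of_mem _ he', by rw [← h']; congr 1; push_cast; ring⟩

theorem swOk_get (n : ℕ) : ∀ (es : List SwapCert) (u : ℤ) (i : ℕ), i < es.length → swOk n u es = true →
    ∃ e : SwapCert, e.ok n (2 * (u + i) + 1) = true
  | [], u, i, hi, _ => by simp at hi
  | e :: es, u, 0, _, h => by
    rw [swOk, Bool.and_eq_true] at h
    exact ⟨e, by simpa using h.1⟩
  | e :: es, u, i + 1, hi, h => by
    rw [swOk, Bool.and_eq_true] at h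
    obtain ⟨e', h'⟩ := swOk_get n es (u + 1) i (by simpa using hi) h.2
    exact ⟨e', by rw [← h']; congr 1; push_cast; ring⟩

theorem rows_all (n : ℕ) (h2 : 2 ≤ n) (h40 : n ≤ 40) :
    ∃ es : List Entry, es.length = 17 ∧ rowOk n (-18) es = true ∧ ppOk n es = true := by
  interval_cases n
  · exact ⟨row2, rfl, row2_ok, by decide +kernel⟩
  · exact ⟨row3, rfl, row3_ok, by decide +kernel⟩
  · exact ⟨row4, rfl, row4_ok, by decide +kernel⟩
  · exact ⟨row5, rfl, row5_ok, by decide +kernel⟩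
  · exact ⟨row6, rfl, row6_ok, by decide +kernel⟩
  · exact ⟨row7, rfl, row7_ok, by decide +kernel⟩
  · exact ⟨row8, rfl, row8_ok, by decide +kernel⟩
  · exact ⟨row9, rfl, row9_ok, by decide +kernel⟩
  · exact ⟨row10, rfl, row10_ok, by decide +kernel⟩
  · exact ⟨row11, rfl, row11_ok, by decide +kernel⟩
  · exact ⟨row12, rfl, row12_ok, by decide +kernel⟩
  · exact ⟨row13, rfl, row13_ok, by decide +kernel⟩
  · exact ⟨row14, rfl, row14_ok, by decide +kernel⟩
  · exact ⟨row15, rfl, row15_ok, by decide +kernel⟩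
  · exact ⟨row16, rfl, row16_ok, by decide +kernel⟩
  · exact ⟨row17, rfl, row17_ok, by decide +kernel⟩
  · exact ⟨row18, rfl, row18_ok, by decide +kernel⟩
  · exact ⟨row19, rfl, row19_ok, by decide +kernel⟩
  · exact ⟨row20, rfl, row20_ok, by decide +kernel⟩
  · exact ⟨row21, rfl, row21_ok, by decide +kernel⟩
  · exact ⟨row22, rfl, row22_ok, by decide +kernel⟩
  · exact ⟨row23, rfl, row23_ok, by decide +kernel⟩
  · exact ⟨row24, rfl, row24_ok, by decide +kernel⟩
  · exact ⟨row25, rfl, row25_ok, by decide +kernel⟩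
  · exact ⟨row26, rfl, row26_ok, by decide +kernel⟩
  · exact ⟨row27, rfl, row27_ok, by decide +kernel⟩
  · exact ⟨row28, rfl, row28_ok, by decide +kernel⟩
  · exact ⟨row29, rfl, row29_ok, by decide +kernel⟩
  · exact ⟨row30, rfl, row30_ok, by decide +kernel⟩
  · exact ⟨row31, rfl, row31_ok, by decide +kernel⟩
  · exact ⟨row32, rfl, row32_ok, by decide +kernel⟩
  · exact ⟨row33, rfl, row33_ok, by decide +kernel⟩
  · exact ⟨row34, rfl, row34_ok, by decide +kernel⟩
  · exact ⟨row35, rfl, row35_ok, by decide +kernel⟩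
  · exact ⟨row36, rfl, row36_ok, by decide +kernel⟩
  · exact ⟨row37, rfl, row37_ok, by decide +kernel⟩
  · exact ⟨row38, rfl, row38_ok, by decide +kernel⟩
  · exact ⟨row39, rfl, row39_ok, by decide +kernel⟩
  · exact ⟨row40, rfl, row40_ok, by decide +kernel⟩

theorem sw_all (n : ℕ) (h2 : 2 ≤ n) (h7 : n ≤ 7) (u : ℤ) (hu1 : -18 ≤ u) (hu2 : u ≤ -2) :
    ∃ s : SwapCert, s.ok n (2 * u + 1) = true := by
  obtain ⟨i, hi⟩ := Int.eq_ofNat_of_zero_le (show 0 ≤ u + 18 by omega)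
  obtain rfl : u = -18 + (i : ℤ) := by omega
  have hi' : i < 17 := by omega
  interval_cases n
  · exact swOk_get 2 sw2 (-18) i hi' sw2_ok
  · exact swOk_get 3 sw3 (-18) i hi' sw3_ok
  · exact swOk_get 4 sw4 (-18) i hi' sw4_ok
  · exact swOk_get 5 sw5 (-18) i hi' sw5_ok
  · exact swOk_get 6 sw6 (-18) i hi' sw6_ok
  · exact swOk_get 7 sw7 (-18) i hi' sw7_ok

theorem entry_all (n : ℕ) (h2 : 2 ≤ n) (h40 : n ≤ 40) (u : ℤ) (hu1 : -18 ≤ u) (hu2 : u ≤ -2) :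
    ∃ e : Entry, e.ok n u = true ∧ (8 ≤ n → n < 2 * e.pp ∧ e.pp + 3 ≤ n) ∧ ((n = 4 ∨ n = 6) → n < 2 * e.pp) := by
  obtain ⟨i, hi⟩ := Int.eq_ofNat_of_zero_le (show 0 ≤ u + 18 by omega)
  obtain rfl : u = -18 + (i : ℤ) := by omega
  obtain ⟨es, hl, hr, hp⟩ := rows_all n h2 h40
  obtain ⟨e, he, hok⟩ := rowOk_get n es (-18) i (by omega) hr
  have h := (List.all_eq_true.mp hp) e he
  refine ⟨e, hok, fun h8 => ?_, fun h46 => ?_⟩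
  · rw [if_pos (Nat.ble_eq.mpr h8)] at h
    simpa using h
  · rw [if_neg (by rw [Nat.ble_eq]; omega)] at h
    rcases h46 with rfl | rfl <;> simpa using h

theorem gal_core (L : Type) [Field L] [CharZero L] (n : ℕ) (u : ℤ) (h2 : 2 ≤ n) (h40 : n ≤ 40)
    (hu1 : -18 ≤ u) (hu2 : u ≤ -2)
    [(lcal n u).IsSplittingField ℚ L] :
    (((n : ℤ), u) ∈ exceptionalSet →
        Nonempty (Gal(L/ℚ) ≃* alternatingGroup (Fin n))) ∧
    (((n : ℤ), u) ∉ exceptionalSet →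
        Nonempty (Gal(L/ℚ) ≃* Equiv.Perm (Fin n))) := by
  rw [← excB_iff]
  obtain ⟨e, hok, hpp8, hpp46⟩ := entry_all n h2 h40 u hu1 hu2
  rw [Entry.ok, Bool.and_eq_true, Bool.or_eq_true, Bool.and_eq_true, Nat.beq_eq] at hok
  obtain ⟨hirrc, hpp⟩ := hok
  have hmZ := lcalZ_monic n (2 * u + 1)
  have hdZ := lcalZ_natDegree n (2 * u + 1)
  have hm : (lcal n u).Monic := by rw [← lcalZ_map]; exact hmZ.map _
  have hd : (lcal n u).natDegree = n := by rw [← lcalZ_map, hmZ.natDegree_map, hdZ]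
  have hirr : Irreducible (lcal n u) := by
    rw [← lcalZ_map]
    exact irrChk2_irreducible _ hmZ (by omega) _ (ofL_coefL n _) e.certs e.mcs (by rw [hdZ]; exact hirrc)
  have : FiniteDimensional ℚ L := IsSplittingField.finiteDimensional L (lcal n u)
  have : NumberField L := { }
  have : IsGalois ℚ L := IsGalois.of_separable_splitting_field hirr.separable
  obtain ⟨θ, hθi, hθ', ρ, hρi, hρ, htr⟩ := exists_rho (L := L) (lcal n u) hm hirr n hd
  have hθ : (lcalZ n (2 * u + 1)).map (Int.castRingHom L) = ∏ j, (X - C (θ j)) := by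
    rw [← hθ', ← lcalZ_map, Polynomial.map_map]
    congr 1
    exact RingHom.ext_int _ _
  have hsplit : ((lcalZ n (2 * u + 1)).map (Int.castRingHom L)).Splits := by
    rw [hθ]
    exact Polynomial.Splits.prod fun i _ => Polynomial.Splits.X_sub_C _
  have hcard : Nat.card ρ.range = Nat.card Gal(L/ℚ) := (Nat.card_congr (MonoidHom.ofInjective hρi).toEquiv).symm
  have hpret : MulAction.IsPretransitive ρ.range (Fin n) := ⟨fun i j => by
    obtain ⟨σ, hσ⟩ := htr i j
    exact ⟨⟨ρ σ, σ, rfl⟩, hσ⟩⟩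
  have hdvd : e.pp ≠ 1 → e.pp.Prime ∧ e.pp ∣ Nat.card ρ.range := by
    intro h1
    obtain ⟨h3, h4⟩ := hpp.resolve_left h1
    rw [List.any_eq_true] at h4
    obtain ⟨c, hc, h5⟩ := h4
    rw [Nat.beq_eq] at h5
    refine ⟨isP_prime h3, (Nat.dvd_of_mod_eq_zero h5).trans ?_⟩
    rw [hcard]
    have hcok : c.ok (coefL n (2 * u + 1)) = true := by
      simp only [irrChk2, Bool.and_eq_true, List.all_eq_true] at hirrc
      exact hirrc.1.1 c hc
    exact c.dvd_card _ hmZ _ (ofL_coefL n _) hcok L hsplit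
  have equivTop : ρ.range = ⊤ → Nonempty (Gal(L/ℚ) ≃* Equiv.Perm (Fin n)) := fun htop =>
    ⟨((MonoidHom.ofInjective hρi).trans (MulEquiv.subgroupCongr htop)).trans Subgroup.topEquiv⟩
  rcases Nat.lt_or_ge n 8 with h8 | h8
  · refine ⟨fun h => absurd (exc_ge n u h) (by omega), fun _ => equivTop ?_⟩
    obtain ⟨s, hs⟩ := sw_all n h2 (by omega) u hu1 hu2
    obtain ⟨σ, hσ⟩ := s.isSwap n (by omega) _ hs L θ hθ ρ hρ hθi
    have hprim : MulAction.IsPreprimitive ρ.range (Fin n) := by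
      by_cases h46 : n = 4 ∨ n = 6
      · have h5 := hpp46 h46
        obtain ⟨h6, h7⟩ := hdvd (by omega)
        have : Fact e.pp.Prime := ⟨h6⟩
        obtain ⟨g, _, _, _, _, _, h⟩ := jordan_prim ρ.range e.pp (by simpa using h5) h7
        exact h
      · have hnp : n.Prime := by
          have : n = 2 ∨ n = 3 ∨ n = 5 ∨ n = 7 := by omega
          rcases this with rfl | rfl | rfl | rfl <;> norm_num
        exact MulAction.IsPreprimitive.of_prime_card (by simpa using hnp)
    exact Equiv.Perm.subgroup_eq_top_of_isPreprimitive_of_isSwap_mem hprim _ hσ ⟨σ, rfl⟩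
  · obtain ⟨h5, h5'⟩ := hpp8 h8
    obtain ⟨h6, h7⟩ := hdvd (by omega)
    have : Fact e.pp.Prime := ⟨h6⟩
    have hA : alternatingGroup (Fin n) ≤ ρ.range :=
      jordan_prime ρ.range e.pp (by simpa using h5) (by simpa using h5') h7
    refine ⟨fun hex => ?_, fun hex => equivTop ?_⟩
    · obtain ⟨t, ht0, ht⟩ := exc_sq n u hex
      have hAeq : ρ.range = alternatingGroup (Fin n) := by
        refine le_antisymm ?_ hA
        rintro _ ⟨σ, rfl⟩
        rw [Equiv.Perm.mem_alternatingGroup]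
        exact sign_of_sq n (by omega) _ θ hθ (by rw [ht]; exact pow_ne_zero 2 ht0) ρ hρ t ht σ
      exact ⟨(MonoidHom.ofInjective hρi).trans (MulEquiv.subgroupCongr hAeq)⟩
    · refine eq_top_of _ hA ?_
      obtain ⟨σ, hσ⟩ := sign_of_not_sq n (by omega) _ θ hθ ρ hρ (nexc_nsq n h8 h40 u hu1 hu2 hex)
      exact ⟨ρ σ, ⟨σ, rfl⟩, hσ⟩

/-- For `2 ≤ n ≤ 40` and `-18 ≤ u ≤ -2`, the Galois group of `𝓛_n^{(u)}(x)` over `ℚ` is the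
symmetric group `S_n`, except for the exceptional pairs `(n, u)`, where it is the alternating
group `A_n`. -/
theorem gal_lcal_small_degree (n : ℕ) (u : ℤ) (h2 : 2 ≤ n) (h40 : n ≤ 40)
    (hu1 : -18 ≤ u) (hu2 : u ≤ -2) :
    (((n : ℤ), u) ∈ exceptionalSet →
        Nonempty ((lcal n u).Gal ≃* alternatingGroup (Fin n))) ∧
    (((n : ℤ), u) ∉ exceptionalSet →
        Nonempty ((lcal n u).Gal ≃* Equiv.Perm (Fin n))) := by
  have key : ∀ (inst : Algebra ℚ (lcal n u).SplittingField), (lcal n u).IsSplittingField ℚ (lcal n u).SplittingField →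
    (((n : ℤ), u) ∈ exceptionalSet →
        Nonempty (Gal((lcal n u).SplittingField/ℚ) ≃* alternatingGroup (Fin n))) ∧
    (((n : ℤ), u) ∉ exceptionalSet →
        Nonempty (Gal((lcal n u).SplittingField/ℚ) ≃* Equiv.Perm (Fin n))) := by
    intro inst hsf
    have : CharZero (lcal n u).SplittingField := algebraRat.charZero _
    obtain rfl : inst = DivisionRing.toRatAlgebra := Subsingleton.elim _ _
    exact gal_core (lcal n u).SplittingField n u h2 h40 hu1 hu2
  exact key _ (Polynomial.IsSplittingField.splittingField (lcal n u))
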